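/- arXiv:1711.09359 — 4 statements merged into one kernel-verified Lean document; each statement's English description precedes it below -/
import Mathlib

section
/- Let T > 0. There is no constant C > 0 such that the observability inequality ‖u₀‖²_{L²(𝕋²)} ≤ C ∫₀ᵀ ‖𝒢∥(S(t)u₀)‖²_{L²(𝕋²)} dt holds for all u₀ ∈ L²₀(𝕋²); that is, observability for the linearized KP-II equation from a horizontal strip fails at every time T. -/
open MeasureTheory Real Filter

noncomputable section

instance : Fact (0 < 2 * Real.pi) := ⟨by positivity⟩

/-- The torus `𝕋 = ℝ/2πℤ`. -/
abbrev Torus := AddCircle (2 * Real.pi)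
/-- The two-dimensional torus `𝕋² = (ℝ/2πℤ)²`. -/
abbrev Torus2 := Torus × Torus

/-- `L²(𝕋)`. -/
abbrev L2T := Lp ℂ 2 (volume : Measure Torus)
/-- `L²(𝕋²)`. -/
abbrev L2T2 := Lp ℂ 2 (volume : Measure Torus2)

/-- 2D Fourier coefficient `û(k,l) = (1/4π²) ∫_{𝕋²} u(x,y) e^{-i(kx+ly)} dx dy`. -/
def fc2 (u : Torus2 → ℂ) (k l : ℤ) : ℂ :=
  (1 / (4 * Real.pi ^ 2)) * ∫ p : Torus2, fourier (-k) p.1 * fourier (-l) p.2 * u p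

/-- Membership in `L²₀(𝕋²)`: all Fourier coefficients `û(0,l)` vanish. -/
def MeanZero2 (u : L2T2) : Prop := ∀ l : ℤ, fc2 (u : Torus2 → ℂ) 0 l = 0

/-- The multiplier `e^{it(k³ - l²/k)}`. -/
def kpPhase (t : ℝ) (k l : ℤ) : ℂ :=
  Complex.exp (Complex.I * (t : ℂ) * ((k : ℂ) ^ 3 - (l : ℂ) ^ 2 / (k : ℂ)))

/-- Spectral characterization of the linearized KP-II unitary group `S(t)` on `L²₀(𝕋²)`:
`(S(t)u)^(k,l) = e^{it(k³ - l²/k)} û(k,l)` for `k ≠ 0`, and `S(t)` preserves `L²₀`. -/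
def IsKPGroup (S : ℝ → L2T2 →L[ℂ] L2T2) : Prop :=
  ∀ t : ℝ, ∀ u : L2T2, MeanZero2 u →
    MeanZero2 (S t u) ∧
      ∀ k l : ℤ, k ≠ 0 → fc2 (S t u : Torus2 → ℂ) k l = kpPhase t k l * fc2 (u : Torus2 → ℂ) k l

/-- `(𝒢⊥ h)(x,y) = g(x) (h(x,y) - ∫_𝕋 g(x') h(x',y) dx')` (a.e.). -/
def IsGperp (g : Torus → ℝ) (G : L2T2 →L[ℂ] L2T2) : Prop :=
  ∀ h : L2T2, ∀ᵐ p ∂(volume : Measure Torus2),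
    (G h : Torus2 → ℂ) p =
      (g p.1 : ℂ) * ((h : Torus2 → ℂ) p - ∫ x' : Torus, (g x' : ℂ) * (h : Torus2 → ℂ) (x', p.2))

/-- `(𝒢∥ h)(x,y) = g(y) (h(x,y) - ∫_𝕋 g(y') h(x,y') dy')` (a.e.). -/
def IsGpar (g : Torus → ℝ) (G : L2T2 →L[ℂ] L2T2) : Prop :=
  ∀ h : L2T2, ∀ᵐ p ∂(volume : Measure Torus2),
    (G h : Torus2 → ℂ) p =
      (g p.2 : ℂ) * ((h : Torus2 → ℂ) p - ∫ y' : Torus, (g y' : ℂ) * (h : Torus2 → ℂ) (p.1, y'))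

theorem integral_fourier (n : ℤ) :
    ∫ x : Torus, (fourier n x : ℂ) = if n = 0 then (2 * Real.pi : ℂ) else 0 := by
  split_ifs with h
  · simp [h, Measure.real, AddCircle.measure_univ, Real.pi_pos.le]
  · exact integral_eq_zero_of_add_right_eq_neg (μ := volume)
      (fourier_add_half_inv_index h Fact.out)

/-- The monomial `e^{i(kx+ly)}` on `𝕋²`. -/
def monomial2 (n : ℤ × ℤ) : C(Torus2, ℂ) where
  toFun p := fourier n.1 p.1 * fourier n.2 p.2
  continuous_toFun := by fun_prop

theorem monomial2_apply (n : ℤ × ℤ) (p : Torus2) :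
    monomial2 n p = fourier n.1 p.1 * fourier n.2 p.2 := rfl

theorem monomial2_neg (n : ℤ × ℤ) (p : Torus2) :
    monomial2 (-n) p = starRingEnd ℂ (monomial2 n p) := by
  simp only [monomial2_apply, Prod.fst_neg, Prod.snd_neg, fourier_neg, map_mul]

theorem monomial2_add (m n : ℤ × ℤ) (p : Torus2) :
    monomial2 (m + n) p = monomial2 m p * monomial2 n p := by
  simp only [monomial2_apply, Prod.fst_add, Prod.snd_add, fourier_add]
  ring

theorem integral_monomial2 (n : ℤ × ℤ) :
    ∫ p, monomial2 n p = if n = 0 then (4 * Real.pi ^ 2 : ℂ) else 0 := by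
  simp only [monomial2_apply]
  rw [Measure.volume_eq_prod,
    integral_prod_mul (fun x : Torus => (fourier n.1 x : ℂ)) fun y => (fourier n.2 y : ℂ),
    integral_fourier, integral_fourier]
  simp only [Prod.ext_iff, Prod.fst_zero, Prod.snd_zero]
  by_cases h1 : n.1 = 0 <;> by_cases h2 : n.2 = 0 <;> simp [h1, h2]
  ring

/-- The star subalgebra of `C(𝕋², ℂ)` generated by the monomials. -/
def monomial2Subalgebra : StarSubalgebra ℂ C(Torus2, ℂ) where
  toSubalgebra := Algebra.adjoin ℂ (Set.range monomial2)
  star_mem' := by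
    change Algebra.adjoin ℂ (Set.range monomial2) ≤
      star (Algebra.adjoin ℂ (Set.range monomial2))
    refine Algebra.adjoin_le ?_
    rintro _ ⟨n, rfl⟩
    refine Algebra.subset_adjoin ⟨-n, ?_⟩
    ext1 x
    simp only [monomial2_neg, starRingEnd_apply, ContinuousMap.star_apply]

theorem monomial2Subalgebra_coe :
    monomial2Subalgebra.toSubalgebra.toSubmodule = Submodule.span ℂ (Set.range monomial2) := by
  apply Algebra.adjoin_eq_span_of_subset
  refine .trans (fun x ↦ Submonoid.closure_induction (fun _ ↦ id) ⟨0, ?_⟩ ?_)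
    Submodule.subset_span
  · ext z
    simp [monomial2_apply]
  · rintro _ _ _ _ ⟨m, rfl⟩ ⟨n, rfl⟩
    exact ⟨m + n, ContinuousMap.ext (monomial2_add m n)⟩

theorem monomial2Subalgebra_separatesPoints : monomial2Subalgebra.SeparatesPoints := by
  intro x y hxy
  have hpi : (2 * Real.pi) ≠ 0 := by positivity
  by_cases h : x.1 = y.1
  · refine ⟨_, ⟨monomial2 (0, 1), Algebra.subset_adjoin ⟨_, rfl⟩, rfl⟩, ?_⟩
    have h2 : x.2 ≠ y.2 := fun h2 => hxy (Prod.ext h h2)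
    simp only [monomial2_apply, fourier_zero, one_mul, fourier_one, ne_eq]
    contrapose h2
    exact AddCircle.injective_toCircle hpi (Subtype.coe_injective h2)
  · refine ⟨_, ⟨monomial2 (1, 0), Algebra.subset_adjoin ⟨_, rfl⟩, rfl⟩, ?_⟩
    simp only [monomial2_apply, fourier_zero, mul_one, fourier_one, ne_eq]
    contrapose h
    exact AddCircle.injective_toCircle hpi (Subtype.coe_injective h)

theorem span_monomial2_closure_eq_top :
    (Submodule.span ℂ (Set.range monomial2)).topologicalClosure = ⊤ := by
  rw [← monomial2Subalgebra_coe]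
  exact congr_arg (Subalgebra.toSubmodule <| StarSubalgebra.toSubalgebra ·)
    (ContinuousMap.starSubalgebra_topologicalClosure_eq_top_of_separatesPoints _
      monomial2Subalgebra_separatesPoints)

/-- The normalized monomials `e^{i(kx+ly)} / 2π` in `L²(𝕋²)`. -/
def monomial2Lp (n : ℤ × ℤ) : L2T2 :=
  ContinuousMap.toLp (E := ℂ) 2 volume ℂ ((1 / (2 * Real.pi) : ℂ) • monomial2 n)

theorem inner_monomial2Lp (n : ℤ × ℤ) (u : L2T2) :
    inner ℂ (monomial2Lp n) u = 2 * Real.pi * fc2 u n.1 n.2 := by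
  have hpi : (Real.pi : ℂ) ≠ 0 := by exact_mod_cast Real.pi_ne_zero
  rw [L2.inner_def, fc2, ← mul_assoc, ← integral_const_mul]
  refine integral_congr_ae ?_
  filter_upwards [ContinuousMap.coeFn_toLp (p := 2) (𝕜 := ℂ) (volume : Measure Torus2)
    ((1 / (2 * Real.pi) : ℂ) • monomial2 n)] with p hp
  rw [monomial2Lp, hp]
  simp only [RCLike.inner_apply, ContinuousMap.smul_apply, smul_eq_mul, map_mul, monomial2_apply,
    fourier_neg, map_div₀, map_one, map_ofNat, Complex.conj_ofReal]
  field_simp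
  ring

theorem orthonormal_monomial2Lp : Orthonormal ℂ monomial2Lp := by
  have hpi : (Real.pi : ℂ) ≠ 0 := by exact_mod_cast Real.pi_ne_zero
  rw [orthonormal_iff_ite]
  intro m n
  have key : fc2 (monomial2Lp n) m.1 m.2 =
      1 / (4 * Real.pi ^ 2) * (1 / (2 * Real.pi) * ∫ p, monomial2 (-m + n) p) := by
    rw [fc2, ← integral_const_mul (1 / (2 * Real.pi) : ℂ)]
    congr 1
    refine integral_congr_ae ?_
    filter_upwards [ContinuousMap.coeFn_toLp (p := 2) (𝕜 := ℂ) (volume : Measure Torus2)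
      ((1 / (2 * Real.pi) : ℂ) • monomial2 n)] with p hp
    rw [monomial2Lp, hp, monomial2_add]
    simp only [ContinuousMap.smul_apply, smul_eq_mul, monomial2_apply, Prod.fst_neg, Prod.snd_neg]
    ring
  rw [inner_monomial2Lp, key, integral_monomial2]
  simp only [neg_add_eq_zero]
  split_ifs
  · field_simp
  · simp

theorem span_monomial2Lp_closure_eq_top :
    (Submodule.span ℂ (Set.range monomial2Lp)).topologicalClosure = ⊤ := by
  have h := (ContinuousMap.toLp_denseRange ℂ (volume : Measure Torus2) ℂ
    (p := 2) (by norm_num)).topologicalClosure_map_submodule span_monomial2_closure_eq_top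
  rw [eq_top_iff, ← h]
  refine Submodule.topologicalClosure_mono ?_
  rw [Submodule.map_span, Submodule.span_le]
  rintro _ ⟨_, ⟨n, rfl⟩, rfl⟩
  have hpi : (2 * Real.pi : ℂ) ≠ 0 := by
    exact_mod_cast (by positivity : (2 * Real.pi) ≠ 0)
  have : ContinuousMap.toLp (E := ℂ) 2 (volume : Measure Torus2) ℂ (monomial2 n) =
      (2 * Real.pi : ℂ) • monomial2Lp n := by
    rw [monomial2Lp, map_smul, smul_smul, mul_one_div_cancel hpi, one_smul]
  change ContinuousMap.toLp (E := ℂ) 2 (volume : Measure Torus2) ℂ (monomial2 n) ∈ _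
  rw [this]
  exact Submodule.smul_mem _ _ (Submodule.subset_span ⟨n, rfl⟩)

/-- The Fourier basis of `L²(𝕋²)`. -/
def fourierBasis2 : HilbertBasis (ℤ × ℤ) ℂ L2T2 :=
  HilbertBasis.mk orthonormal_monomial2Lp span_monomial2Lp_closure_eq_top.ge

theorem fourierBasis2_apply (n : ℤ × ℤ) : fourierBasis2 n = monomial2Lp n := by
  rw [fourierBasis2, HilbertBasis.coe_mk]

/-- Parseval's identity on `𝕋²`. -/
theorem hasSum_sq_fc2 (u : L2T2) :
    HasSum (fun n : ℤ × ℤ => 4 * Real.pi ^ 2 * ‖fc2 u n.1 n.2‖ ^ 2) (‖u‖ ^ 2) := by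
  have h := Complex.hasSum_re (fourierBasis2.hasSum_inner_mul_inner u u)
  rw [← RCLike.re_eq_complex_re, inner_self_eq_norm_sq] at h
  refine h.congr_fun fun n => ?_
  rw [← inner_conj_symm, fourierBasis2_apply, inner_monomial2Lp, ← Complex.normSq_eq_conj_mul_self,
    RCLike.re_eq_complex_re, Complex.ofReal_re, Complex.normSq_eq_norm_sq]
  simp only [norm_mul, Complex.norm_ofNat, Complex.norm_real, norm_of_nonneg pi_pos.le]
  ring

theorem fc2_sub_smul (u v : L2T2) (c : ℂ) (k l : ℤ) :
    fc2 (u - c • v : L2T2) k l = fc2 u k l - c * fc2 v k l := by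
  have hpi : (2 * Real.pi : ℂ) ≠ 0 := by
    exact_mod_cast (by positivity : (2 * Real.pi) ≠ 0)
  have h := inner_sub_right (𝕜 := ℂ) (monomial2Lp (k, l)) u (c • v)
  rw [inner_smul_right, inner_monomial2Lp, inner_monomial2Lp, inner_monomial2Lp] at h
  apply mul_left_cancel₀ hpi
  linear_combination h

theorem memLp_modulate {f : Torus → ℂ} (hf : Measurable f) (hb : ∀ y, ‖f y‖ ≤ 1) (k : ℤ) :
    MemLp (fun p : Torus2 => fourier k p.1 * f p.2) 2 volume := by
  refine MemLp.of_bound (Measurable.aestronglyMeasurable (by fun_prop)) 1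
    (Eventually.of_forall fun p => ?_)
  simpa [fourier_apply, Circle.norm_coe] using hb p.2

/-- The element `e^{ikx} f(y)` of `L²(𝕋²)`. -/
def modulate {f : Torus → ℂ} (hf : Measurable f) (hb : ∀ y, ‖f y‖ ≤ 1) (k : ℤ) : L2T2 :=
  (memLp_modulate hf hb k).toLp

section Modulate

variable {f : Torus → ℂ} (hf : Measurable f) (hb : ∀ y, ‖f y‖ ≤ 1)

theorem coeFn_modulate (k : ℤ) :
    (modulate hf hb k : Torus2 → ℂ) =ᵐ[volume] fun p => fourier k p.1 * f p.2 :=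
  (memLp_modulate hf hb k).coeFn_toLp

theorem norm_modulate (k : ℤ) : ‖modulate hf hb k‖ = ‖modulate hf hb 0‖ := by
  rw [modulate, modulate, Lp.norm_toLp, Lp.norm_toLp]
  congr 1
  refine eLpNorm_congr_norm_ae (Eventually.of_forall fun p => ?_)
  simp [fourier_apply, Circle.norm_coe]

theorem fc2_modulate (k m l : ℤ) :
    fc2 (modulate hf hb k) m l =
      if m = k then 1 / (2 * Real.pi) * ∫ y, (fourier (-l) y : ℂ) * f y else 0 := by
  have h : fc2 (modulate hf hb k) m l = 1 / (4 * Real.pi ^ 2) *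
      ∫ p : Torus2, (fourier (-m + k) p.1 : ℂ) * ((fourier (-l) p.2 : ℂ) * f p.2) := by
    rw [fc2]
    congr 1
    refine integral_congr_ae ?_
    filter_upwards [coeFn_modulate hf hb k] with p hp
    rw [hp, fourier_add]
    ring
  have hpi : (Real.pi : ℂ) ≠ 0 := by exact_mod_cast Real.pi_ne_zero
  rw [h, Measure.volume_eq_prod, integral_prod_mul (fun x : Torus => (fourier (-m + k) x : ℂ))
    fun y => (fourier (-l) y : ℂ) * f y, integral_fourier]
  simp only [neg_add_eq_zero]
  split_ifs
  · field_simp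
    ring
  · simp

theorem meanZero2_modulate {k : ℤ} (hk : k ≠ 0) : MeanZero2 (modulate hf hb k) := fun l => by
  rw [fc2_modulate, if_neg hk.symm]

theorem gpar_modulate_eq_zero {g : Torus → ℝ} {G : L2T2 →L[ℂ] L2T2} (hG : IsGpar g G)
    (hgf : ∀ y, (g y : ℂ) * f y = 0) (k : ℤ) : G (modulate hf hb k) = 0 := by
  rw [Lp.eq_zero_iff_ae_eq_zero]
  have h1 := coeFn_modulate hf hb k
  have h2 : ∀ᵐ p : Torus2, ∀ᵐ y : Torus,
      (modulate hf hb k : Torus2 → ℂ) (p.1, y) = fourier k p.1 * f y :=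
    Measure.quasiMeasurePreserving_fst.ae (Measure.ae_ae_of_ae_prod h1)
  filter_upwards [hG (modulate hf hb k), h1, h2] with p hp hp1 hp2
  have h3 : ∫ y', (g y' : ℂ) * (modulate hf hb k : Torus2 → ℂ) (p.1, y') = 0 := by
    refine integral_eq_zero_of_ae ?_
    filter_upwards [hp2] with y hy
    rw [hy, mul_left_comm, hgf, mul_zero, Pi.zero_apply]
  rw [hp, h3, hp1, sub_zero, mul_left_comm, hgf, mul_zero, Pi.zero_apply]

end Modulate

theorem norm_kpPhase (t : ℝ) (k l : ℤ) : ‖kpPhase t k l‖ = 1 := by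
  rw [kpPhase, mul_assoc, mul_comm]
  have h := Complex.norm_exp_ofReal_mul_I (t * ((k : ℝ) ^ 3 - (l : ℝ) ^ 2 / k))
  push_cast at h
  exact h

theorem norm_kpPhase_sub_le_two (t : ℝ) (k l : ℤ) : ‖kpPhase t k l - kpPhase t k 0‖ ≤ 2 := by
  calc _ ≤ _ := norm_sub_le _ _
    _ = 2 := by rw [norm_kpPhase, norm_kpPhase]; norm_num

theorem norm_kpPhase_sub_le (t : ℝ) (k l : ℤ) :
    ‖kpPhase t k l - kpPhase t k 0‖ ≤ |t| * ((l : ℝ) ^ 2 / |(k : ℝ)|) := by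
  have h : kpPhase t k l - kpPhase t k 0 = kpPhase t k 0 *
      (Complex.exp (Complex.I * ((-(t * ((l : ℝ) ^ 2 / k)) : ℝ) : ℂ)) - 1) := by
    rw [mul_sub, kpPhase, kpPhase, ← Complex.exp_add, mul_one]
    congr 2
    push_cast
    ring
  rw [h, norm_mul, norm_kpPhase, one_mul]
  refine Real.norm_exp_I_mul_ofReal_sub_one_le.trans_eq ?_
  simp

/-- For data of `x`-frequency `k → ∞`, the flow converges to a pure phase, uniformly on `[0, T]`. -/
theorem exists_tendsto_zero_bound_flow_modulate {S : ℝ → L2T2 →L[ℂ] L2T2} (hS : IsKPGroup S)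
    {f : Torus → ℂ} (hf : Measurable f) (hb : ∀ y, ‖f y‖ ≤ 1) (T : ℝ) :
    ∃ D : ℕ → ℝ, Tendsto D atTop (nhds 0) ∧ ∀ k : ℕ, k ≠ 0 → ∀ t, |t| ≤ T →
      ‖S t (modulate hf hb k) - kpPhase t k 0 • modulate hf hb k‖ ^ 2 ≤ D k := by
  have hsum := (hasSum_sq_fc2 (modulate hf hb 0)).summable
  set a : ℤ × ℤ → ℝ := fun n => 4 * Real.pi ^ 2 * ‖fc2 (modulate hf hb 0) n.1 n.2‖ ^ 2 with ha
  have ha0 : ∀ n, 0 ≤ a n := fun n => by positivity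
  let B : ℕ → ℤ × ℤ → ℝ := fun k n => min 2 (T * ((n.2 : ℝ) ^ 2 / k)) ^ 2 * a n
  have hdom : ∀ k : ℕ, 0 ≤ T → ∀ n, ‖B k n‖ ≤ 4 * a n := fun k hT n => by
    have h0 : 0 ≤ min 2 (T * ((n.2 : ℝ) ^ 2 / k)) := le_min (by norm_num) (by positivity)
    rw [Real.norm_of_nonneg (mul_nonneg (sq_nonneg _) (ha0 n))]
    refine mul_le_mul_of_nonneg_right ?_ (ha0 n)
    nlinarith [min_le_left 2 (T * ((n.2 : ℝ) ^ 2 / k))]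
  rcases lt_or_ge T 0 with hT | hT
  · exact ⟨0, tendsto_const_nhds, fun k _ t ht => absurd (abs_nonneg t) (by linarith)⟩
  refine ⟨fun k => ∑' n, B k n, ?_, fun k hk t ht => ?_⟩
  · have hlim : ∀ n, Tendsto (fun k => B k n) atTop (nhds 0) := fun n => by
      have h1 : Tendsto (fun k : ℕ => T * ((n.2 : ℝ) ^ 2 / k)) atTop (nhds (T * 0)) :=
        (tendsto_const_div_atTop_nhds_zero_nat _).const_mul T
      have h2 := (((tendsto_const_nhds (x := (2 : ℝ))).min h1).pow 2).mul_const (a n)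
      simpa [B] using h2
    simpa using tendsto_tsum_of_dominated_convergence (hsum.mul_left 4) hlim
      (Eventually.of_forall fun k => hdom k hT)
  · have hBs : Summable (B k) := .of_norm_bounded (hsum.mul_left 4) (hdom k hT)
    have hk' : (k : ℤ) ≠ 0 := by exact_mod_cast hk
    have hP := hasSum_sq_fc2 (S t (modulate hf hb k) - kpPhase t k 0 • modulate hf hb k)
    rw [← (Equiv.addRight ((k : ℤ), (0 : ℤ))).hasSum_iff] at hP
    refine hasSum_le (fun n => ?_) hP hBs.hasSum
    obtain ⟨m, l⟩ := n
    have hu := meanZero2_modulate hf hb hk'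
    obtain ⟨hz, hnz⟩ := hS t _ hu
    simp only [Function.comp_apply, Equiv.coe_addRight, Prod.mk_add_mk, add_zero, fc2_sub_smul]
    by_cases hm : m = 0
    · subst hm
      rw [zero_add, hnz _ _ hk', ← sub_mul, norm_mul, mul_pow]
      simp only [B, ha, fc2_modulate, if_true]
      rw [mul_left_comm]
      gcongr
      refine le_min (norm_kpPhase_sub_le_two t k l) ((norm_kpPhase_sub_le t k l).trans ?_)
      rw [Int.cast_natCast, Nat.abs_cast]
      gcongr
    · have h0 : fc2 (modulate hf hb k) (m + k) l = 0 := by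
        rw [fc2_modulate, if_neg (by simpa using hm)]
      have h1 : fc2 (S t (modulate hf hb k)) (m + k) l = 0 := by
        by_cases hmk : m + k = 0
        · rw [hmk, hz]
        · rw [hnz _ _ hmk, h0, mul_zero]
      rw [h1, h0]
      simpa using mul_nonneg (sq_nonneg _) (ha0 (m, l))

theorem Function.Periodic.continuous_lift_addCircle {g : ℝ → ℝ} (hg : Continuous g) {c : ℝ}
    (hper : Function.Periodic g c) : Continuous (hper.lift : AddCircle c → ℝ) :=
  continuous_coinduced_dom.mpr hg

theorem volume_lift_eq_zero_ne_zero {g : ℝ → ℝ} (hg : Continuous g)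
    (hper : Function.Periodic g (2 * Real.pi)) {a b : ℝ} (ha : -Real.pi < a) (hab : a < b)
    (hb : b < Real.pi)
    (hsupp : ∀ x ∈ Set.Ioc (-Real.pi) Real.pi, g x ≠ 0 → x ∈ Set.Ioo a b) :
    (volume : Measure Torus) {y | hper.lift y = 0} ≠ 0 := by
  have hA : MeasurableSet {y : Torus | hper.lift y = 0} :=
    (isClosed_singleton.preimage (hper.continuous_lift_addCircle hg)).measurableSet
  have hmp := AddCircle.measurePreserving_mk (2 * Real.pi) (-Real.pi)
  rw [← hmp.measure_preimage hA.nullMeasurableSet]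
  have hsub : Set.Ioc b Real.pi ⊆
      ((↑) : ℝ → Torus) ⁻¹' {y | hper.lift y = 0} := fun x hx => by
    by_contra h
    exact absurd (hsupp x ⟨by linarith [hx.1], hx.2⟩ h).2 (not_lt.mpr hx.1.le)
  have hpos : 0 < volume.restrict (Set.Ioc (-Real.pi) (-Real.pi + 2 * Real.pi))
      (Set.Ioc b Real.pi) := by
    rw [Measure.restrict_apply measurableSet_Ioc, Set.inter_eq_left.mpr
      (Set.Ioc_subset_Ioc (by linarith) (by linarith)), Real.volume_Ioc]
    simpa using hb
  exact (hpos.trans_le (measure_mono hsub)).ne'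

theorem modulate_indicator_ne_zero {A : Set Torus}
    (hA0 : (volume : Measure Torus) A ≠ 0) (hf : Measurable (A.indicator (1 : Torus → ℂ)))
    (hb : ∀ y, ‖A.indicator (1 : Torus → ℂ) y‖ ≤ 1) : modulate hf hb 0 ≠ 0 := by
  intro h
  rw [Lp.eq_zero_iff_ae_eq_zero] at h
  have h2 : ∀ᵐ p : Torus2, p ∉ (Set.univ ×ˢ A : Set Torus2) := by
    filter_upwards [h, coeFn_modulate hf hb 0] with p hp1 hp2 hpA
    rw [hp1] at hp2
    simp [Set.indicator_of_mem hpA.2] at hp2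
  rw [← measure_eq_zero_iff_ae_notMem, Measure.volume_eq_prod, Measure.prod_prod] at h2
  simp [AddCircle.measure_univ, hA0, Real.pi_pos.not_ge] at h2

/-- Theorem 5.2, failure of observability from a horizontal strip: for every
`T > 0` there is no constant `C > 0` with
`‖u₀‖²_{L²(𝕋²)} ≤ C ∫₀ᵀ ‖𝒢∥(S(t)u₀)‖²_{L²(𝕋²)} dt` for all `u₀ ∈ L²₀(𝕋²)`. -/
theorem linearized_KPII_no_observability_horizontal
    -- `g` is a fixed real-valued C² function on `𝕋` (2π-periodic on `ℝ`), nonnegative,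
    -- with integral 1, vanishing outside `(a,b) ⊂ (-π,π)`:
    (g : ℝ → ℝ) (hg_reg : ContDiff ℝ 2 g) (hg_per : Function.Periodic g (2 * Real.pi))
    (hg_nonneg : ∀ x, 0 ≤ g x)
    (a b : ℝ) (ha : -Real.pi < a) (hab : a < b) (hb : b < Real.pi)
    (hg_supp : ∀ x ∈ Set.Ioc (-Real.pi) Real.pi, g x ≠ 0 → x ∈ Set.Ioo a b)
    (hg_int : ∫ x in (-Real.pi)..Real.pi, g x = 1)
    (S : ℝ → L2T2 →L[ℂ] L2T2) (hS : IsKPGroup S)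
    (G : L2T2 →L[ℂ] L2T2) (hG : IsGpar hg_per.lift G)
    (T : ℝ) (hT : 0 < T) :
    ¬ ∃ C : ℝ, 0 < C ∧
        ∀ u₀ : L2T2, MeanZero2 u₀ →
          ‖u₀‖ ^ 2 ≤ C * ∫ t in (0:ℝ)..T, ‖G (S t u₀)‖ ^ 2 := by
  rintro ⟨C, hC, hobs⟩
  have hcont := hg_per.continuous_lift_addCircle hg_reg.continuous
  set A : Set Torus := {y | hg_per.lift y = 0}
  have hA : MeasurableSet A := (isClosed_singleton.preimage hcont).measurableSet
  have hf : Measurable (A.indicator (1 : Torus → ℂ)) := measurable_one.indicator hA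
  have hb1 : ∀ y, ‖A.indicator (1 : Torus → ℂ) y‖ ≤ 1 := fun y =>
    (norm_indicator_le_norm_self _ _).trans (by simp)
  have hgf : ∀ y, (hg_per.lift y : ℂ) * A.indicator (1 : Torus → ℂ) y = 0 := fun y => by
    by_cases hy : y ∈ A
    · rw [show hg_per.lift y = 0 from hy, Complex.ofReal_zero, zero_mul]
    · rw [Set.indicator_of_notMem hy, mul_zero]
  have hne := modulate_indicator_ne_zero
    (volume_lift_eq_zero_ne_zero hg_reg.continuous hg_per ha hab hb hg_supp) hf hb1
  obtain ⟨D, hD, hDb⟩ := exists_tendsto_zero_bound_flow_modulate hS hf hb1 T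
  have hle : ∀ k : ℕ, k ≠ 0 →
      ‖modulate hf hb1 0‖ ^ 2 ≤ C * (‖G‖ ^ 2 * D k * T) := fun k hk => by
    rw [← norm_modulate hf hb1 k]
    refine (hobs _ (meanZero2_modulate hf hb1 (by exact_mod_cast hk))).trans ?_
    refine mul_le_mul_of_nonneg_left ((le_abs_self _).trans ?_) hC.le
    have hint := intervalIntegral.norm_integral_le_of_norm_le_const (a := 0) (b := T)
      (f := fun t => ‖G (S t (modulate hf hb1 k))‖ ^ 2) (C := ‖G‖ ^ 2 * D k) fun t ht => by
        rw [Set.uIoc_of_le hT.le] at ht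
        have hG0 : G (S t (modulate hf hb1 k)) =
            G (S t (modulate hf hb1 k) - kpPhase t k 0 • modulate hf hb1 k) := by
          rw [map_sub, map_smul, gpar_modulate_eq_zero hf hb1 hG hgf, smul_zero, sub_zero]
        rw [norm_pow, norm_norm, hG0]
        calc _ ≤ (‖G‖ * _) ^ 2 := pow_le_pow_left₀ (norm_nonneg _) (G.le_opNorm _) 2
          _ ≤ _ := by
            rw [mul_pow]
            exact mul_le_mul_of_nonneg_left
              (hDb k hk t (by rw [abs_of_pos ht.1]; exact ht.2)) (sq_nonneg _)
    simpa [abs_of_pos hT] using hint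
  have hlim : Tendsto (fun k => C * (‖G‖ ^ 2 * D k * T)) atTop (nhds 0) := by
    simpa using ((hD.const_mul (‖G‖ ^ 2)).mul_const T).const_mul C
  have h0 : ‖modulate hf hb1 0‖ ^ 2 ≤ 0 :=
    ge_of_tendsto hlim ((eventually_ne_atTop 0).mono hle)
  exact absurd h0 (not_le.mpr (by have := norm_pos_iff.mpr hne; positivity))
end
end

section
/- For every T > 0 there exists a constant C = C(T) > 0 such that for every real λ > 0 and every u₀ ∈ L²₀(𝕋), the uniform observability inequality ‖u₀‖²_{L²(𝕋)} ≤ C ∫₀ᵀ ‖𝒢(S_λ(t)u₀)‖²_{L²(𝕋)} dt holds (with C independent of λ). -/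
open MeasureTheory Real Filter

noncomputable section

/-- Fourier coefficient `û(k) = (1/2π) ∫_𝕋 u(x) e^{-ikx} dx`. -/
def fc (u : Torus → ℂ) (k : ℤ) : ℂ :=
  (1 / (2 * Real.pi)) * ∫ x : Torus, fourier (-k) x * u x

/-- Membership in `L²₀(𝕋)`: the mean `û(0)` vanishes. -/
def MeanZero (u : L2T) : Prop := fc (u : Torus → ℂ) 0 = 0

/-- The squared `H⁻¹(𝕋)` norm `‖u‖²_{H⁻¹} = Σ_k (1+k²)⁻¹ |û(k)|²`. -/
def Hneg1Sq (u : L2T) : ℝ := ∑' k : ℤ, (1 + (k : ℝ) ^ 2)⁻¹ * ‖fc (u : Torus → ℂ) k‖ ^ 2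

/-- Squared `L²` norm of the pointwise product `g · v`. -/
def gMulNormSq (g : Torus → ℝ) (v : L2T) : ℝ :=
  ∫ x : Torus, ‖(g x : ℂ) * (v : Torus → ℂ) x‖ ^ 2

/-- Spectral characterization of the unitary group `S_λ(t)` on `L²₀(𝕋)` solving
`∂ₜu + ∂ₓ³u - λ²∂ₓ⁻¹u = 0`: `(S_λ(t)u)^(k) = e^{it(k³ - λ²/k)} û(k)` for `k ≠ 0`. -/
def IsLamGroup (lam : ℝ) (S : ℝ → L2T →L[ℂ] L2T) : Prop :=
  ∀ t : ℝ, ∀ u : L2T, MeanZero u →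
    MeanZero (S t u) ∧
      ∀ k : ℤ, k ≠ 0 →
        fc (S t u : Torus → ℂ) k =
          Complex.exp (Complex.I * (t : ℂ) * ((k : ℂ) ^ 3 - (lam : ℂ) ^ 2 / (k : ℂ))) *
            fc (u : Torus → ℂ) k

/-- Spectral characterization of the semiclassical unitary group `Sʰ(t)` on `L²₀(𝕋)` solving
`h∂ₜu + (h∂ₓ)³u - (h∂ₓ)⁻¹u = 0`: `(Sʰ(t)u)^(k) = e^{it(h²k³ - 1/(h²k))} û(k)` for `k ≠ 0`. -/
def IsSemiGroup (h : ℝ) (S : ℝ → L2T →L[ℂ] L2T) : Prop :=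
  ∀ t : ℝ, ∀ u : L2T, MeanZero u →
    MeanZero (S t u) ∧
      ∀ k : ℤ, k ≠ 0 →
        fc (S t u : Torus → ℂ) k =
          Complex.exp (Complex.I * (t : ℂ) *
              ((h : ℂ) ^ 2 * (k : ℂ) ^ 3 - 1 / ((h : ℂ) ^ 2 * (k : ℂ)))) *
            fc (u : Torus → ℂ) k

/-- `(𝒢 v)(x) = g(x) (v(x) - ∫_𝕋 g(x') v(x') dx')` (a.e.). -/
def IsG (g : Torus → ℝ) (G : L2T →L[ℂ] L2T) : Prop :=
  ∀ v : L2T, ∀ᵐ x ∂(volume : Measure Torus),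
    (G v : Torus → ℂ) x =
      (g x : ℂ) * ((v : Torus → ℂ) x - ∫ x' : Torus, (g x' : ℂ) * (v : Torus → ℂ) x')

/-- The Fourier multiplier `m(hDₓ)`: `(m(hDₓ)u)^(k) = m(hk) û(k)`. -/
def IsMult (m : ℝ → ℝ) (h : ℝ) (M : L2T →L[ℂ] L2T) : Prop :=
  ∀ u : L2T, ∀ k : ℤ, fc (M u : Torus → ℂ) k = (m (h * k) : ℂ) * fc (u : Torus → ℂ) k

section ExponentialSums

/-- The oscillatory integral `∫₀ᵀ e^{ist} dt`. -/
def expWindow (T s : ℝ) : ℂ := ∫ t in (0:ℝ)..T, Complex.exp (Complex.I * (t * s : ℝ))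

lemma norm_expWindow_le_length {T : ℝ} (hT : 0 ≤ T) (s : ℝ) : ‖expWindow T s‖ ≤ T := by
  have h := intervalIntegral.norm_integral_le_of_norm_le_const (a := 0) (b := T) (C := 1)
    (f := fun t : ℝ => Complex.exp (Complex.I * (t * s : ℝ)))
    (fun t _ => (Complex.norm_exp_I_mul_ofReal _).le)
  simpa [expWindow, abs_of_nonneg hT] using h

lemma expWindow_zero (T : ℝ) : expWindow T 0 = T := by
  simp [expWindow]

lemma expWindow_eq (T : ℝ) {s : ℝ} (hs : s ≠ 0) :
    expWindow T s = (Complex.exp (Complex.I * (T * s : ℝ)) - 1) / (Complex.I * s) := by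
  have hc : Complex.I * (s : ℂ) ≠ 0 := mul_ne_zero Complex.I_ne_zero (by exact_mod_cast hs)
  have h := integral_exp_mul_complex (a := 0) (b := T) hc
  rw [expWindow]
  convert h using 3 with t
  · congr 1
    push_cast
    ring
  · congr 1
    push_cast
    ring
  · simp

lemma norm_expWindow_le_div (T : ℝ) {s : ℝ} (hs : s ≠ 0) : ‖expWindow T s‖ ≤ 2 / |s| := by
  rw [expWindow_eq T hs, norm_div]
  have h1 : ‖Complex.exp (Complex.I * (T * s : ℝ)) - 1‖ ≤ 2 := by
    refine (norm_sub_le _ _).trans ?_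
    rw [Complex.norm_exp_I_mul_ofReal]
    norm_num
  have h2 : ‖Complex.I * (s : ℂ)‖ = |s| := by simp
  rw [h2]
  gcongr

lemma expWindow_re (T : ℝ) {s : ℝ} (hs : s ≠ 0) : (expWindow T s).re = Real.sin (T * s) / s := by
  have hs' : (s : ℂ) ≠ 0 := by exact_mod_cast hs
  have h : expWindow T s =
      (Real.sin (T * s) / s : ℝ) + (-((Real.cos (T * s) - 1) / s) : ℝ) * Complex.I := by
    rw [expWindow_eq T hs, mul_comm Complex.I ((T * s : ℝ) : ℂ), Complex.exp_mul_I]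
    push_cast
    field_simp
    linear_combination
      ((Complex.cos (T * s) - 1)) * Complex.I_sq
  rw [h, Complex.add_re, Complex.re_ofReal_mul, Complex.ofReal_re, Complex.I_re, mul_zero, add_zero]

/-- Away from the origin, `1 - sin y / y` is bounded below. -/
lemma exists_sin_div_le {y₀ : ℝ} (hy₀ : 0 < y₀) :
    ∃ c : ℝ, 0 < c ∧ ∀ y : ℝ, y₀ ≤ |y| → Real.sin y / y ≤ 1 - c := by
  have hlt := Real.sin_lt hy₀
  refine ⟨min (1 / 2) ((y₀ - Real.sin y₀) / 2), lt_min (by norm_num) (by linarith), ?_⟩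
  have key : ∀ y : ℝ, y₀ ≤ y →
      Real.sin y / y ≤ 1 - min (1 / 2) ((y₀ - Real.sin y₀) / 2) := by
    intro y hy
    have hy' : 0 < y := hy₀.trans_le hy
    rw [div_le_iff₀ hy']
    rcases le_total y 2 with h2 | h2
    · have h3 := (abs_le.1 (Real.abs_sin_sub_sin_le y y₀)).2
      rw [abs_of_nonneg (by linarith), sub_le_iff_le_add] at h3
      have h4 := min_le_right (1 / 2) ((y₀ - Real.sin y₀) / 2)
      nlinarith
    · have h3 := Real.sin_le_one y
      have h4 := min_le_left (1 / 2) ((y₀ - Real.sin y₀) / 2)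
      nlinarith
  intro y hy
  rcases le_total 0 y with h | h
  · exact key y (by rwa [abs_of_nonneg h] at hy)
  · have := key (-y) (by rwa [abs_of_nonpos h] at hy)
    rwa [Real.sin_neg, neg_div_neg_eq] at this

/-- Schur's test for a symmetric kernel on a finite set. -/
lemma sum_sum_mul_le_of_symm {ι : Type*} (F : Finset ι) (w : ι → ι → ℝ) (x : ι → ℝ) (M : ℝ)
    (hw : ∀ j ∈ F, ∀ k ∈ F, 0 ≤ w j k) (hsymm : ∀ j ∈ F, ∀ k ∈ F, w j k = w k j)
    (hM : ∀ j ∈ F, ∑ k ∈ F, w j k ≤ M) :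
    ∑ j ∈ F, ∑ k ∈ F, w j k * (x j * x k) ≤ M * ∑ j ∈ F, x j ^ 2 := by
  have h1 : ∑ j ∈ F, ∑ k ∈ F, w j k * (x j * x k) ≤
      ∑ j ∈ F, ∑ k ∈ F, (w j k * (x j ^ 2 / 2) + w k j * (x k ^ 2 / 2)) := by
    refine Finset.sum_le_sum fun j hj => Finset.sum_le_sum fun k hk => ?_
    rw [← hsymm j hj k hk]
    nlinarith [hw j hj k hk, sq_nonneg (x j - x k),
      mul_nonneg (hw j hj k hk) (sq_nonneg (x j - x k))]
  have h2 : ∑ j ∈ F, ∑ k ∈ F, w k j * (x k ^ 2 / 2) =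
      ∑ j ∈ F, ∑ k ∈ F, w j k * (x j ^ 2 / 2) := Finset.sum_comm
  simp only [Finset.sum_add_distrib] at h1
  rw [h2, ← two_mul] at h1
  refine h1.trans ?_
  rw [Finset.mul_sum, Finset.mul_sum]
  refine Finset.sum_le_sum fun j hj => ?_
  rw [← Finset.sum_mul]
  nlinarith [hM j hj, mul_le_mul_of_nonneg_right (hM j hj) (sq_nonneg (x j))]

variable {E : Type*} [NormedAddCommGroup E] [InnerProductSpace ℂ E]

/-- The vector-valued exponential sum `∑_{k ∈ F} a_k e^{itφ_k} ψ_k`. -/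
def expSum (ψ : ℤ → E) (φ : ℤ → ℝ) (F : Finset ℤ) (a : ℤ → ℂ) (t : ℝ) : E :=
  ∑ k ∈ F, (Complex.exp (Complex.I * (t * φ k : ℝ)) * a k) • ψ k

lemma continuous_expSum (ψ : ℤ → E) (φ : ℤ → ℝ) (F : Finset ℤ) (a : ℤ → ℂ) :
    Continuous (expSum ψ φ F a) := by
  unfold expSum
  fun_prop

/-- Almost orthogonality of a family of vectors indexed by the frequencies: Gram matrix bounded in
the sense of Schur, norms bounded below, and a uniform angle between any two vectors whose indices
have opposite signs. -/
structure AlmostOrthogonal (ψ : ℤ → E) (K c δ : ℝ) : Prop where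
  bound_pos : 0 < K
  lower_pos : 0 < c
  angle_pos : 0 < δ
  angle_le_one : δ ≤ 1
  sum_inner_le : ∀ (F : Finset ℤ) (j : ℤ), ∑ k ∈ F, ‖inner ℂ (ψ j) (ψ k)‖ ≤ K
  le_norm_sq : ∀ j : ℤ, j ≠ 0 → c ≤ ‖ψ j‖ ^ 2
  inner_le : ∀ j k : ℤ, j * k < 0 → ‖inner ℂ (ψ j) (ψ k)‖ ≤ (1 - δ) * (‖ψ j‖ * ‖ψ k‖)

/-- The observability inequality on the time interval `(0, T)` with constant `C` for exponential
sums with frequencies indexed by `S`. -/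
def ObservesWith (ψ : ℤ → E) (φ : ℤ → ℝ) (S : Set ℤ) (T C : ℝ) : Prop :=
  ∀ F : Finset ℤ, (F : Set ℤ) ⊆ S → ∀ a : ℤ → ℂ,
    ∑ k ∈ F, ‖a k‖ ^ 2 ≤ C * ∫ t in (0:ℝ)..T, ‖expSum ψ φ F a t‖ ^ 2

namespace AlmostOrthogonal

variable {ψ : ℤ → E} {K c δ : ℝ}

lemma norm_sum_sq_le (h : AlmostOrthogonal ψ K c δ) (F : Finset ℤ) (b : ℤ → ℂ) :
    ‖∑ k ∈ F, b k • ψ k‖ ^ 2 ≤ K * ∑ k ∈ F, ‖b k‖ ^ 2 := by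
  have h1 : ‖∑ k ∈ F, b k • ψ k‖ ^ 2 ≤
      ∑ j ∈ F, ∑ k ∈ F, ‖inner ℂ (ψ j) (ψ k)‖ * (‖b j‖ * ‖b k‖) := by
    have h2 : ‖∑ k ∈ F, b k • ψ k‖ ^ 2 =
        ‖inner ℂ (∑ k ∈ F, b k • ψ k) (∑ k ∈ F, b k • ψ k)‖ := by
      rw [inner_self_eq_norm_sq_to_K]
      simp
    rw [h2, sum_inner]
    refine (norm_sum_le _ _).trans (Finset.sum_le_sum fun j _ => ?_)
    rw [inner_sum]
    refine (norm_sum_le _ _).trans (Finset.sum_le_sum fun k _ => ?_)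
    rw [inner_smul_left, inner_smul_right, norm_mul, norm_mul, RCLike.norm_conj]
    exact le_of_eq (by ring)
  refine h1.trans (sum_sum_mul_le_of_symm F _ _ K (fun _ _ _ _ => norm_nonneg _) ?_
    fun j _ => h.sum_inner_le F j)
  intro j _ k _
  exact norm_inner_symm _ _

end AlmostOrthogonal

lemma integral_norm_expSum_sq (ψ : ℤ → E) (φ : ℤ → ℝ) (F : Finset ℤ) (a : ℤ → ℂ) (T : ℝ) :
    ((∫ t in (0:ℝ)..T, ‖expSum ψ φ F a t‖ ^ 2 : ℝ) : ℂ) =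
      ∑ j ∈ F, ∑ k ∈ F, expWindow T (φ k - φ j) *
        ((starRingEnd ℂ) (a j) * a k * inner ℂ (ψ j) (ψ k)) := by
  have h1 : ∀ t : ℝ, ((‖expSum ψ φ F a t‖ ^ 2 : ℝ) : ℂ) =
      ∑ j ∈ F, ∑ k ∈ F, Complex.exp (Complex.I * (t * (φ k - φ j) : ℝ)) *
        ((starRingEnd ℂ) (a j) * a k * inner ℂ (ψ j) (ψ k)) := by
    intro t
    have h2 : ((‖expSum ψ φ F a t‖ ^ 2 : ℝ) : ℂ) =
        inner ℂ (expSum ψ φ F a t) (expSum ψ φ F a t) := by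
      rw [inner_self_eq_norm_sq_to_K]
      simp
    rw [h2, expSum, sum_inner]
    refine Finset.sum_congr rfl fun j _ => ?_
    rw [inner_sum]
    refine Finset.sum_congr rfl fun k _ => ?_
    have h3 : Complex.exp (Complex.I * (t * (φ k - φ j) : ℝ)) =
        (starRingEnd ℂ) (Complex.exp (Complex.I * (t * φ j : ℝ))) *
          Complex.exp (Complex.I * (t * φ k : ℝ)) := by
      rw [← Complex.exp_conj, ← Complex.exp_add]
      congr 1
      simp only [map_mul, Complex.conj_I, Complex.conj_ofReal]
      push_cast
      ring
    rw [inner_smul_left, inner_smul_right, h3, map_mul]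
    ring
  rw [← intervalIntegral.integral_ofReal]
  simp only [h1]
  rw [intervalIntegral.integral_finsetSum]
  · refine Finset.sum_congr rfl fun j _ => ?_
    rw [intervalIntegral.integral_finsetSum]
    · refine Finset.sum_congr rfl fun k _ => ?_
      rw [intervalIntegral.integral_mul_const, expWindow]
    · intro k _
      exact Continuous.intervalIntegrable (by fun_prop) _ _
  · intro j _
    exact Continuous.intervalIntegrable (by fun_prop) _ _

/-- Observability under a gap condition imposed only between frequencies whose indices have the
same sign. -/
theorem AlmostOrthogonal.observesWith_of_gap {ψ : ℤ → E} {K c δ : ℝ}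
    (h : AlmostOrthogonal ψ K c δ) {T D : ℝ} (hT : 0 < T) (hD : 4 * K / (T * δ * c) ≤ D)
    {φ : ℤ → ℝ} {S : Set ℤ} (hS : (0 : ℤ) ∉ S)
    (hgap : ∀ j ∈ S, ∀ k ∈ S, j ≠ k → 0 < j * k → 2 * D ≤ |φ j - φ k|) :
    ObservesWith ψ φ S T (2 / (T * δ * c)) := by
  classical
  intro F hF a
  have hK := h.bound_pos
  have hc := h.lower_pos
  have hδ := h.angle_pos
  have hδ1 := h.angle_le_one
  have hTδc : 0 < T * δ * c := by positivity
  have hDpos : 0 < D := lt_of_lt_of_le (by positivity) hD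
  set I := ∫ t in (0:ℝ)..T, ‖expSum ψ φ F a t‖ ^ 2 with hI
  set x : ℤ → ℝ := fun k => ‖a k‖ * ‖ψ k‖ with hx
  let near : ℤ → ℤ → ℝ := fun j k => if j ≠ k ∧ |φ j - φ k| < D then 1 else 0
  have hne : ∀ j ∈ F, j ≠ 0 := fun j hj h0 => hS (h0 ▸ hF hj)
  have hopp : ∀ j ∈ F, ∀ k ∈ F, j ≠ k → |φ j - φ k| < 2 * D → j * k < 0 := by
    intro j hj k hk hjk hlt
    by_contra hcon
    have hpos : 0 < j * k :=
      lt_of_le_of_ne (not_lt.1 hcon) (mul_ne_zero (hne j hj) (hne k hk)).symm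
    exact absurd (hgap j (hF hj) k (hF hk) hjk hpos) (not_le.2 hlt)
  -- every index has at most one near partner
  have hnear_sum : ∀ j ∈ F, ∑ k ∈ F, near j k ≤ 1 := by
    intro j hj
    have h1 : (F.filter fun k => j ≠ k ∧ |φ j - φ k| < D).card ≤ 1 := by
      rw [Finset.card_le_one]
      intro k hk l hl
      simp only [Finset.mem_filter] at hk hl
      by_contra hkl
      have hk' := hopp j hj k hk.1 hk.2.1 (by linarith [hk.2.2])
      have hl' := hopp j hj l hl.1 hl.2.1 (by linarith [hl.2.2])
      have hd : |φ k - φ l| < 2 * D := by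
        have e1 := abs_lt.1 hk.2.2
        have e2 := abs_lt.1 hl.2.2
        rw [abs_lt]
        constructor <;> linarith [e1.1, e1.2, e2.1, e2.2]
      have hkl' := hopp k hk.1 l hl.1 hkl hd
      nlinarith [mul_pos_of_neg_of_neg hk' hl', mul_self_pos.2 (hne j hj)]
    have h2 : ∑ k ∈ F, near j k = ((F.filter fun k => j ≠ k ∧ |φ j - φ k| < D).card : ℝ) := by
      simp [near, Finset.sum_boole]
    rw [h2]
    exact_mod_cast h1
  have hnear_symm : ∀ j ∈ F, ∀ k ∈ F, near j k = near k j := by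
    intro j _ k _
    simp only [near, abs_sub_comm (φ j) (φ k), ne_comm (a := j)]
  have hnear_nonneg : ∀ j ∈ F, ∀ k ∈ F, 0 ≤ near j k := by
    intro j _ k _
    simp only [near]
    split_ifs <;> norm_num
  have hterm : ∀ j ∈ F, ∀ k ∈ F,
      ‖expWindow T (φ k - φ j) * ((starRingEnd ℂ) (a j) * a k * inner ℂ (ψ j) (ψ k)) -
          (if j = k then ((T * x j ^ 2 : ℝ) : ℂ) else 0)‖ ≤
        T * (1 - δ) * (near j k * (x j * x k)) +
          2 / D * (‖inner ℂ (ψ j) (ψ k)‖ * (‖a j‖ * ‖a k‖)) := by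
    intro j hj k hk
    have hδ' : 0 ≤ 1 - δ := by linarith
    have hr1 : 0 ≤ T * (1 - δ) * (near j k * (x j * x k)) :=
      mul_nonneg (by positivity) (mul_nonneg (hnear_nonneg j hj k hk) (by positivity))
    have hr2 : 0 ≤ 2 / D * (‖inner ℂ (ψ j) (ψ k)‖ * (‖a j‖ * ‖a k‖)) := by positivity
    by_cases hjk : j = k
    · subst hjk
      have : expWindow T (φ j - φ j) * ((starRingEnd ℂ) (a j) * a j * inner ℂ (ψ j) (ψ j)) -
          (if j = j then ((T * x j ^ 2 : ℝ) : ℂ) else 0) = 0 := by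
        rw [sub_self, expWindow_zero, inner_self_eq_norm_sq_to_K, RCLike.conj_mul]
        simp only [hx, if_true]
        push_cast
        simp only [Complex.coe_algebraMap]
        ring
      rw [this, norm_zero]
      positivity
    · rw [if_neg hjk, sub_zero, norm_mul, norm_mul, norm_mul, RCLike.norm_conj]
      by_cases hlt : |φ j - φ k| < D
      · have h1 := h.inner_le j k (hopp j hj k hk hjk (by linarith))
        have h2 := norm_expWindow_le_length hT.le (φ k - φ j)
        have h3 : near j k = 1 := by simp [near, hjk, hlt]
        rw [h3]
        have h4 : ‖expWindow T (φ k - φ j)‖ * (‖a j‖ * ‖a k‖ * ‖inner ℂ (ψ j) (ψ k)‖) ≤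
            T * (‖a j‖ * ‖a k‖ * ((1 - δ) * (‖ψ j‖ * ‖ψ k‖))) := by gcongr
        calc _ ≤ _ := h4
          _ = T * (1 - δ) * (1 * (x j * x k)) := by simp only [hx]; ring
          _ ≤ _ := le_add_of_nonneg_right hr2
      · have hle : D ≤ |φ k - φ j| := by rw [abs_sub_comm]; exact not_lt.1 hlt
        have h1 : ‖expWindow T (φ k - φ j)‖ ≤ 2 / D := by
          refine (norm_expWindow_le_div T ?_).trans (by gcongr)
          intro h0
          rw [h0, abs_zero] at hle
          linarith
        have h4 : ‖expWindow T (φ k - φ j)‖ * (‖a j‖ * ‖a k‖ * ‖inner ℂ (ψ j) (ψ k)‖) ≤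
            2 / D * (‖inner ℂ (ψ j) (ψ k)‖ * (‖a j‖ * ‖a k‖)) := by
          rw [mul_comm (‖a j‖ * ‖a k‖)]
          gcongr
        exact h4.trans (le_add_of_nonneg_left hr1)
  have hdiag : ∑ j ∈ F, ∑ k ∈ F, (if j = k then ((T * x j ^ 2 : ℝ) : ℂ) else 0) =
      ((T * ∑ j ∈ F, x j ^ 2 : ℝ) : ℂ) := by
    rw [Finset.mul_sum]
    push_cast
    refine Finset.sum_congr rfl fun j hj => ?_
    rw [Finset.sum_ite_eq, if_pos hj]
  have hmain : |I - T * ∑ j ∈ F, x j ^ 2| ≤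
      T * (1 - δ) * ∑ j ∈ F, x j ^ 2 + 2 / D * (K * ∑ j ∈ F, ‖a j‖ ^ 2) := by
    have h1 : |I - T * ∑ j ∈ F, x j ^ 2| =
        ‖((I : ℝ) : ℂ) - ((T * ∑ j ∈ F, x j ^ 2 : ℝ) : ℂ)‖ := by
      rw [← Complex.ofReal_sub, Complex.norm_real, Real.norm_eq_abs]
    rw [h1, hI, integral_norm_expSum_sq, ← hdiag, ← Finset.sum_sub_distrib]
    simp only [← Finset.sum_sub_distrib]
    calc _ ≤ ∑ j ∈ F, ∑ k ∈ F, (T * (1 - δ) * (near j k * (x j * x k)) +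
          2 / D * (‖inner ℂ (ψ j) (ψ k)‖ * (‖a j‖ * ‖a k‖))) :=
        (norm_sum_le _ _).trans (Finset.sum_le_sum fun j hj =>
          (norm_sum_le _ _).trans (Finset.sum_le_sum fun k hk => hterm j hj k hk))
      _ = T * (1 - δ) * (∑ j ∈ F, ∑ k ∈ F, near j k * (x j * x k)) +
          2 / D * ∑ j ∈ F, ∑ k ∈ F, ‖inner ℂ (ψ j) (ψ k)‖ * (‖a j‖ * ‖a k‖) := by
        simp only [Finset.sum_add_distrib, Finset.mul_sum]
      _ ≤ _ := by
        have e1 := sum_sum_mul_le_of_symm F near x 1 hnear_nonneg hnear_symm hnear_sum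
        have e2 := sum_sum_mul_le_of_symm F (fun j k => ‖inner ℂ (ψ j) (ψ k)‖) (fun j => ‖a j‖) K
          (fun _ _ _ _ => norm_nonneg _) (fun _ _ _ _ => norm_inner_symm _ _)
          fun j _ => h.sum_inner_le F j
        rw [one_mul] at e1
        have : 0 ≤ 1 - δ := by linarith
        gcongr
  have hlow : c * ∑ j ∈ F, ‖a j‖ ^ 2 ≤ ∑ j ∈ F, x j ^ 2 := by
    rw [Finset.mul_sum]
    refine Finset.sum_le_sum fun j hj => ?_
    simp only [hx, mul_pow]
    rw [mul_comm]
    gcongr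
    exact h.le_norm_sq j (hne j hj)
  have hA : 0 ≤ ∑ j ∈ F, ‖a j‖ ^ 2 := by positivity
  set A := ∑ j ∈ F, ‖a j‖ ^ 2
  set X := ∑ j ∈ F, x j ^ 2
  have hKD : 2 / D * K ≤ T * δ * c / 2 := by
    rw [div_le_iff₀ hTδc] at hD
    rw [div_mul_eq_mul_div, div_le_iff₀ hDpos]
    linarith
  have h5 : T * δ * c / 2 * A ≤ I := by
    have e1 := (abs_le.1 hmain).1
    have e2 : T * δ * (c * A) ≤ T * δ * X := by gcongr
    have e3 : 2 / D * K * A ≤ T * δ * c / 2 * A := by gcongr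
    nlinarith
  rw [div_mul_eq_mul_div, le_div_iff₀ hTδc]
  linarith
end ExponentialSums

section Observability

lemma norm_add_sq_le_two_mul {E : Type*} [SeminormedAddCommGroup E] (x y : E) :
    ‖x + y‖ ^ 2 ≤ 2 * ‖x‖ ^ 2 + 2 * ‖y‖ ^ 2 := by
  have h := norm_add_le x y
  nlinarith [sq_nonneg (‖x‖ - ‖y‖), norm_nonneg (x + y), norm_nonneg x, norm_nonneg y]

lemma integral_norm_add_sq_le {E : Type*} [SeminormedAddCommGroup E] {f g : ℝ → E}
    (hf : Continuous f) (hg : Continuous g) {T : ℝ} (hT : 0 ≤ T) :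
    ∫ t in (0:ℝ)..T, ‖f t + g t‖ ^ 2 ≤
      2 * (∫ t in (0:ℝ)..T, ‖f t‖ ^ 2) + 2 * ∫ t in (0:ℝ)..T, ‖g t‖ ^ 2 := by
  rw [← intervalIntegral.integral_const_mul, ← intervalIntegral.integral_const_mul,
    ← intervalIntegral.integral_add]
  · refine intervalIntegral.integral_mono_on hT ?_ ?_ fun t _ => norm_add_sq_le_two_mul _ _
    all_goals exact Continuous.intervalIntegrable (by fun_prop) _ _
  all_goals exact Continuous.intervalIntegrable (by fun_prop) _ _

lemma integral_le_const_of_le {f : ℝ → ℝ} (hf : Continuous f) {T M : ℝ} (hT : 0 ≤ T)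
    (h : ∀ t ∈ Set.Icc 0 T, f t ≤ M) : ∫ t in (0:ℝ)..T, f t ≤ T * M := by
  have := intervalIntegral.integral_mono_on (μ := volume) (g := fun _ => M) hT
    (hf.intervalIntegrable _ _) (Continuous.intervalIntegrable (by fun_prop) _ _) h
  simpa using this

variable {E : Type*} [NormedAddCommGroup E] [InnerProductSpace ℂ E]

lemma ObservesWith.mono {ψ : ℤ → E} {φ : ℤ → ℝ} {S S' : Set ℤ} {T T' C : ℝ}
    (h : ObservesWith ψ φ S T C) (hS : S' ⊆ S) (hC : 0 ≤ C) (hT : 0 ≤ T) (hTT' : T ≤ T') :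
    ObservesWith ψ φ S' T' C := by
  intro F hF a
  refine (h F (hF.trans hS) a).trans (mul_le_mul_of_nonneg_left ?_ hC)
  have hcont : Continuous fun t => ‖expSum ψ φ F a t‖ ^ 2 := (continuous_expSum ψ φ F a).norm.pow 2
  exact intervalIntegral.integral_mono_interval le_rfl hT hTT'
    (Eventually.of_forall fun t => by positivity) (hcont.intervalIntegrable _ _)

lemma ObservesWith.mono_const {ψ : ℤ → E} {φ : ℤ → ℝ} {S : Set ℤ} {T C C' : ℝ}
    (h : ObservesWith ψ φ S T C) (hT : 0 ≤ T) (hC : C ≤ C') : ObservesWith ψ φ S T C' := by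
  intro F hF a
  refine (h F hF a).trans (mul_le_mul_of_nonneg_right hC ?_)
  exact intervalIntegral.integral_nonneg hT fun t _ => by positivity

lemma sq_intervalIntegral_le {f : ℝ → ℝ} (hf : Continuous f) {τ : ℝ} (hτ : 0 < τ) :
    (∫ s in (0:ℝ)..τ, f s) ^ 2 ≤ τ * ∫ s in (0:ℝ)..τ, f s ^ 2 := by
  set M := ∫ s in (0:ℝ)..τ, f s with hM
  have h0 : 0 ≤ ∫ s in (0:ℝ)..τ, (τ * f s - M) ^ 2 :=
    intervalIntegral.integral_nonneg hτ.le fun s _ => sq_nonneg _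
  have h1 : ∫ s in (0:ℝ)..τ, (τ * f s - M) ^ 2 =
      τ ^ 2 * (∫ s in (0:ℝ)..τ, f s ^ 2) - 2 * τ * M * M + τ * M ^ 2 := by
    have h2 : ∀ s, (τ * f s - M) ^ 2 = τ ^ 2 * f s ^ 2 - 2 * τ * M * f s + M ^ 2 :=
      fun s => by ring
    simp only [h2]
    rw [intervalIntegral.integral_add, intervalIntegral.integral_sub,
      intervalIntegral.integral_const_mul, intervalIntegral.integral_const_mul,
      intervalIntegral.integral_const, ← hM]
    · simp
    all_goals exact Continuous.intervalIntegrable (by fun_prop) _ _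
  rw [h1] at h0
  have h3 : 0 ≤ τ * (τ * (∫ s in (0:ℝ)..τ, f s ^ 2) - M ^ 2) := by nlinarith
  linarith [nonneg_of_mul_nonneg_right h3 hτ]

lemma integral_exp_smul_expSum [CompleteSpace E] (ψ : ℤ → E) (φ : ℤ → ℝ) (F : Finset ℤ)
    (a : ℤ → ℂ) (ω τ t : ℝ) :
    ∫ s in (0:ℝ)..τ, Complex.exp (Complex.I * (s * (-ω) : ℝ)) • expSum ψ φ F a (t + s) =
      ∑ k ∈ F, (Complex.exp (Complex.I * (t * φ k : ℝ)) * (expWindow τ (φ k - ω) * a k)) • ψ k := by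
  have h1 : ∀ s : ℝ, Complex.exp (Complex.I * (s * (-ω) : ℝ)) • expSum ψ φ F a (t + s) =
      ∑ k ∈ F, (Complex.exp (Complex.I * (s * (φ k - ω) : ℝ))) •
        ((Complex.exp (Complex.I * (t * φ k : ℝ)) * a k) • ψ k) := by
    intro s
    rw [expSum, Finset.smul_sum]
    refine Finset.sum_congr rfl fun k _ => ?_
    rw [smul_smul, smul_smul, ← mul_assoc, ← mul_assoc, ← Complex.exp_add, ← Complex.exp_add]
    congr 3
    push_cast
    ring
  simp only [h1]
  rw [intervalIntegral.integral_finsetSum]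
  · refine Finset.sum_congr rfl fun k _ => ?_
    rw [intervalIntegral.integral_smul_const, smul_smul, expWindow]
    congr 1
    ring
  · intro k _
    exact Continuous.intervalIntegrable (by fun_prop) _ _

/-- Adding to an observable set of frequencies all indices with one given isolated frequency, at
the cost of an arbitrarily small amount of time. -/
theorem AlmostOrthogonal.observesWith_union_level [CompleteSpace E] {ψ : ℤ → E} {K c δ : ℝ}
    (h : AlmostOrthogonal ψ K c δ) {φ : ℤ → ℝ} {S₁ S₂ : Set ℤ} {T' T ω γ C₁ C₂ : ℝ}
    (hT' : 0 < T') (hTT : T' < T) (hγ : 0 < γ) (hgap : ∀ k ∈ S₁, γ ≤ |φ k - ω|)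
    (hlev : ∀ k ∈ S₂, φ k = ω) (hC₁ : 0 < C₁) (hC₂ : 0 < C₂)
    (h₁ : ObservesWith ψ φ S₁ T' C₁) (h₂ : ObservesWith ψ φ S₂ T C₂) :
    ∃ C : ℝ, 0 < C ∧ ObservesWith ψ φ (S₁ ∪ S₂) T C := by
  classical
  have hT : 0 < T := hT'.trans hTT
  have hK := h.bound_pos
  set τ := T - T' with hτdef
  have hτ : 0 < τ := sub_pos.2 hTT
  obtain ⟨d, hd, hd'⟩ := exists_sin_div_le (mul_pos hτ hγ)
  set B₁ := C₁ * (2 * T + 2 * T * T / τ) / (d ^ 2 * T) with hB₁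
  have hB₁pos : 0 < B₁ := by positivity
  set B₂ := C₂ * (2 + 2 * (T * (K * B₁))) with hB₂
  have hB₂pos : 0 < B₂ := by positivity
  refine ⟨B₁ + B₂, by positivity, fun F hF a => ?_⟩
  set I := ∫ t in (0:ℝ)..T, ‖expSum ψ φ F a t‖ ^ 2 with hI
  have hIint : ∀ u v : ℝ, IntervalIntegrable (fun t => ‖expSum ψ φ F a t‖ ^ 2) volume u v :=
    fun u v => ((continuous_expSum ψ φ F a).norm.pow 2).intervalIntegrable _ _
  have hI0 : 0 ≤ I := intervalIntegral.integral_nonneg hT.le fun t _ => by positivity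
  set F₁ := F.filter fun k => φ k ≠ ω with hF₁
  set F₂ := F.filter fun k => ¬ φ k ≠ ω with hF₂
  have hF₁S : (F₁ : Set ℤ) ⊆ S₁ := by
    intro k hk
    simp only [hF₁, Finset.coe_filter, Set.mem_ofPred_eq] at hk
    exact (hF hk.1).resolve_right fun h' => hk.2 (hlev k h')
  have hF₂S : (F₂ : Set ℤ) ⊆ S₂ := by
    intro k hk
    simp only [hF₂, Finset.coe_filter, Set.mem_ofPred_eq, not_not] at hk
    refine (hF hk.1).resolve_left fun h' => ?_
    have := hgap k h'
    rw [hk.2, sub_self, abs_zero] at this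
    linarith
  let m : ℤ → ℂ := fun k => 1 - (τ : ℂ)⁻¹ * expWindow τ (φ k - ω)
  have hm2 : ∀ k ∈ F, k ∉ F₁ → m k = 0 := by
    intro k hk hk'
    have : φ k = ω := by
      by_contra hne
      exact hk' (Finset.mem_filter.2 ⟨hk, hne⟩)
    have hτ' : (τ : ℂ) ≠ 0 := by exact_mod_cast hτ.ne'
    simp only [m, this, sub_self, expWindow_zero]
    rw [inv_mul_cancel₀ hτ', sub_self]
  have hm1 : ∀ k ∈ F₁, d ≤ ‖m k‖ := by
    intro k hk
    have hg := hgap k (hF₁S hk)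
    have hs : φ k - ω ≠ 0 := by
      intro h0
      rw [h0, abs_zero] at hg
      linarith
    refine le_trans ?_ (Complex.re_le_norm _)
    have h1 := hd' (τ * (φ k - ω)) (by rw [abs_mul, abs_of_pos hτ]; gcongr)
    have h2 : (m k).re = 1 - Real.sin (τ * (φ k - ω)) / (τ * (φ k - ω)) := by
      simp only [m, Complex.sub_re, Complex.one_re]
      rw [← Complex.ofReal_inv, Complex.re_ofReal_mul, expWindow_re τ hs]
      field_simp
    rw [h2]
    linarith
  -- the averaged sum only involves the frequencies in `F₁`
  have hv : ∀ t, expSum ψ φ F₁ (fun k => m k * a k) t = expSum ψ φ F a t +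
      (-(τ : ℂ)⁻¹) • ∫ s in (0:ℝ)..τ,
        Complex.exp (Complex.I * (s * (-ω) : ℝ)) • expSum ψ φ F a (t + s) := by
    intro t
    rw [integral_exp_smul_expSum]
    have h1 : expSum ψ φ F₁ (fun k => m k * a k) t = expSum ψ φ F (fun k => m k * a k) t := by
      refine Finset.sum_subset (Finset.filter_subset _ _) fun k hk hk' => ?_
      simp only [hm2 k hk hk', zero_mul, mul_zero, zero_smul]
    rw [h1, expSum, expSum, Finset.smul_sum, ← Finset.sum_add_distrib]
    refine Finset.sum_congr rfl fun k _ => ?_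
    rw [smul_smul, ← add_smul]
    congr 1
    simp only [m]
    ring
  have hv_le : ∀ t ∈ Set.Icc 0 T', ‖expSum ψ φ F₁ (fun k => m k * a k) t‖ ^ 2 ≤
      2 * ‖expSum ψ φ F a t‖ ^ 2 + 2 / τ * I := by
    intro t ht
    rw [hv]
    refine (norm_add_sq_le_two_mul _ _).trans ?_
    have h1 : ‖∫ s in (0:ℝ)..τ,
        Complex.exp (Complex.I * (s * (-ω) : ℝ)) • expSum ψ φ F a (t + s)‖ ≤
        ∫ s in (0:ℝ)..τ, ‖expSum ψ φ F a (t + s)‖ := by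
      refine (intervalIntegral.norm_integral_le_integral_norm hτ.le).trans (le_of_eq ?_)
      refine intervalIntegral.integral_congr fun s _ => ?_
      simp only [norm_smul, Complex.norm_exp_I_mul_ofReal, one_mul]
    have h2 := sq_intervalIntegral_le (f := fun s => ‖expSum ψ φ F a (t + s)‖)
      (((continuous_expSum ψ φ F a).comp (by fun_prop)).norm) hτ
    have h3 : ∫ s in (0:ℝ)..τ, ‖expSum ψ φ F a (t + s)‖ ^ 2 ≤ I := by
      rw [intervalIntegral.integral_comp_add_left fun s => ‖expSum ψ φ F a s‖ ^ 2]
      refine intervalIntegral.integral_mono_interval ?_ ?_ ?_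
        (Eventually.of_forall fun t => by positivity) (hIint _ _)
      · linarith [ht.1]
      · linarith
      · linarith [ht.2]
    have h4 : ‖∫ s in (0:ℝ)..τ,
        Complex.exp (Complex.I * (s * (-ω) : ℝ)) • expSum ψ φ F a (t + s)‖ ^ 2 ≤ τ * I :=
      (pow_le_pow_left₀ (norm_nonneg _) h1 2).trans (h2.trans (by gcongr))
    rw [norm_smul, mul_pow, norm_neg, norm_inv, Complex.norm_real, Real.norm_eq_abs,
      abs_of_pos hτ]
    have h5 : (τ⁻¹) ^ 2 * ‖∫ s in (0:ℝ)..τ,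
        Complex.exp (Complex.I * (s * (-ω) : ℝ)) • expSum ψ φ F a (t + s)‖ ^ 2 ≤
        (τ⁻¹) ^ 2 * (τ * I) := by gcongr
    have h6 : (τ⁻¹) ^ 2 * (τ * I) = 1 / τ * I := by field_simp
    rw [h6] at h5
    have h7 : 2 / τ * I = 2 * (1 / τ * I) := by ring
    rw [h7]
    linarith
  have hvI : ∫ t in (0:ℝ)..T', ‖expSum ψ φ F₁ (fun k => m k * a k) t‖ ^ 2 ≤
      (2 * T + 2 * T * T / τ) / T * I := by
    have h1 : ∫ t in (0:ℝ)..T', ‖expSum ψ φ F₁ (fun k => m k * a k) t‖ ^ 2 ≤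
        ∫ t in (0:ℝ)..T', (2 * ‖expSum ψ φ F a t‖ ^ 2 + 2 / τ * I) := by
      refine intervalIntegral.integral_mono_on hT'.le ?_ ?_ hv_le
      · exact ((continuous_expSum ψ φ F₁ _).norm.pow 2).intervalIntegrable _ _
      · exact ((hIint _ _).const_mul 2).add (Continuous.intervalIntegrable (by fun_prop) _ _)
    rw [intervalIntegral.integral_add ((hIint _ _).const_mul 2)
      (Continuous.intervalIntegrable (by fun_prop) _ _), intervalIntegral.integral_const_mul,
      intervalIntegral.integral_const, smul_eq_mul, sub_zero] at h1
    have h2 : ∫ t in (0:ℝ)..T', ‖expSum ψ φ F a t‖ ^ 2 ≤ I :=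
      intervalIntegral.integral_mono_interval le_rfl hT'.le hTT.le
        (Eventually.of_forall fun t => by positivity) (hIint _ _)
    have h3 : T' * (2 / τ * I) ≤ T * (2 / τ * I) := by gcongr
    have h4 : (2 * T + 2 * T * T / τ) / T * I = 2 * I + T * (2 / τ * I) := by
      field_simp
    rw [h4]
    linarith
  have hA₁ : ∑ k ∈ F₁, ‖a k‖ ^ 2 ≤ B₁ * I := by
    have h1 := (h₁ F₁ hF₁S fun k => m k * a k).trans (mul_le_mul_of_nonneg_left hvI hC₁.le)
    have h2 : d ^ 2 * ∑ k ∈ F₁, ‖a k‖ ^ 2 ≤ ∑ k ∈ F₁, ‖m k * a k‖ ^ 2 := by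
      rw [Finset.mul_sum]
      refine Finset.sum_le_sum fun k hk => ?_
      rw [norm_mul, mul_pow]
      have := hm1 k hk
      gcongr
    have h3 : B₁ * I = (C₁ * ((2 * T + 2 * T * T / τ) / T * I)) / d ^ 2 := by
      rw [hB₁]
      field_simp
    rw [h3, le_div_iff₀ (by positivity), mul_comm]
    exact h2.trans h1
  have hA₂ : ∑ k ∈ F₂, ‖a k‖ ^ 2 ≤ B₂ * I := by
    have h0 : ∀ t, expSum ψ φ F₂ a t = expSum ψ φ F a t + (-1 : ℂ) • expSum ψ φ F₁ a t := by
      intro t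
      rw [neg_smul, one_smul, ← sub_eq_add_neg, eq_sub_iff_add_eq']
      exact Finset.sum_filter_add_sum_filter_not F _ _
    have h1 := integral_norm_add_sq_le (g := fun t => (-1 : ℂ) • expSum ψ φ F₁ a t)
      (continuous_expSum ψ φ F a) ((continuous_expSum ψ φ F₁ a).const_smul (-1 : ℂ)) hT.le
    simp only [← h0, norm_smul, norm_neg, norm_one, one_mul] at h1
    have h2 : ∫ t in (0:ℝ)..T, ‖expSum ψ φ F₁ a t‖ ^ 2 ≤ T * (K * (B₁ * I)) := by
      refine integral_le_const_of_le ((continuous_expSum ψ φ F₁ a).norm.pow 2) hT.le fun t _ => ?_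
      change ‖expSum ψ φ F₁ a t‖ ^ 2 ≤ _
      refine (h.norm_sum_sq_le F₁ _).trans ?_
      simp only [norm_mul, Complex.norm_exp_I_mul_ofReal, one_mul]
      gcongr
    calc _ ≤ C₂ * ∫ t in (0:ℝ)..T, ‖expSum ψ φ F₂ a t‖ ^ 2 := h₂ F₂ hF₂S a
      _ ≤ C₂ * (2 * I + 2 * (T * (K * (B₁ * I)))) := by gcongr; linarith
      _ = B₂ * I := by rw [hB₂]; ring
  rw [← Finset.sum_filter_add_sum_filter_not F fun k => φ k ≠ ω]
  linarith

/-- The dispersion relation `k³ - λ²/k`. -/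
def dispersion (lam : ℝ) (k : ℤ) : ℝ := (k : ℝ) ^ 3 - lam ^ 2 / k

lemma le_abs_dispersion_sub (lam : ℝ) {j k : ℤ} (hjk : j ≠ k) (hpos : 0 < j * k) :
    (j : ℝ) ^ 2 + j * k + k ^ 2 + lam ^ 2 / (j * k) ≤ |dispersion lam j - dispersion lam k| := by
  have hp : (0 : ℝ) < j * k := by exact_mod_cast hpos
  have hj : (j : ℝ) ≠ 0 := left_ne_zero_of_mul hp.ne'
  have hk : (k : ℝ) ≠ 0 := right_ne_zero_of_mul hp.ne'
  have h1 : dispersion lam j - dispersion lam k =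
      (j - k : ℝ) * ((j : ℝ) ^ 2 + j * k + k ^ 2 + lam ^ 2 / (j * k)) := by
    unfold dispersion
    field_simp
    ring
  have h2 : (1 : ℝ) ≤ |(j : ℝ) - k| := by
    have : (1 : ℤ) ≤ |j - k| := Int.one_le_abs (sub_ne_zero.2 hjk)
    exact_mod_cast this
  have h3 : 0 ≤ (j : ℝ) ^ 2 + j * k + k ^ 2 + lam ^ 2 / (j * k) := by positivity
  rw [h1, abs_mul, abs_of_nonneg h3]
  exact le_mul_of_one_le_left h3 h2

lemma two_mul_le_abs_dispersion_sub (lam : ℝ) {j k : ℤ} (hjk : j ≠ k)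
    (hpos : 0 < j * k) : 2 * lam ≤ |dispersion lam j - dispersion lam k| := by
  refine le_trans ?_ (le_abs_dispersion_sub lam hjk hpos)
  have hp : (0 : ℝ) < j * k := by exact_mod_cast hpos
  have h1 : 2 * lam ≤ j * k + lam ^ 2 / (j * k) := by
    rw [← sub_nonneg]
    have : (j : ℝ) * k + lam ^ 2 / (j * k) - 2 * lam = (j * k - lam) ^ 2 / (j * k) := by
      rw [eq_div_iff hp.ne', sub_mul, add_mul, div_mul_cancel₀ _ hp.ne']
      ring
    rw [this]
    positivity
  nlinarith [sq_nonneg (j : ℝ), sq_nonneg (k : ℝ)]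

lemma abs_le_abs_dispersion_sub (lam : ℝ) {j k : ℤ} (hjk : j ≠ k) (hpos : 0 < j * k) :
    |(j : ℝ)| ≤ |dispersion lam j - dispersion lam k| := by
  refine le_trans ?_ (le_abs_dispersion_sub lam hjk hpos)
  have hp : (0 : ℝ) < j * k := by exact_mod_cast hpos
  have h0 : 0 ≤ lam ^ 2 / ((j : ℝ) * k) := by positivity
  have h1 : |(j : ℝ)| ≤ (j : ℝ) ^ 2 := by
    have hj : (1 : ℝ) ≤ |(j : ℝ)| := by
      exact_mod_cast Int.one_le_abs (left_ne_zero_of_mul hpos.ne')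
    rw [← sq_abs]
    exact le_self_pow₀ hj two_ne_zero
  nlinarith [sq_nonneg (k : ℝ)]

lemma abs_le_abs_dispersion (lam : ℝ) {k : ℤ} (hk : k ≠ 0) :
    |(k : ℝ)| - lam ^ 2 ≤ |dispersion lam k| := by
  have h1 : (1 : ℝ) ≤ |(k : ℝ)| := by exact_mod_cast Int.one_le_abs hk
  have h2 : |(k : ℝ)| ≤ |(k : ℝ) ^ 3| := by
    rw [abs_pow]
    exact le_self_pow₀ h1 (by norm_num)
  have h3 : |lam ^ 2 / (k : ℝ)| ≤ lam ^ 2 := by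
    rw [abs_div, abs_of_nonneg (sq_nonneg lam)]
    exact div_le_self (sq_nonneg lam) h1
  have h4 := abs_sub_abs_le_abs_sub ((k : ℝ) ^ 3) (lam ^ 2 / k)
  unfold dispersion
  linarith

lemma Finset.exists_pos_le_of_forall_pos {ι : Type*} (s : Finset ι) (f : ι → ℝ)
    (hf : ∀ i ∈ s, 0 < f i) : ∃ γ : ℝ, 0 < γ ∧ ∀ i ∈ s, γ ≤ f i := by
  rcases s.eq_empty_or_nonempty with rfl | hs
  · exact ⟨1, one_pos, by simp⟩
  · obtain ⟨i, hi, h⟩ := s.exists_min_image f hs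
    exact ⟨f i, hf i hi, h⟩

lemma exists_dispersion_gap (lam ω : ℝ) :
    ∃ γ : ℝ, 0 < γ ∧ ∀ k : ℤ, k ≠ 0 → dispersion lam k ≠ ω → γ ≤ |dispersion lam k - ω| := by
  classical
  obtain ⟨N, hN⟩ := exists_nat_ge (1 + |ω| + lam ^ 2)
  obtain ⟨γ, hγ, h⟩ := ((Finset.Icc (-(N : ℤ)) N).filter
    fun k => dispersion lam k ≠ ω).exists_pos_le_of_forall_pos (fun k => |dispersion lam k - ω|)
    (fun k hk => abs_pos.2 (sub_ne_zero.2 (Finset.mem_filter.1 hk).2))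
  refine ⟨min γ 1, lt_min hγ one_pos, fun k hk hkω => ?_⟩
  by_cases hkN : |k| ≤ N
  · exact (min_le_left _ _).trans (h k (Finset.mem_filter.2 ⟨Finset.mem_Icc.2 (abs_le.1 hkN), hkω⟩))
  · refine (min_le_right _ _).trans ?_
    have h1 : (N : ℝ) ≤ |(k : ℝ)| := by exact_mod_cast (not_le.1 hkN).le
    have h2 := abs_le_abs_dispersion lam hk
    have h3 := abs_sub_abs_le_abs_sub (dispersion lam k) ω
    linarith

variable {ψ : ℤ → E} {K c δ : ℝ}

namespace AlmostOrthogonal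

lemma exists_observesWith_level (h : AlmostOrthogonal ψ K c δ) (lam ω : ℝ) {T : ℝ} (hT : 0 < T) :
    ∃ C : ℝ, 0 < C ∧
      ObservesWith ψ (dispersion lam) {k | k ≠ 0 ∧ dispersion lam k = ω} T C := by
  have hc := h.lower_pos
  have hδ := h.angle_pos
  refine ⟨2 / (T * δ * c), by positivity, h.observesWith_of_gap hT le_rfl (by simp) ?_⟩
  intro j hj k hk hjk hpos
  have h1 := abs_le_abs_dispersion_sub lam hjk hpos
  rw [hj.2, hk.2, sub_self, abs_zero] at h1
  have h2 : (1 : ℝ) ≤ |(j : ℝ)| := by exact_mod_cast Int.one_le_abs hj.1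
  linarith

/-- Observability is stable under small changes of the parameter. -/
lemma observesWith_of_close (h : AlmostOrthogonal ψ K c δ) {lam mu T C : ℝ} (hT : 0 < T)
    (hC : 0 < C) (hobs : ObservesWith ψ (dispersion lam) {0}ᶜ T C)
    (hclose : 4 * C * (T * (K * (T * |lam ^ 2 - mu ^ 2|) ^ 2)) ≤ 1) :
    ObservesWith ψ (dispersion mu) {0}ᶜ T (4 * C) := by
  intro F hF a
  have hK := h.bound_pos
  set A := ∑ k ∈ F, ‖a k‖ ^ 2 with hA
  have hA0 : 0 ≤ A := by positivity
  set b : ℝ → ℤ → ℂ := fun t k => Complex.exp (Complex.I * (t * dispersion lam k : ℝ)) * a k -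
    Complex.exp (Complex.I * (t * dispersion mu k : ℝ)) * a k with hb
  have hsplit : ∀ t, expSum ψ (dispersion lam) F a t = expSum ψ (dispersion mu) F a t +
      (expSum ψ (dispersion lam) F a t - expSum ψ (dispersion mu) F a t) := fun t => by abel
  have hdiff : ∀ t, expSum ψ (dispersion lam) F a t - expSum ψ (dispersion mu) F a t =
      ∑ k ∈ F, b t k • ψ k := by
    intro t
    simp only [expSum, ← Finset.sum_sub_distrib, ← sub_smul, hb]
  have hbk : ∀ t ∈ Set.Icc 0 T, ∀ k ∈ F, ‖b t k‖ ^ 2 ≤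
      (T * |lam ^ 2 - mu ^ 2|) ^ 2 * ‖a k‖ ^ 2 := by
    intro t ht k hk
    have hk0 : k ≠ 0 := fun h0 => hF hk (by simp [h0])
    have h1 : (1 : ℝ) ≤ |(k : ℝ)| := by exact_mod_cast Int.one_le_abs hk0
    have h2 : b t k = Complex.exp (Complex.I * (t * dispersion mu k : ℝ)) *
        (Complex.exp (Complex.I * (t * (dispersion lam k - dispersion mu k) : ℝ)) - 1) * a k := by
      simp only [hb]
      rw [mul_sub, ← Complex.exp_add, mul_one, sub_mul]
      congr 3
      push_cast
      ring_nf
    have h3 : |t * (dispersion lam k - dispersion mu k)| ≤ T * |lam ^ 2 - mu ^ 2| := by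
      rw [abs_mul, abs_of_nonneg ht.1]
      have : dispersion lam k - dispersion mu k = -((lam ^ 2 - mu ^ 2) / k) := by
        unfold dispersion
        ring
      rw [this, abs_neg, abs_div]
      exact mul_le_mul ht.2 (div_le_self (abs_nonneg _) h1) (by positivity) hT.le
    rw [h2, norm_mul, norm_mul, Complex.norm_exp_I_mul_ofReal, one_mul, mul_pow]
    have h4 := (Real.norm_exp_I_mul_ofReal_sub_one_le
      (x := t * (dispersion lam k - dispersion mu k))).trans h3
    gcongr
  have hcont : Continuous fun t =>
      expSum ψ (dispersion lam) F a t - expSum ψ (dispersion mu) F a t :=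
    (continuous_expSum _ _ _ _).sub (continuous_expSum _ _ _ _)
  have h1 := integral_norm_add_sq_le (continuous_expSum ψ (dispersion mu) F a) hcont hT.le
  simp only [← hsplit] at h1
  have h2 : ∫ t in (0:ℝ)..T,
      ‖expSum ψ (dispersion lam) F a t - expSum ψ (dispersion mu) F a t‖ ^ 2 ≤
      T * (K * ((T * |lam ^ 2 - mu ^ 2|) ^ 2 * A)) := by
    refine integral_le_const_of_le (hcont.norm.pow 2) hT.le fun t ht => ?_
    change ‖expSum ψ (dispersion lam) F a t - expSum ψ (dispersion mu) F a t‖ ^ 2 ≤ _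
    rw [hdiff]
    refine (h.norm_sum_sq_le F _).trans ?_
    refine mul_le_mul_of_nonneg_left ?_ hK.le
    rw [hA, Finset.mul_sum]
    exact Finset.sum_le_sum (hbk t ht)
  have h3 := (hobs F hF a).trans (mul_le_mul_of_nonneg_left
    (h1.trans (add_le_add_right (mul_le_mul_of_nonneg_left h2 zero_le_two) _)) hC.le)
  have h4 : 4 * C * (T * (K * (T * |lam ^ 2 - mu ^ 2|) ^ 2)) * A ≤ 1 * A := by gcongr
  nlinarith

variable [CompleteSpace E]

lemma exists_observesWith_of_compl (h : AlmostOrthogonal ψ K c δ) (lam : ℝ) (W : Finset ℝ) :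
    ∀ T' T : ℝ, 0 < T' → T' < T →
      (∃ C : ℝ, 0 < C ∧
        ObservesWith ψ (dispersion lam) {k | k ≠ 0 ∧ dispersion lam k ∉ W} T' C) →
      ∃ C : ℝ, 0 < C ∧ ObservesWith ψ (dispersion lam) {0}ᶜ T C := by
  classical
  induction W using Finset.induction_on with
  | empty =>
    rintro T' T hT' hTT ⟨C, hC, hobs⟩
    exact ⟨C, hC, hobs.mono (fun k hk => ⟨hk, by simp⟩) hC.le hT'.le hTT.le⟩
  | insert ω W _ ih =>
    rintro T' T hT' hTT ⟨C, hC, hobs⟩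
    refine ih ((T' + T) / 2) T (by linarith) (by linarith) ?_
    obtain ⟨γ, hγ, hgap⟩ := exists_dispersion_gap lam ω
    obtain ⟨C₂, hC₂, hobs₂⟩ :=
      h.exists_observesWith_level lam ω (T := (T' + T) / 2) (by linarith)
    obtain ⟨C', hC', hobs'⟩ := h.observesWith_union_level hT' (by linarith) hγ
      (fun k hk => hgap k hk.1 fun h0 => hk.2 (h0 ▸ Finset.mem_insert_self _ _))
      (fun k hk => hk.2) hC hC₂ hobs hobs₂
    refine ⟨C', hC', hobs'.mono ?_ hC'.le (by linarith) le_rfl⟩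
    intro k hk
    by_cases hω : dispersion lam k = ω
    · exact Or.inr ⟨hk.1, hω⟩
    · exact Or.inl ⟨hk.1, by simp [hω, hk.2]⟩

lemma exists_observesWith_fixed (h : AlmostOrthogonal ψ K c δ) (lam : ℝ) {T : ℝ} (hT : 0 < T) :
    ∃ C : ℝ, 0 < C ∧ ObservesWith ψ (dispersion lam) {0}ᶜ T C := by
  classical
  have hc := h.lower_pos
  have hδ := h.angle_pos
  obtain ⟨N, hN⟩ := exists_nat_ge (2 * (4 * K / (T / 2 * δ * c)))
  refine h.exists_observesWith_of_compl lam ((Finset.Icc (-(N : ℤ)) N).image (dispersion lam))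
    (T / 2) T (by linarith) (by linarith) ⟨2 / (T / 2 * δ * c), by positivity, ?_⟩
  refine h.observesWith_of_gap (by linarith) le_rfl (by simp) ?_
  intro j hj k hk hjk hpos
  refine le_trans ?_ (abs_le_abs_dispersion_sub lam hjk hpos)
  refine hN.trans ?_
  have : (N : ℤ) ≤ |j| := by
    by_contra hcon
    exact hj.2 (Finset.mem_image_of_mem _ (Finset.mem_Icc.2 (abs_le.1 (not_le.1 hcon).le)))
  exact_mod_cast this

/-- Observability with a constant which is uniform in the parameter `λ ≥ 0`. -/
theorem exists_uniform_observesWith (h : AlmostOrthogonal ψ K c δ) {T : ℝ} (hT : 0 < T) :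
    ∃ C : ℝ, 0 < C ∧ ∀ lam : ℝ, 0 ≤ lam → ObservesWith ψ (dispersion lam) {0}ᶜ T C := by
  have hc := h.lower_pos
  have hδ := h.angle_pos
  set D := 4 * K / (T * δ * c) with hD
  have hlow : ∃ C : ℝ, 0 < C ∧
      ∀ lam ∈ Set.Icc 0 D, ObservesWith ψ (dispersion lam) {0}ᶜ T C := by
    refine isCompact_Icc.induction_on
      (p := fun s => ∃ C : ℝ, 0 < C ∧ ∀ lam ∈ s, ObservesWith ψ (dispersion lam) {0}ᶜ T C)
      ⟨1, one_pos, by simp⟩ ?_ ?_ ?_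
    · rintro s t hst ⟨C, hC, hobs⟩
      exact ⟨C, hC, fun lam hlam => hobs lam (hst hlam)⟩
    · rintro s t ⟨C, hC, hobs⟩ ⟨C', hC', hobs'⟩
      refine ⟨max C C', lt_max_of_lt_left hC, ?_⟩
      rintro lam (hlam | hlam)
      · exact (hobs lam hlam).mono_const hT.le (le_max_left _ _)
      · exact (hobs' lam hlam).mono_const hT.le (le_max_right _ _)
    · intro lam _
      obtain ⟨C, hC, hobs⟩ := h.exists_observesWith_fixed lam hT
      have hcont : Continuous fun mu : ℝ => 4 * C * (T * (K * (T * |lam ^ 2 - mu ^ 2|) ^ 2)) := by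
        fun_prop
      have hev : ∀ᶠ mu in nhds lam, 4 * C * (T * (K * (T * |lam ^ 2 - mu ^ 2|) ^ 2)) < 1 :=
        hcont.continuousAt.eventually_lt continuousAt_const (by simp)
      exact ⟨_, mem_nhdsWithin_of_mem_nhds hev, 4 * C, by positivity,
        fun mu hmu => h.observesWith_of_close hT hC hobs (le_of_lt hmu)⟩
  obtain ⟨C, hC, hobs⟩ := hlow
  refine ⟨max C (2 / (T * δ * c)), lt_max_of_lt_left hC, fun lam hlam => ?_⟩
  rcases le_total lam D with hle | hle
  · exact (hobs lam ⟨hlam, hle⟩).mono_const hT.le (le_max_left _ _)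
  · exact (h.observesWith_of_gap hT hle (by simp) fun j _ k _ hjk hpos =>
      two_mul_le_abs_dispersion_sub lam hjk hpos).mono_const hT.le (le_max_right _ _)

end AlmostOrthogonal

end Observability

section FourierDecay

lemma periodic_deriv {f : ℝ → ℝ} {c : ℝ} (hf : Function.Periodic f c) :
    Function.Periodic (deriv f) c := fun x => by
  rw [← deriv_comp_add_const, show (fun y => f (y + c)) = f from funext hf]

lemma hasDerivAt_exp_I_mul_int (n : ℤ) (x : ℝ) :
    HasDerivAt (fun y : ℝ => Complex.exp (Complex.I * n * y))
      (Complex.I * n * Complex.exp (Complex.I * n * x)) x := by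
  have h := ((hasDerivAt_id x).ofReal_comp.const_mul (Complex.I * n)).cexp
  simpa [mul_comm] using h

lemma exp_I_mul_int_two_pi (n : ℤ) : Complex.exp (Complex.I * n * (2 * π : ℝ)) = 1 := by
  rw [← Complex.exp_int_mul_two_pi_mul_I n]
  congr 1
  push_cast
  ring

lemma integral_deriv_mul_exp {f : ℝ → ℝ} (hf : ContDiff ℝ 1 f)
    (hper : Function.Periodic f (2 * π)) (n : ℤ) :
    ∫ x in (0:ℝ)..(2 * π), ((deriv f x : ℝ) : ℂ) * Complex.exp (Complex.I * n * x) =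
      -(Complex.I * n) * ∫ x in (0:ℝ)..(2 * π), (f x : ℂ) * Complex.exp (Complex.I * n * x) := by
  have hd : Continuous (deriv f) := hf.continuous_deriv le_rfl
  have h := intervalIntegral.integral_mul_deriv_eq_deriv_mul (a := 0) (b := 2 * π)
    (u := fun x : ℝ => (f x : ℂ)) (u' := fun x : ℝ => ((deriv f x : ℝ) : ℂ))
    (v := fun x : ℝ => Complex.exp (Complex.I * n * x))
    (v' := fun x : ℝ => Complex.I * n * Complex.exp (Complex.I * n * x))
    (fun x _ => ((hf.differentiable one_ne_zero x).hasDerivAt).ofReal_comp)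
    (fun x _ => hasDerivAt_exp_I_mul_int n x)
    (by apply Continuous.intervalIntegrable; fun_prop)
    (by apply Continuous.intervalIntegrable; fun_prop)
  have h0 : f (2 * π) = f 0 := by simpa using hper 0
  rw [exp_I_mul_int_two_pi, h0] at h
  simp only [Complex.ofReal_zero, mul_zero, Complex.exp_zero, mul_one, sub_self, zero_sub] at h
  rw [← neg_eq_iff_eq_neg] at h
  rw [← h, neg_mul, ← intervalIntegral.integral_const_mul]
  congr 1
  apply intervalIntegral.integral_congr
  intro x _
  simp only
  ring

lemma integral_lift_mul_fourier {h : ℝ → ℝ} (hper : Function.Periodic h (2 * π)) (n : ℤ) :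
    ∫ x : Torus, (hper.lift x : ℂ) * fourier n x =
      ∫ x in (0:ℝ)..(2 * π), (h x : ℂ) * Complex.exp (Complex.I * n * x) := by
  rw [← AddCircle.intervalIntegral_preimage (2 * π) 0, zero_add]
  apply intervalIntegral.integral_congr
  intro x _
  simp only [Function.Periodic.lift_coe, fourier_coe_apply]
  congr 2
  have : (π : ℂ) ≠ 0 := by exact_mod_cast Real.pi_ne_zero
  push_cast
  field_simp

lemma exists_fourier_decay {h : ℝ → ℝ} (hreg : ContDiff ℝ 2 h)
    (hper : Function.Periodic h (2 * π)) :
    ∃ B : ℝ, 0 ≤ B ∧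
      ∀ n : ℤ, ‖∫ x : Torus, (hper.lift x : ℂ) * fourier n x‖ ≤ B * (1 / (1 + (n : ℝ) ^ 2)) := by
  have hreg' : ContDiff ℝ 1 (deriv h) := by
    have : ContDiff ℝ (1 + 1) h := by simpa [one_add_one_eq_two] using hreg
    exact (contDiff_succ_iff_deriv.1 this).2.2
  have hpi : (0:ℝ) ≤ 2 * π := by positivity
  have key : ∀ (f : ℝ → ℝ) (n : ℤ),
      ‖∫ x in (0:ℝ)..(2 * π), (f x : ℂ) * Complex.exp (Complex.I * n * x)‖ ≤
        ∫ x in (0:ℝ)..(2 * π), |f x| := by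
    intro f n
    refine (intervalIntegral.norm_integral_le_integral_norm hpi).trans_eq ?_
    apply intervalIntegral.integral_congr
    intro x _
    have : Complex.I * n * x = ((n * x : ℝ) : ℂ) * Complex.I := by push_cast; ring
    simp only [norm_mul, this, Complex.norm_exp_ofReal_mul_I, mul_one, Complex.norm_real,
      Real.norm_eq_abs]
  refine ⟨(∫ x in (0:ℝ)..(2 * π), |h x|) + ∫ x in (0:ℝ)..(2 * π), |deriv (deriv h) x|,
    add_nonneg (intervalIntegral.integral_nonneg hpi fun _ _ => abs_nonneg _)
      (intervalIntegral.integral_nonneg hpi fun _ _ => abs_nonneg _), fun n => ?_⟩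
  rw [integral_lift_mul_fourier, mul_one_div, le_div_iff₀ (by positivity), mul_add, mul_one]
  have h2 := integral_deriv_mul_exp hreg' (periodic_deriv hper) n
  rw [integral_deriv_mul_exp (hreg.of_le one_le_two) hper n, ← mul_assoc] at h2
  have h3 := congrArg norm h2
  have h4 : ‖-(Complex.I * (n : ℂ)) * -(Complex.I * (n : ℂ))‖ = (n : ℝ) ^ 2 := by
    simp [sq]
  rw [norm_mul, h4] at h3
  have h5 := key (deriv (deriv h)) n
  have h6 := key h n
  rw [h3] at h5
  linarith

end FourierDecay

section AlmostOrthogonalCriterion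

/-- The decay weight `1 / (1 + n²)`. -/
def decayWeight (n : ℤ) : ℝ := 1 / (1 + (n : ℝ) ^ 2)

lemma decayWeight_pos (n : ℤ) : 0 < decayWeight n := by
  unfold decayWeight
  positivity

lemma decayWeight_le_one (n : ℤ) : decayWeight n ≤ 1 := by
  unfold decayWeight
  rw [div_le_one (by positivity)]
  nlinarith [sq_nonneg (n : ℝ)]

lemma decayWeight_neg (n : ℤ) : decayWeight (-n) = decayWeight n := by
  simp [decayWeight]

lemma decayWeight_le_of_sq_le {m n : ℤ} (h : m ^ 2 ≤ n ^ 2) : decayWeight n ≤ decayWeight m := by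
  unfold decayWeight
  have : (m : ℝ) ^ 2 ≤ (n : ℝ) ^ 2 := by exact_mod_cast h
  gcongr

lemma summable_decayWeight : Summable decayWeight := by
  have h1 : Summable fun n : ℤ => 1 / (n : ℝ) ^ 2 := Real.summable_one_div_int_pow.2 one_lt_two
  have h2 : Summable fun n : ℤ => if n = 0 then (1 : ℝ) else 0 :=
    summable_of_ne_finset_zero (s := {0}) fun n hn => if_neg (by simpa using hn)
  refine (h1.add h2).of_nonneg_of_le (fun n => (decayWeight_pos n).le) fun n => ?_
  by_cases hn : n = 0
  · simp [hn, decayWeight]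
  · have : (n : ℝ) ≠ 0 := by exact_mod_cast hn
    simp only [hn, if_false, add_zero, decayWeight]
    gcongr
    linarith

lemma finite_lt_decayWeight {M ε : ℝ} (hε : 0 < ε) :
    {n : ℤ | ε < M * decayWeight n}.Finite := by
  have h := (summable_decayWeight.mul_left M).tendsto_cofinite_zero
  have h2 := h.eventually (gt_mem_nhds hε)
  rw [eventually_cofinite] at h2
  exact h2.subset fun n hn => not_lt.2 (le_of_lt hn)

variable {E : Type*} [NormedAddCommGroup E] [InnerProductSpace ℂ E]

theorem exists_almostOrthogonal_of_decay {ψ : ℤ → E} {M Q : ℝ} (hM : 0 ≤ M) (hQ : 0 < Q)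
    (hinner : ∀ j k, ‖inner ℂ (ψ j) (ψ k)‖ ≤
      M * (decayWeight (k - j) + decayWeight j * decayWeight k))
    (hnorm : ∀ j, Q - M * decayWeight j ≤ ‖ψ j‖ ^ 2)
    (hne : ∀ j, j ≠ 0 → ψ j ≠ 0)
    (hlt : ∀ j k, j * k < 0 → ‖inner ℂ (ψ j) (ψ k)‖ < ‖ψ j‖ * ‖ψ k‖) :
    ∃ K c δ, AlmostOrthogonal ψ K c δ := by
  obtain ⟨γ, hγ, hγle⟩ := Finset.exists_pos_le_of_forall_pos
    ((finite_lt_decayWeight (M := M) (half_pos hQ)).toFinset.erase 0) (fun j => ‖ψ j‖ ^ 2)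
    fun j hj => by have := norm_pos_iff.2 (hne j (Finset.ne_of_mem_erase hj)); positivity
  set c := min γ (Q / 2) with hc
  have hc0 : 0 < c := lt_min hγ (half_pos hQ)
  have hlower : ∀ j : ℤ, j ≠ 0 → c ≤ ‖ψ j‖ ^ 2 := by
    intro j hj
    by_cases hjs : Q / 2 < M * decayWeight j
    · exact (min_le_left _ _).trans (hγle j (by simp [hj, hjs]))
    · have := hnorm j
      exact (min_le_right _ _).trans (by linarith)
  set s := (finite_lt_decayWeight (M := M) (div_pos hc0 four_pos)).toFinset with hs
  have hnorms : ∀ j k : ℤ, j * k < 0 → 0 < ‖ψ j‖ * ‖ψ k‖ := fun j k hjk =>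
    (norm_nonneg _).trans_lt (hlt j k hjk)
  obtain ⟨ε, hε, hεle⟩ := Finset.exists_pos_le_of_forall_pos
    ((s ×ˢ s).filter fun p => p.1 * p.2 < 0)
    (fun p => 1 - ‖inner ℂ (ψ p.1) (ψ p.2)‖ / (‖ψ p.1‖ * ‖ψ p.2‖)) fun p hp => by
      have hp' := (Finset.mem_filter.1 hp).2
      rw [sub_pos, div_lt_one (hnorms _ _ hp')]
      exact hlt _ _ hp'
  have hsmall : ∀ j k : ℤ, j * k < 0 → (j ∉ s ∨ k ∉ s) →
      ‖inner ℂ (ψ j) (ψ k)‖ ≤ 1 / 2 * (‖ψ j‖ * ‖ψ k‖) := by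
    intro j k hjk hjks
    have hj : j ≠ 0 := by rintro rfl; simp at hjk
    have hk : k ≠ 0 := by rintro rfl; simp at hjk
    have hprod : c ≤ ‖ψ j‖ * ‖ψ k‖ := by
      refine le_of_sq_le_sq ?_ (by positivity)
      rw [mul_pow, sq c]
      exact mul_le_mul (hlower j hj) (hlower k hk) hc0.le (by positivity)
    have hb := hinner j k
    have h1 : decayWeight (k - j) ≤ decayWeight j := decayWeight_le_of_sq_le (by nlinarith)
    have h2 : decayWeight (k - j) ≤ decayWeight k := decayWeight_le_of_sq_le (by nlinarith)
    have h3 : decayWeight j * decayWeight k ≤ decayWeight j :=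
      mul_le_of_le_one_right (decayWeight_pos j).le (decayWeight_le_one k)
    have h4 : decayWeight j * decayWeight k ≤ decayWeight k :=
      mul_le_of_le_one_left (decayWeight_pos k).le (decayWeight_le_one j)
    rcases hjks with h | h
    · have h5 : M * decayWeight j ≤ c / 4 := by simpa [hs] using h
      nlinarith
    · have h5 : M * decayWeight k ≤ c / 4 := by simpa [hs] using h
      nlinarith
  set W := ∑' n, decayWeight n with hW
  have hW0 : 0 ≤ W := tsum_nonneg fun n => (decayWeight_pos n).le
  refine ⟨M * (W + W) + 1, c, min (1 / 2) ε, by positivity, hc0, lt_min (by norm_num) hε,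
    (min_le_left _ _).trans (by norm_num), fun F j => ?_, hlower, fun j k hjk => ?_⟩
  · have h1 : ∑ k ∈ F, decayWeight (k - j) ≤ W := by
      rw [hW, ← (Equiv.subRight j).tsum_eq decayWeight]
      exact Summable.sum_le_tsum F (fun n _ => (decayWeight_pos _).le)
        ((Equiv.subRight j).summable_iff.2 summable_decayWeight)
    have h2 : ∑ k ∈ F, decayWeight k ≤ W :=
      summable_decayWeight.sum_le_tsum F fun n _ => (decayWeight_pos _).le
    have h3 : decayWeight j * ∑ k ∈ F, decayWeight k ≤ W :=
      (mul_le_of_le_one_left (Finset.sum_nonneg fun n _ => (decayWeight_pos n).le)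
        (decayWeight_le_one j)).trans h2
    calc ∑ k ∈ F, ‖inner ℂ (ψ j) (ψ k)‖
        ≤ ∑ k ∈ F, M * (decayWeight (k - j) + decayWeight j * decayWeight k) :=
          Finset.sum_le_sum fun k _ => hinner j k
      _ = M * (∑ k ∈ F, decayWeight (k - j) + decayWeight j * ∑ k ∈ F, decayWeight k) := by
          rw [← Finset.mul_sum, Finset.sum_add_distrib, Finset.mul_sum]
      _ ≤ M * (W + W) := by gcongr
      _ ≤ M * (W + W) + 1 := by linarith
  · have hpos := hnorms j k hjk
    by_cases hjks : j ∈ s ∧ k ∈ s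
    · have h1 := hεle (j, k) (by simp [hjks, hjk])
      simp only at h1
      have h2 : ‖inner ℂ (ψ j) (ψ k)‖ ≤ (1 - ε) * (‖ψ j‖ * ‖ψ k‖) := by
        rw [← div_le_iff₀ hpos]
        linarith
      refine h2.trans ?_
      gcongr
      exact min_le_right _ _
    · refine (hsmall j k hjk (not_and_or.1 hjks)).trans ?_
      gcongr
      have := min_le_left (1 / 2 : ℝ) ε
      linarith

end AlmostOrthogonalCriterion

section LocalizedExponentials

lemma Function.Periodic.continuous_lift {α : Type*} [TopologicalSpace α] {f : ℝ → α} {c : ℝ}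
    (hper : Function.Periodic f c) (hf : Continuous f) : Continuous hper.lift :=
  continuous_coinduced_dom.2 hf

/-- The exponential `x ↦ e^{ikx}` as an element of `L²(𝕋)`. -/
def expL2 (k : ℤ) : L2T := ContinuousMap.toLp (E := ℂ) 2 volume ℂ (fourier k)

lemma coeFn_expL2 (k : ℤ) : (expL2 k : Torus → ℂ) =ᵐ[volume] fourier k :=
  ContinuousMap.coeFn_toLp volume (fourier k)

lemma integrable_torus {f : Torus → ℂ} (hf : Continuous f) : Integrable f volume :=
  hf.integrable_of_hasCompactSupport (HasCompactSupport.of_compactSpace f)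

variable {γ : Torus → ℝ} {G : L2T →L[ℂ] L2T}

lemma coeFn_apply_expL2 (hG : IsG γ G) (k : ℤ) :
    (G (expL2 k) : Torus → ℂ) =ᵐ[volume]
      fun x => (γ x : ℂ) * (fourier k x - ∫ y : Torus, (γ y : ℂ) * fourier k y) := by
  have h1 : ∫ y : Torus, (γ y : ℂ) * (expL2 k : Torus → ℂ) y =
      ∫ y : Torus, (γ y : ℂ) * fourier k y := by
    apply integral_congr_ae
    filter_upwards [coeFn_expL2 k] with x hx
    rw [hx]
  filter_upwards [hG (expL2 k), coeFn_expL2 k] with x hx hx'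
  rw [hx, hx', h1]

lemma inner_apply_expL2 (hG : IsG γ G) (hγ : Continuous γ) (j k : ℤ) :
    inner ℂ (G (expL2 j)) (G (expL2 k)) =
      (∫ x : Torus, ((γ x ^ 2 : ℝ) : ℂ) * fourier (k - j) x)
      - (∫ x : Torus, (γ x : ℂ) * fourier k x) * (∫ x : Torus, ((γ x ^ 2 : ℝ) : ℂ) * fourier (-j) x)
      - (∫ x : Torus, (γ x : ℂ) * fourier (-j) x) * (∫ x : Torus, ((γ x ^ 2 : ℝ) : ℂ) * fourier k x)
      + (∫ x : Torus, (γ x : ℂ) * fourier (-j) x) * (∫ x : Torus, (γ x : ℂ) * fourier k x) *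
        (∫ x : Torus, ((γ x ^ 2 : ℝ) : ℂ) * fourier 0 x) := by
  set c := ∫ x : Torus, (γ x : ℂ) * fourier k x with hc
  set d := ∫ x : Torus, (γ x : ℂ) * fourier (-j) x with hd
  have hconj : (starRingEnd ℂ) (∫ x : Torus, (γ x : ℂ) * fourier j x) = d := by
    rw [hd, ← integral_conj]
    congr 1
    ext x
    rw [map_mul, Complex.conj_ofReal, fourier_neg]
  have hq : ∀ n : ℤ, Integrable (fun x : Torus => ((γ x ^ 2 : ℝ) : ℂ) * fourier n x) volume :=
    fun n => integrable_torus (by fun_prop)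
  calc inner ℂ (G (expL2 j)) (G (expL2 k))
      = ∫ x : Torus, (((γ x ^ 2 : ℝ) : ℂ) * fourier (k - j) x
          - c * (((γ x ^ 2 : ℝ) : ℂ) * fourier (-j) x)
          - d * (((γ x ^ 2 : ℝ) : ℂ) * fourier k x)
          + d * c * (((γ x ^ 2 : ℝ) : ℂ) * fourier 0 x)) := by
        rw [L2.inner_def]
        apply integral_congr_ae
        filter_upwards [coeFn_apply_expL2 hG j, coeFn_apply_expL2 hG k] with x hj hk
        rw [hj, hk, RCLike.inner_apply, map_mul, map_sub, hconj, Complex.conj_ofReal,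
          ← fourier_neg, sub_eq_add_neg k j, fourier_add, fourier_zero]
        push_cast
        ring
    _ = _ := by
        rw [integral_add, integral_sub, integral_sub, integral_const_mul, integral_const_mul,
          integral_const_mul]
        · exact hq _
        · exact (hq _).const_mul _
        · exact (hq _).sub ((hq _).const_mul _)
        · exact (hq _).const_mul _
        · exact ((hq _).sub ((hq _).const_mul _)).sub ((hq _).const_mul _)
        · exact (hq _).const_mul _

lemma exists_combination_const {j k : ℤ} {α β κ : ℂ} {s : Set ℝ} (hs : IsOpen s)
    (hne : s.Nonempty) (hj : j ≠ 0) (hk : k ≠ 0) (hjk : j ≠ k)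
    (h : ∀ x ∈ s, α * Complex.exp (Complex.I * j * x) + β * Complex.exp (Complex.I * k * x) = κ) :
    α = 0 ∧ β = 0 := by
  obtain ⟨x₀, hx₀⟩ := hne
  have hderiv : ∀ (α' β' κ' : ℂ), (∀ x ∈ s, α' * Complex.exp (Complex.I * j * x) +
      β' * Complex.exp (Complex.I * k * x) = κ') → ∀ x ∈ s,
      (α' * (Complex.I * j)) * Complex.exp (Complex.I * j * x) +
        (β' * (Complex.I * k)) * Complex.exp (Complex.I * k * x) = 0 := by
    intro α' β' κ' h' x hx
    have h1 := ((hasDerivAt_exp_I_mul_int j x).const_mul α').add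
      ((hasDerivAt_exp_I_mul_int k x).const_mul β')
    have h2 : HasDerivAt (fun y : ℝ => α' * Complex.exp (Complex.I * j * y) +
        β' * Complex.exp (Complex.I * k * y)) 0 x := by
      refine (hasDerivAt_const x κ').congr_of_eventuallyEq ?_
      filter_upwards [hs.mem_nhds hx] with y hy using h' y hy
    rw [← h1.unique h2]
    ring
  have h1 := hderiv _ _ _ h
  have h2 := hderiv _ _ _ h1 x₀ hx₀
  have h1 := h1 x₀ hx₀
  set X := Complex.exp (Complex.I * j * x₀) with hX
  set Y := Complex.exp (Complex.I * k * x₀) with hY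
  have hX0 : X ≠ 0 := Complex.exp_ne_zero _
  have hY0 : Y ≠ 0 := Complex.exp_ne_zero _
  have hj' : (j : ℂ) ≠ 0 := by exact_mod_cast hj
  have hk' : (k : ℂ) ≠ 0 := by exact_mod_cast hk
  have hjk' : (j : ℂ) - k ≠ 0 := sub_ne_zero.2 (by exact_mod_cast hjk)
  constructor
  · have : α * (Complex.I * j * (Complex.I * (j - k)) * X) = 0 := by
      linear_combination h2 - Complex.I * k * h1
    simpa [hX0, hj', hjk'] using this
  · have : β * (Complex.I * k * (Complex.I * (j - k)) * Y) = 0 := by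
      linear_combination Complex.I * j * h1 - h2
    simpa [hY0, hk', hjk'] using this

lemma eq_zero_of_combination_eq_zero {g : ℝ → ℝ} (hg : Continuous g)
    (hper : Function.Periodic g (2 * π)) (hne : ∃ x, g x ≠ 0) (hG : IsG hper.lift G)
    {j k : ℤ} (hj : j ≠ 0) (hk : k ≠ 0) (hjk : j ≠ k) {α β : ℂ}
    (h : α • G (expL2 j) + β • G (expL2 k) = 0) : α = 0 ∧ β = 0 := by
  have hγ : Continuous hper.lift := hper.continuous_lift hg
  set c : ℤ → ℂ := fun n => ∫ y : Torus, (hper.lift y : ℂ) * fourier n y with hc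
  have hae : (fun x : Torus => α * ((hper.lift x : ℂ) * (fourier j x - c j)) +
      β * ((hper.lift x : ℂ) * (fourier k x - c k))) =ᵐ[volume] fun _ => 0 := by
    have h0 := Lp.coeFn_zero ℂ 2 (volume : Measure Torus)
    rw [← h] at h0
    filter_upwards [h0, Lp.coeFn_add (α • G (expL2 j)) (β • G (expL2 k)),
      Lp.coeFn_smul α (G (expL2 j)), Lp.coeFn_smul β (G (expL2 k)),
      coeFn_apply_expL2 hG j, coeFn_apply_expL2 hG k] with x h1 h2 h3 h4 h5 h6
    rw [h2, Pi.add_apply, h3, h4, Pi.smul_apply, Pi.smul_apply, h5, h6] at h1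
    exact h1
  rw [Continuous.ae_eq_iff_eq volume (by fun_prop) continuous_const] at hae
  refine exists_combination_const (s := {x | g x ≠ 0}) (isOpen_ne_fun hg continuous_const) hne
    hj hk hjk (κ := α * c j + β * c k) fun x hx => ?_
  have h1 := congrFun hae (x : Torus)
  have hexp : ∀ n : ℤ, fourier n (x : Torus) = Complex.exp (Complex.I * n * x) := by
    intro n
    have : (π : ℂ) ≠ 0 := by exact_mod_cast Real.pi_ne_zero
    rw [fourier_coe_apply]
    congr 1
    push_cast
    field_simp
  simp only [Function.Periodic.lift_coe, hexp] at h1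
  have hx' : (g x : ℂ) ≠ 0 := by exact_mod_cast hx
  apply mul_left_cancel₀ hx'
  linear_combination h1

theorem exists_almostOrthogonal_apply_expL2 {g : ℝ → ℝ} (hreg : ContDiff ℝ 2 g)
    (hper : Function.Periodic g (2 * π)) (hne : ∃ x, g x ≠ 0) (hG : IsG hper.lift G) :
    ∃ K c δ, AlmostOrthogonal (fun k => G (expL2 k)) K c δ := by
  have hγ : Continuous hper.lift := hper.continuous_lift hreg.continuous
  have hper2 : Function.Periodic (fun x => g x ^ 2) (2 * π) := fun x => by
    simp only [hper x]
  have hlift : ∀ x : Torus, hper2.lift x = hper.lift x ^ 2 := fun x =>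
    QuotientAddGroup.induction_on x fun y => rfl
  obtain ⟨B, hB, hBle⟩ := exists_fourier_decay hreg hper
  obtain ⟨D, hD, hDle⟩ := exists_fourier_decay (hreg.pow 2) hper2
  simp only [hlift] at hDle
  change ∀ n : ℤ, _ ≤ B * decayWeight n at hBle
  change ∀ n : ℤ, _ ≤ D * decayWeight n at hDle
  set Q := ∫ x : Torus, hper.lift x ^ 2 with hQ
  have hQ0 : ∫ x : Torus, ((hper.lift x ^ 2 : ℝ) : ℂ) * fourier 0 x = Q := by
    simp only [fourier_zero, mul_one]
    exact integral_ofReal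
  have hQpos : 0 < Q := by
    obtain ⟨x, hx⟩ := hne
    exact (hγ.pow 2).integral_pos_of_hasCompactSupport_nonneg_nonzero
      (HasCompactSupport.of_compactSpace _) (fun y => sq_nonneg _)
      (x := (x : Torus)) (pow_ne_zero 2 hx)
  have hQD : Q ≤ D := by
    have h := hDle 0
    rw [hQ0] at h
    simpa [decayWeight, abs_of_pos hQpos] using h
  have hrest : ∀ j k : ℤ, ‖inner ℂ (G (expL2 j)) (G (expL2 k)) -
      ∫ x : Torus, ((hper.lift x ^ 2 : ℝ) : ℂ) * fourier (k - j) x‖ ≤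
      (2 * B * D + B ^ 2 * D) * (decayWeight j * decayWeight k) := by
    intro j k
    have hc := hBle k
    have hd := hBle (-j)
    have hk := hDle k
    have hj := hDle (-j)
    rw [decayWeight_neg] at hd hj
    rw [inner_apply_expL2 hG hγ, hQ0]
    set c := ∫ x : Torus, (hper.lift x : ℂ) * fourier k x
    set d := ∫ x : Torus, (hper.lift x : ℂ) * fourier (-j) x
    set p := ∫ x : Torus, ((hper.lift x ^ 2 : ℝ) : ℂ) * fourier (-j) x
    set q := ∫ x : Torus, ((hper.lift x ^ 2 : ℝ) : ℂ) * fourier k x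
    set r := ∫ x : Torus, ((hper.lift x ^ 2 : ℝ) : ℂ) * fourier (k - j) x
    have hwj := (decayWeight_pos j).le
    have hwk := (decayWeight_pos k).le
    have hQn : ‖(Q : ℂ)‖ ≤ D := by rwa [Complex.norm_real, Real.norm_of_nonneg hQpos.le]
    calc ‖r - c * p - d * q + d * c * Q - r‖ = ‖d * c * Q - c * p - d * q‖ := by
          congr 1
          ring
      _ ≤ ‖d * c * Q‖ + ‖c * p‖ + ‖d * q‖ :=
          (norm_sub_le _ _).trans (add_le_add_left (norm_sub_le _ _) _)
      _ = ‖d‖ * ‖c‖ * ‖(Q : ℂ)‖ + ‖c‖ * ‖p‖ + ‖d‖ * ‖q‖ := by simp only [norm_mul]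
      _ ≤ (B * decayWeight j) * (B * decayWeight k) * D +
          (B * decayWeight k) * (D * decayWeight j) +
          (B * decayWeight j) * (D * decayWeight k) := by gcongr
      _ = _ := by ring
  have hne0 : ∀ j : ℤ, j ≠ 0 → G (expL2 j) ≠ 0 := by
    intro j hj h0
    refine one_ne_zero (α := ℂ) (eq_zero_of_combination_eq_zero hreg.continuous hper hne hG hj
      (neg_ne_zero.2 hj) (by omega) (α := 1) (β := 0) ?_).1
    simpa using h0
  refine exists_almostOrthogonal_of_decay (M := D + (2 * B * D + B ^ 2 * D)) (by positivity) hQpos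
    (fun j k => ?_) (fun j => ?_) hne0 fun j k hjk => ?_
  · have h1 := (norm_le_norm_sub_add _ (∫ x : Torus, ((hper.lift x ^ 2 : ℝ) : ℂ) *
      fourier (k - j) x)).trans (add_le_add (hrest j k) (hDle (k - j)))
    have h2 : 0 ≤ (2 * B * D + B ^ 2 * D) * decayWeight (k - j) :=
      mul_nonneg (by positivity) (decayWeight_pos _).le
    have h3 : 0 ≤ D * (decayWeight j * decayWeight k) :=
      mul_nonneg hD (mul_pos (decayWeight_pos _) (decayWeight_pos _)).le
    linarith
  · have h1 := hrest j j
    rw [sub_self, hQ0, inner_self_eq_norm_sq_to_K] at h1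
    have h2 : ((‖G (expL2 j)‖ : ℂ) ^ 2 - Q) = ((‖G (expL2 j)‖ ^ 2 - Q : ℝ) : ℂ) := by push_cast; rfl
    erw [h2] at h1
    rw [Complex.norm_real] at h1
    have h3 : (2 * B * D + B ^ 2 * D) * (decayWeight j * decayWeight j) ≤
        (2 * B * D + B ^ 2 * D) * decayWeight j := by
      gcongr
      exact mul_le_of_le_one_left (decayWeight_pos j).le (decayWeight_le_one j)
    have h4 : 0 ≤ D * decayWeight j := mul_nonneg hD (decayWeight_pos j).le
    have h5 := neg_abs_le (‖G (expL2 j)‖ ^ 2 - Q)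
    rw [Real.norm_eq_abs] at h1
    linarith
  · have hj : j ≠ 0 := by rintro rfl; simp at hjk
    have hk : k ≠ 0 := by rintro rfl; simp at hjk
    have hjk' : j ≠ k := by rintro rfl; nlinarith
    refine (norm_inner_le_norm _ _).lt_of_ne fun heq => ?_
    obtain ⟨r, -, hrk⟩ := (norm_inner_eq_norm_iff (hne0 j hj) (hne0 k hk)).1 heq
    refine one_ne_zero (α := ℂ) (neg_eq_zero.1 (eq_zero_of_combination_eq_zero hreg.continuous hper
      hne hG hj hk hjk' (α := r) (β := -1) ?_).2)
    rw [hrk, neg_one_smul, add_neg_cancel]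

end LocalizedExponentials

section FourierSeries

lemma inner_expL2_left (k : ℤ) (u : L2T) :
    inner ℂ (expL2 k) u = 2 * π * fc (u : Torus → ℂ) k := by
  have hpi : (π : ℂ) ≠ 0 := by exact_mod_cast Real.pi_ne_zero
  rw [fc, L2.inner_def, ← mul_assoc, mul_one_div_cancel (by simp [hpi]), one_mul]
  apply integral_congr_ae
  filter_upwards [coeFn_expL2 k] with x hx
  rw [hx, RCLike.inner_apply, fourier_neg, mul_comm]

lemma inner_expL2_expL2 (j k : ℤ) :
    inner ℂ (expL2 j) (expL2 k) = if j = k then (2 * π : ℂ) else 0 := by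
  have h1 : inner ℂ (expL2 j) (expL2 k) = ∫ x : Torus, fourier (-j) x * fourier k x := by
    rw [L2.inner_def]
    apply integral_congr_ae
    filter_upwards [coeFn_expL2 j, coeFn_expL2 k] with x hj hk
    rw [hj, hk, RCLike.inner_apply, fourier_neg, mul_comm]
  have h2 := fourierCoeff_fourier (T := 2 * π) k
  have h3 := congrFun h2 j
  rw [fourierCoeff, AddCircle.integral_haarAddCircle] at h3
  simp only [smul_eq_mul] at h3
  rw [h1]
  have hpi : (2 * π : ℝ) ≠ 0 := by positivity
  rw [inv_smul_eq_iff₀ hpi] at h3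
  rw [h3, Pi.single_apply]
  split_ifs <;> simp

lemma span_expL2_closure_eq_top :
    (Submodule.span ℂ (Set.range expL2)).topologicalClosure = ⊤ := by
  convert!
    (ContinuousMap.toLp_denseRange ℂ (volume : Measure Torus) ℂ
      (p := 2) (by simp)).topologicalClosure_map_submodule span_fourier_closure_eq_top
  rw [Submodule.map_span, ← Set.range_comp]
  rfl

lemma hasSum_norm_fc_sq (u : L2T) :
    HasSum (fun k : ℤ => 2 * π * ‖fc (u : Torus → ℂ) k‖ ^ 2) (‖u‖ ^ 2) := by
  have hpos : (0 : ℝ) < 2 * π := by positivity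
  set r : ℝ := √(2 * π) with hr
  have hr0 : r ≠ 0 := (Real.sqrt_pos.2 hpos).ne'
  have hr2 : r * r = 2 * π := Real.mul_self_sqrt hpos.le
  have hr2' : (r : ℂ) * r = 2 * π := by exact_mod_cast hr2
  have hrc : (r : ℂ) ≠ 0 := by exact_mod_cast hr0
  have horth : Orthonormal ℂ fun k : ℤ => (r⁻¹ : ℂ) • expL2 k := by
    rw [orthonormal_iff_ite]
    intro j k
    rw [inner_smul_left, inner_smul_right, inner_expL2_expL2, ← hr2']
    split_ifs with h
    · simp [hrc]
    · simp
  have hspan : ⊤ ≤ (Submodule.span ℂ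
      (Set.range fun k : ℤ => (r⁻¹ : ℂ) • expL2 k)).topologicalClosure := by
    rw [← span_expL2_closure_eq_top]
    refine Submodule.topologicalClosure_mono (Submodule.span_le.2 ?_)
    rintro _ ⟨k, rfl⟩
    have : expL2 k = (r : ℂ) • ((r⁻¹ : ℂ) • expL2 k) := by
      rw [smul_smul, mul_inv_cancel₀ hrc, one_smul]
    rw [SetLike.mem_coe, this]
    exact Submodule.smul_mem _ _ (Submodule.subset_span ⟨k, rfl⟩)
  have h := (HilbertBasis.mk horth hspan).hasSum_inner_mul_inner u u
  rw [HilbertBasis.coe_mk, inner_self_eq_norm_sq_to_K] at h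
  have h2 := Complex.hasSum_re h
  convert h2 using 1
  · ext k
    rw [← inner_conj_symm u, inner_smul_left, inner_expL2_left, ← Complex.normSq_eq_conj_mul_self,
      Complex.ofReal_re, Complex.normSq_eq_norm_sq]
    simp only [norm_mul, mul_pow, map_inv₀, norm_inv, Complex.conj_ofReal, Complex.norm_real,
      Complex.norm_ofNat, Real.norm_eq_abs, sq_abs, inv_pow, abs_of_pos Real.pi_pos]
    rw [sq r, hr2]
    field_simp
  · norm_cast

lemma norm_sub_sum_fc_sq (u : L2T) (F : Finset ℤ) :
    ‖u - ∑ k ∈ F, fc (u : Torus → ℂ) k • expL2 k‖ ^ 2 =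
      ‖u‖ ^ 2 - ∑ k ∈ F, 2 * π * ‖fc (u : Torus → ℂ) k‖ ^ 2 := by
  set a := fc (u : Torus → ℂ) with ha
  set p := ∑ k ∈ F, a k • expL2 k with hp
  have hinner : ∀ v : L2T, (∀ k ∈ F, inner ℂ (expL2 k) v = 2 * π * a k) →
      inner ℂ p v = ((∑ k ∈ F, 2 * π * ‖a k‖ ^ 2 : ℝ) : ℂ) := by
    intro v hv
    rw [hp, sum_inner, Complex.ofReal_sum]
    refine Finset.sum_congr rfl fun k hk => ?_
    rw [inner_smul_left, hv k hk]
    push_cast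
    rw [← Complex.conj_mul']
    ring
  have h1 := hinner u fun k _ => inner_expL2_left k u
  have h2 := hinner p fun k hk => by
    rw [hp, inner_sum]
    simp only [inner_smul_right, inner_expL2_expL2, mul_ite, mul_zero]
    rw [Finset.sum_ite_eq F k, if_pos hk, mul_comm]
  have h3 := norm_sub_sq (𝕜 := ℂ) u p
  have h4 := norm_sq_eq_re_inner (𝕜 := ℂ) p
  rw [inner_re_symm, h1] at h3
  rw [h2] at h4
  simp only [RCLike.re_to_complex, Complex.ofReal_re] at h3 h4
  rw [h3, h4]
  ring

end FourierSeries

section LamGroup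

variable {lam : ℝ} {S : ℝ → L2T →L[ℂ] L2T} {u : L2T}

lemma IsLamGroup.fc_eq (hS : IsLamGroup lam S) (hu : MeanZero u) (t : ℝ) (k : ℤ) :
    fc (S t u : Torus → ℂ) k =
      Complex.exp (Complex.I * (t * dispersion lam k : ℝ)) * fc (u : Torus → ℂ) k := by
  by_cases hk : k = 0
  · subst hk
    rw [show fc (u : Torus → ℂ) 0 = 0 from hu, mul_zero]
    exact (hS t u hu).1
  · rw [(hS t u hu).2 k hk]
    congr 2
    simp only [dispersion]
    push_cast
    ring

lemma IsLamGroup.norm_fc_eq (hS : IsLamGroup lam S) (hu : MeanZero u) (t : ℝ) (k : ℤ) :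
    ‖fc (S t u : Torus → ℂ) k‖ = ‖fc (u : Torus → ℂ) k‖ := by
  rw [hS.fc_eq hu, norm_mul, mul_comm Complex.I, Complex.norm_exp_ofReal_mul_I, one_mul]

lemma IsLamGroup.norm_sub_expSum_sq (hS : IsLamGroup lam S) (hu : MeanZero u) (F : Finset ℤ)
    (t : ℝ) :
    ‖S t u - expSum expL2 (dispersion lam) F (fc (u : Torus → ℂ)) t‖ ^ 2 =
      ‖u‖ ^ 2 - ∑ k ∈ F, 2 * π * ‖fc (u : Torus → ℂ) k‖ ^ 2 := by
  have h1 := norm_sub_sum_fc_sq (S t u) F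
  have h2 : ‖S t u‖ ^ 2 = ‖u‖ ^ 2 := by
    have h := hasSum_norm_fc_sq (S t u)
    simp only [hS.norm_fc_eq hu] at h
    exact h.unique (hasSum_norm_fc_sq u)
  simp only [hS.norm_fc_eq hu, h2] at h1
  rw [← h1]
  simp only [hS.fc_eq hu, expSum]

lemma tendsto_residual (u : L2T) :
    Tendsto (fun F : Finset ℤ => ‖u‖ ^ 2 - ∑ k ∈ F, 2 * π * ‖fc (u : Torus → ℂ) k‖ ^ 2)
      atTop (nhds 0) := by
  rw [← sub_self (‖u‖ ^ 2)]
  exact tendsto_const_nhds.sub (hasSum_norm_fc_sq u)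

lemma IsLamGroup.continuous_apply (hS : IsLamGroup lam S) (hu : MeanZero u) :
    Continuous fun t => S t u := by
  have h : TendstoUniformly
      (fun F : Finset ℤ => expSum expL2 (dispersion lam) F (fc (u : Torus → ℂ)))
      (fun t => S t u) atTop := by
    rw [Metric.tendstoUniformly_iff]
    intro ε hε
    filter_upwards [(tendsto_residual u).eventually (gt_mem_nhds (pow_pos hε 2))] with F hF t
    rw [dist_eq_norm]
    refine lt_of_pow_lt_pow_left₀ 2 hε.le ?_
    rwa [hS.norm_sub_expSum_sq hu]
  exact h.continuous (Frequently.of_forall fun F => continuous_expSum _ _ _ _)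

theorem IsLamGroup.norm_sq_le_of_observesWith (hS : IsLamGroup lam S) (hu : MeanZero u)
    {G : L2T →L[ℂ] L2T} {T C : ℝ} (hT : 0 ≤ T) (hC : 0 ≤ C)
    (hobs : ObservesWith (fun k => G (expL2 k)) (dispersion lam) {0}ᶜ T C) :
    ‖u‖ ^ 2 ≤ 4 * π * C * ∫ t in (0:ℝ)..T, ‖G (S t u)‖ ^ 2 := by
  set a := fc (u : Torus → ℂ) with ha
  have ha0 : a 0 = 0 := hu
  have hcont := hS.continuous_apply hu
  set I := ∫ t in (0:ℝ)..T, ‖G (S t u)‖ ^ 2 with hI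
  have hbound : ∀ F : Finset ℤ, ∑ k ∈ F, 2 * π * ‖a k‖ ^ 2 ≤
      2 * π * (C * (2 * I + 2 * (T * (‖G‖ ^ 2 *
        (‖u‖ ^ 2 - ∑ k ∈ F, 2 * π * ‖a k‖ ^ 2))))) := by
    intro F
    have h1 := hobs (F.erase 0) (fun k hk => Finset.ne_of_mem_erase hk) a
    rw [Finset.sum_erase F (by simp [ha0])] at h1
    have h2 : ∀ t, expSum (fun k => G (expL2 k)) (dispersion lam) (F.erase 0) a t =
        G (expSum expL2 (dispersion lam) F a t) := by
      intro t
      simp only [expSum, map_sum, map_smul]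
      exact Finset.sum_erase F (by simp [ha0])
    have hcE := continuous_expSum expL2 (dispersion lam) F a
    have h3 := integral_norm_add_sq_le (f := fun t => G (S t u))
      (g := fun t => G (expSum expL2 (dispersion lam) F a t - S t u))
      (by fun_prop) (by fun_prop) hT
    have h4 := integral_le_const_of_le
      (f := fun t => ‖G (expSum expL2 (dispersion lam) F a t - S t u)‖ ^ 2)
      (M := ‖G‖ ^ 2 * (‖u‖ ^ 2 - ∑ k ∈ F, 2 * π * ‖a k‖ ^ 2)) (by fun_prop) hT fun t _ => by
        rw [← hS.norm_sub_expSum_sq hu F t, norm_sub_rev, ← mul_pow]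
        gcongr
        exact G.le_opNorm _
    simp only [← map_add, add_sub_cancel] at h3
    simp only [h2] at h1
    refine (Finset.mul_sum ..).symm.trans_le 
      (mul_le_mul_of_nonneg_left (h1.trans ?_) (by positivity))
    exact mul_le_mul_of_nonneg_left (by linarith) hC
  have hlim : Tendsto (fun F : Finset ℤ => 2 * π * (C * (2 * I + 2 * (T * (‖G‖ ^ 2 *
      (‖u‖ ^ 2 - ∑ k ∈ F, 2 * π * ‖a k‖ ^ 2)))))) atTop
      (nhds (2 * π * (C * (2 * I + 2 * (T * (‖G‖ ^ 2 * 0)))))) :=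
    ((((((tendsto_residual u).const_mul _).const_mul _).const_mul _).const_add _).const_mul
      _).const_mul _
  refine (le_of_tendsto_of_tendsto' (hasSum_norm_fc_sq u) hlim hbound).trans_eq ?_
  ring

end LamGroup

/-- Theorem 3.3, uniform one-dimensional observability: for every `T > 0`
there is `C = C(T) > 0` such that for every `λ > 0` and every `u₀ ∈ L²₀(𝕋)`,
`‖u₀‖²_{L²(𝕋)} ≤ C ∫₀ᵀ ‖𝒢(S_λ(t)u₀)‖²_{L²(𝕋)} dt`, with `C` independent of `λ`. -/
theorem uniform_1D_observability
    -- `g` is a fixed real-valued C² function on `𝕋` (2π-periodic on `ℝ`), nonnegative,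
    -- with integral 1, vanishing outside `(a,b) ⊂ (-π,π)`:
    (g : ℝ → ℝ) (hg_reg : ContDiff ℝ 2 g) (hg_per : Function.Periodic g (2 * Real.pi))
    (hg_nonneg : ∀ x, 0 ≤ g x)
    (a b : ℝ) (ha : -Real.pi < a) (hab : a < b) (hb : b < Real.pi)
    (hg_supp : ∀ x ∈ Set.Ioc (-Real.pi) Real.pi, g x ≠ 0 → x ∈ Set.Ioo a b)
    (hg_int : ∫ x in (-Real.pi)..Real.pi, g x = 1)
    (G : L2T →L[ℂ] L2T) (hG : IsG hg_per.lift G)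
    (T : ℝ) (hT : 0 < T) :
    ∃ C : ℝ, 0 < C ∧
      ∀ lam : ℝ, 0 < lam →
        ∀ S : ℝ → L2T →L[ℂ] L2T, IsLamGroup lam S →
          ∀ u₀ : L2T, MeanZero u₀ →
            ‖u₀‖ ^ 2 ≤ C * ∫ t in (0:ℝ)..T, ‖G (S t u₀)‖ ^ 2 := by
  obtain ⟨K, c, δ, h⟩ := exists_almostOrthogonal_apply_expL2 hg_reg hg_per (by
    by_contra! h0
    simp [h0] at hg_int) hG
  obtain ⟨C, hC, hobs⟩ := h.exists_uniform_observesWith hT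
  exact ⟨4 * π * C, by positivity, fun lam hlam S hS u₀ hu₀ =>
    hS.norm_sq_le_of_observesWith hu₀ hT.le hC.le (hobs lam hlam.le)⟩
end
end

section
/- (Ingham inequality.) Let (λ_k)_{k∈ℤ} be a family of real numbers satisfying λ_{k+1} − λ_k ≥ γ for all k ∈ ℤ, where γ > 0. Then for every T > 2π/γ there exist positive constants C₁, C₂ depending only on γ and T such that for every finitely supported family (a_k)_{k∈ℤ} of complex numbers, C₁ Σ_{k∈ℤ} |a_k|² ≤ ∫₀ᵀ |Σ_{k∈ℤ} a_k e^{itλ_k}|² dt ≤ C₂ Σ_{k∈ℤ} |a_k|². -/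
open MeasureTheory Real Filter

theorem sum_Icc_neg_inv_sq_sub_quarter (N : ℕ) :
    ∑ r ∈ Finset.Icc (-(N : ℤ)) N, ((r : ℝ) ^ 2 - 1 / 4)⁻¹ = -(2 / ((N : ℝ) + 1 / 2)) := by
  induction N with
  | zero => norm_num
  | succ N ih =>
    have h : Finset.Icc (-((N + 1 : ℕ) : ℤ)) ((N + 1 : ℕ) : ℤ) =
        insert (-((N : ℤ) + 1)) (insert ((N : ℤ) + 1) (Finset.Icc (-(N : ℤ)) N)) := by
      ext x
      simp only [Finset.mem_Icc, Finset.mem_insert]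
      push_cast
      omega
    rw [h, Finset.sum_insert, Finset.sum_insert, ih]
    · have h1 : ((N : ℝ) + 1) ^ 2 - 1 / 4 = (N + 1 / 2) * (N + 3 / 2) := by ring
      push_cast
      rw [neg_sq, h1]
      have : (N : ℝ) + 1 + 1 / 2 = N + 3 / 2 := by ring
      rw [this]
      field_simp
      ring
    · simp
    · simp only [Finset.mem_Icc, Finset.mem_insert]
      omega

theorem one_le_sq_intCast {r : ℤ} (hr : r ≠ 0) : (1 : ℝ) ≤ (r : ℝ) ^ 2 := by
  have h : (1 : ℤ) ≤ r ^ 2 := by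
    have := sq_pos_of_ne_zero hr
    omega
  exact_mod_cast h

theorem inv_sq_sub_quarter_nonneg {r : ℤ} (hr : r ≠ 0) : 0 ≤ ((r : ℝ) ^ 2 - 1 / 4)⁻¹ :=
  inv_nonneg.mpr (by linarith [one_le_sq_intCast hr])

theorem sum_inv_sq_sub_quarter_le (s : Finset ℤ) (hs : (0 : ℤ) ∉ s) :
    ∑ r ∈ s, ((r : ℝ) ^ 2 - 1 / 4)⁻¹ ≤ 4 := by
  set N := ∑ r ∈ s, r.natAbs with hN
  have hsub : insert 0 s ⊆ Finset.Icc (-(N : ℤ)) N := by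
    intro x hx
    rw [Finset.mem_Icc]
    rcases Finset.mem_insert.mp hx with rfl | hx
    · omega
    · have := Finset.single_le_sum (f := Int.natAbs) (fun _ _ => Nat.zero_le _) hx
      omega
  have h := Finset.sum_le_sum_of_subset_of_nonneg
    (f := fun r : ℤ => ((r : ℝ) ^ 2 - 1 / 4)⁻¹) hsub (fun r _ hr =>
      inv_sq_sub_quarter_nonneg (by rintro rfl; exact hr (Finset.mem_insert_self _ _)))
  rw [sum_Icc_neg_inv_sq_sub_quarter, Finset.sum_insert hs] at h
  have h2 : 0 ≤ 2 / ((N : ℝ) + 1 / 2) := by positivity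
  norm_num at h ⊢
  norm_num at h2
  linarith

theorem sum_ite_inv_sq_sub_quarter_le (s : Finset ℤ) (n : ℤ) :
    ∑ m ∈ s, (if n = m then 0 else (((n - m : ℤ) : ℝ) ^ 2 - 1 / 4)⁻¹) ≤ 4 := by
  have h : ∑ m ∈ s, (if n = m then 0 else (((n - m : ℤ) : ℝ) ^ 2 - 1 / 4)⁻¹) =
      ∑ r ∈ (s.erase n).image (fun m => n - m), ((r : ℝ) ^ 2 - 1 / 4)⁻¹ := by
    rw [Finset.sum_image (by intro x _ y _ h; simpa using h)]
    have : s.erase n = s.filter (fun m => ¬ n = m) := by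
      ext x; simp [and_comm, eq_comm]
    rw [this, Finset.sum_filter]
    exact Finset.sum_congr rfl fun m _ => by split_ifs <;> simp_all
  rw [h]
  apply sum_inv_sq_sub_quarter_le
  simp [sub_eq_zero]

theorem integral_sin_mul_exp {c α : ℝ} (hc : 0 < c) (h : c ^ 2 - α ^ 2 ≠ 0) :
    ∫ t in (0 : ℝ)..(π / c), (Real.sin (c * t) : ℂ) * Complex.exp (Complex.I * t * α) =
      c * (Complex.exp (Complex.I * (π / c : ℝ) * α) + 1) / ((c ^ 2 - α ^ 2 : ℝ) : ℂ) := by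
  have hC : ((c ^ 2 - α ^ 2 : ℝ) : ℂ) ≠ 0 := by exact_mod_cast h
  have hderiv : ∀ t : ℝ, HasDerivAt (fun t : ℝ => Complex.exp (Complex.I * t * α) *
      (Complex.I * α * (Real.sin (c * t) : ℂ) - c * (Real.cos (c * t) : ℂ)) /
        ((c ^ 2 - α ^ 2 : ℝ) : ℂ))
      ((Real.sin (c * t) : ℂ) * Complex.exp (Complex.I * t * α)) t := by
    intro t
    have h1 : HasDerivAt (fun t : ℝ => Complex.exp (Complex.I * t * α))
        (Complex.exp (Complex.I * t * α) * (Complex.I * 1 * α)) t :=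
      (((hasDerivAt_id t).ofReal_comp.const_mul Complex.I).mul_const (α : ℂ)).cexp
    have h0 : HasDerivAt (fun t : ℝ => c * t) (c * 1) t := (hasDerivAt_id t).const_mul c
    have h2 := h0.sin.ofReal_comp
    have h3 := h0.cos.ofReal_comp
    have h4 := (h1.mul ((h2.const_mul (Complex.I * α)).sub (h3.const_mul (c : ℂ)))).div_const
      ((c ^ 2 - α ^ 2 : ℝ) : ℂ)
    refine h4.congr_deriv ?_
    rw [div_eq_iff hC]
    push_cast
    simp only [Pi.sub_apply]
    ring_nf
    simp only [Complex.I_sq]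
    ring
  rw [intervalIntegral.integral_eq_sub_of_hasDerivAt (fun t _ => hderiv t)
    (Continuous.intervalIntegrable (by fun_prop) _ _)]
  have hcπ : c * (π / c) = π := by field_simp
  rw [hcπ]
  simp
  ring

theorem norm_integral_sin_mul_exp_le {c α γ : ℝ} {r : ℤ} (hc : 0 < c) (hcγ : c ≤ γ / 2)
    (hr : r ≠ 0) (hα : γ ^ 2 * (r : ℝ) ^ 2 ≤ α ^ 2) (hα' : c ^ 2 < α ^ 2) :
    ‖∫ t in (0 : ℝ)..(π / c), (Real.sin (c * t) : ℂ) * Complex.exp (Complex.I * t * α)‖ ≤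
      2 * c / γ ^ 2 * ((r : ℝ) ^ 2 - 1 / 4)⁻¹ := by
  have hγ : 0 < γ := by linarith
  have hr1 := one_le_sq_intCast hr
  rw [integral_sin_mul_exp hc (by linarith : c ^ 2 - α ^ 2 < 0).ne, norm_div, norm_mul,
    Complex.norm_real, Complex.norm_real, Real.norm_of_nonneg hc.le,
    Real.norm_of_nonpos (by linarith)]
  have he : ‖Complex.exp (Complex.I * (π / c : ℝ) * α) + 1‖ ≤ 2 := by
    refine (norm_add_le _ _).trans ?_
    have : Complex.I * ((π / c : ℝ) : ℂ) * α = ((π / c * α : ℝ) : ℂ) * Complex.I := by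
      push_cast; ring
    rw [this, Complex.norm_exp_ofReal_mul_I]
    norm_num
  have hcsq : c ^ 2 ≤ γ ^ 2 / 4 := by nlinarith
  have hden : γ ^ 2 * ((r : ℝ) ^ 2 - 1 / 4) ≤ -(c ^ 2 - α ^ 2) := by linarith
  have hpos : 0 < γ ^ 2 * ((r : ℝ) ^ 2 - 1 / 4) := by
    apply mul_pos (by positivity); linarith
  calc c * ‖Complex.exp (Complex.I * (π / c : ℝ) * α) + 1‖ / -(c ^ 2 - α ^ 2)
      ≤ c * 2 / (γ ^ 2 * ((r : ℝ) ^ 2 - 1 / 4)) := by gcongr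
    _ = 2 * c / γ ^ 2 * ((r : ℝ) ^ 2 - 1 / 4)⁻¹ := by
      rw [mul_comm c, ← div_div, div_eq_mul_inv (2 * c / γ ^ 2)]

theorem gap_mul_abs_le {γ : ℝ} {lam : ℤ → ℝ} (h : ∀ k : ℤ, γ ≤ lam (k + 1) - lam k) (n m : ℤ) :
    γ * |((n - m : ℤ) : ℝ)| ≤ |lam n - lam m| := by
  have hmono : Monotone fun k : ℤ => lam k - γ * k := by
    apply monotone_int_of_le_succ
    intro k
    have := h k
    push_cast
    linarith
  rcases le_total m n with hmn | hmn
  · have h1 := hmono hmn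
    have h2 : (m : ℝ) ≤ n := by exact_mod_cast hmn
    rw [abs_of_nonneg (by push_cast; linarith)]
    refine le_trans ?_ (le_abs_self _)
    push_cast
    simp only at h1
    linarith
  · have h1 := hmono hmn
    have h2 : (n : ℝ) ≤ m := by exact_mod_cast hmn
    rw [abs_of_nonpos (by push_cast; linarith)]
    refine le_trans ?_ (neg_le_abs _)
    push_cast
    simp only at h1
    linarith

theorem sum_mul_ite_le (s : Finset ℤ) (a : ℤ → ℝ) :
    ∑ n ∈ s, ∑ m ∈ s,
      a n * a m * (if n = m then 0 else (((n - m : ℤ) : ℝ) ^ 2 - 1 / 4)⁻¹) ≤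
        4 * ∑ n ∈ s, a n ^ 2 := by
  set w : ℤ → ℤ → ℝ := fun n m => if n = m then 0 else (((n - m : ℤ) : ℝ) ^ 2 - 1 / 4)⁻¹ with hw
  have hw0 : ∀ n m, 0 ≤ w n m := by
    intro n m
    simp only [hw]
    split_ifs with h
    · exact le_rfl
    · exact inv_sq_sub_quarter_nonneg (sub_ne_zero.mpr h)
  have hsymm : ∀ n m, w n m = w m n := by
    intro n m
    simp only [hw, eq_comm (a := n) (b := m)]
    congr 2
    push_cast
    ring
  have hrow : ∑ n ∈ s, ∑ m ∈ s, a n ^ 2 * w n m ≤ 4 * ∑ n ∈ s, a n ^ 2 := by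
    rw [Finset.mul_sum]
    refine Finset.sum_le_sum fun n _ => ?_
    rw [← Finset.mul_sum, mul_comm]
    exact mul_le_mul_of_nonneg_right (sum_ite_inv_sq_sub_quarter_le s n) (sq_nonneg _)
  have hcol : ∑ n ∈ s, ∑ m ∈ s, a m ^ 2 * w n m = ∑ n ∈ s, ∑ m ∈ s, a n ^ 2 * w n m := by
    rw [Finset.sum_comm]
    simp only [hsymm]
  calc ∑ n ∈ s, ∑ m ∈ s, a n * a m * w n m
      ≤ ∑ n ∈ s, ∑ m ∈ s, (a n ^ 2 * w n m / 2 + a m ^ 2 * w n m / 2) := by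
        refine Finset.sum_le_sum fun n _ => Finset.sum_le_sum fun m _ => ?_
        nlinarith [mul_nonneg (sq_nonneg (a n - a m)) (hw0 n m)]
    _ = ∑ n ∈ s, ∑ m ∈ s, a n ^ 2 * w n m := by
        simp only [Finset.sum_add_distrib, ← Finset.sum_div, hcol]
        ring
    _ ≤ _ := hrow

theorem integral_sin_mul_normSq_sum {c : ℝ} (s : Finset ℤ) (a : ℤ → ℂ) (lam : ℤ → ℝ) :
    ((∫ t in (0 : ℝ)..(π / c), Real.sin (c * t) *
        ‖∑ k ∈ s, a k * Complex.exp (Complex.I * (t : ℂ) * (lam k : ℂ))‖ ^ 2 : ℝ) : ℂ) =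
      ∑ n ∈ s, ∑ m ∈ s, a n * (starRingEnd ℂ) (a m) *
        ∫ t in (0 : ℝ)..(π / c), (Real.sin (c * t) : ℂ) *
          Complex.exp (Complex.I * t * (lam n - lam m : ℝ)) := by
  rw [← intervalIntegral.integral_ofReal]
  simp only [← intervalIntegral.integral_const_mul]
  rw [show (∑ n ∈ s, ∑ m ∈ s, ∫ t in (0 : ℝ)..(π / c), a n * (starRingEnd ℂ) (a m) *
      ((Real.sin (c * t) : ℂ) * Complex.exp (Complex.I * t * (lam n - lam m : ℝ)))) =
      ∑ n ∈ s, ∫ t in (0 : ℝ)..(π / c), ∑ m ∈ s, a n * (starRingEnd ℂ) (a m) *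
      ((Real.sin (c * t) : ℂ) * Complex.exp (Complex.I * t * (lam n - lam m : ℝ))) from
    Finset.sum_congr rfl fun n _ => (intervalIntegral.integral_finsetSum fun m _ =>
      Continuous.intervalIntegrable (by fun_prop) _ _).symm]
  rw [← intervalIntegral.integral_finsetSum fun n _ =>
      Continuous.intervalIntegrable (by fun_prop) _ _]
  refine intervalIntegral.integral_congr fun t _ => ?_
  simp only [Complex.ofReal_mul, Complex.ofReal_pow]
  rw [← Complex.mul_conj', map_sum, Finset.sum_mul_sum, Finset.mul_sum]
  refine Finset.sum_congr rfl fun n _ => ?_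
  rw [Finset.mul_sum]
  refine Finset.sum_congr rfl fun m _ => ?_
  have : Complex.exp (Complex.I * t * (lam n - lam m : ℝ)) =
      Complex.exp (Complex.I * t * lam n) *
        (starRingEnd ℂ) (Complex.exp (Complex.I * t * lam m)) := by
    rw [← Complex.exp_conj, ← Complex.exp_add]
    simp only [map_mul, Complex.conj_I, Complex.conj_ofReal]
    congr 1
    push_cast
    ring
  rw [this, map_mul]
  ring

theorem integral_sin_mul_exp_zero {c : ℝ} (hc : 0 < c) :
    ∫ t in (0 : ℝ)..(π / c), (Real.sin (c * t) : ℂ) *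
      Complex.exp (Complex.I * t * (0 : ℝ)) = ((2 / c : ℝ) : ℂ) := by
  rw [integral_sin_mul_exp hc (by simpa using hc.ne')]
  have : (c : ℂ) ≠ 0 := by exact_mod_cast hc.ne'
  push_cast
  simp
  field_simp
  norm_num

theorem abs_integral_sin_mul_normSq_sum_sub_le {c γ : ℝ} (hc : 0 < c) (hcγ : c ≤ γ / 2)
    (s : Finset ℤ) (a : ℤ → ℂ) {lam : ℤ → ℝ} (h : ∀ k : ℤ, γ ≤ lam (k + 1) - lam k) :
    |(∫ t in (0 : ℝ)..(π / c), Real.sin (c * t) *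
        ‖∑ k ∈ s, a k * Complex.exp (Complex.I * (t : ℂ) * (lam k : ℂ))‖ ^ 2) -
      2 / c * ∑ k ∈ s, ‖a k‖ ^ 2| ≤ 8 * c / γ ^ 2 * ∑ k ∈ s, ‖a k‖ ^ 2 := by
  have hγ : 0 < γ := by linarith
  rw [← Real.norm_eq_abs, ← Complex.norm_real, Complex.ofReal_sub, integral_sin_mul_normSq_sum]
  have hdiag : ((2 / c * ∑ k ∈ s, ‖a k‖ ^ 2 : ℝ) : ℂ) =
      ∑ n ∈ s, ∑ m ∈ s, if n = m then a n * (starRingEnd ℂ) (a m) * ((2 / c : ℝ) : ℂ) else 0 := by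
    rw [Complex.ofReal_mul, Complex.ofReal_sum, Finset.mul_sum]
    refine Finset.sum_congr rfl fun n hn => ?_
    rw [Finset.sum_ite_eq, if_pos hn, Complex.mul_conj']
    push_cast
    ring
  rw [hdiag, ← Finset.sum_sub_distrib]
  simp only [← Finset.sum_sub_distrib]
  have hterm : ∀ n m : ℤ, ‖a n * (starRingEnd ℂ) (a m) *
        (∫ t in (0 : ℝ)..(π / c), (Real.sin (c * t) : ℂ) *
          Complex.exp (Complex.I * t * (lam n - lam m : ℝ))) -
        (if n = m then a n * (starRingEnd ℂ) (a m) * ((2 / c : ℝ) : ℂ) else 0)‖ ≤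
      2 * c / γ ^ 2 * (‖a n‖ * ‖a m‖ *
        (if n = m then 0 else (((n - m : ℤ) : ℝ) ^ 2 - 1 / 4)⁻¹)) := by
    intro n m
    rcases eq_or_ne n m with rfl | hnm
    · rw [sub_self, integral_sin_mul_exp_zero hc]
      simp
    · rw [if_neg hnm, if_neg hnm, sub_zero, norm_mul, norm_mul, RCLike.norm_conj]
      have hr : n - m ≠ 0 := sub_ne_zero.mpr hnm
      have hα : γ ^ 2 * ((n - m : ℤ) : ℝ) ^ 2 ≤ (lam n - lam m) ^ 2 := by
        rw [← sq_abs (lam n - lam m), ← sq_abs ((n - m : ℤ) : ℝ), ← mul_pow]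
        exact pow_le_pow_left₀ (by positivity) (gap_mul_abs_le h n m) 2
      have hr1 := one_le_sq_intCast hr
      have hα' : c ^ 2 < (lam n - lam m) ^ 2 := by nlinarith [sq_nonneg γ]
      calc _ ≤ ‖a n‖ * ‖a m‖ * (2 * c / γ ^ 2 * (((n - m : ℤ) : ℝ) ^ 2 - 1 / 4)⁻¹) := by
            gcongr
            exact norm_integral_sin_mul_exp_le hc hcγ hr hα hα'
        _ = _ := by ring
  calc _ ≤ ∑ n ∈ s, ∑ m ∈ s, 2 * c / γ ^ 2 * (‖a n‖ * ‖a m‖ *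
        (if n = m then 0 else (((n - m : ℤ) : ℝ) ^ 2 - 1 / 4)⁻¹)) :=
        norm_sum_le_of_le _ fun n _ => norm_sum_le_of_le _ fun m _ => hterm n m
    _ = 2 * c / γ ^ 2 * ∑ n ∈ s, ∑ m ∈ s, ‖a n‖ * ‖a m‖ *
        (if n = m then 0 else (((n - m : ℤ) : ℝ) ^ 2 - 1 / 4)⁻¹) := by
        simp only [Finset.mul_sum]
    _ ≤ 2 * c / γ ^ 2 * (4 * ∑ n ∈ s, ‖a n‖ ^ 2) := by
        gcongr
        exact sum_mul_ite_le s fun n => ‖a n‖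
    _ = _ := by ring

theorem ingham_lower_bound {γ T : ℝ} (hT : 0 < T) (hγT : π / T ≤ γ / 2)
    (s : Finset ℤ) (a : ℤ → ℂ) {lam : ℤ → ℝ} (h : ∀ k : ℤ, γ ≤ lam (k + 1) - lam k) :
    (2 / (π / T) - 8 * (π / T) / γ ^ 2) * ∑ k ∈ s, ‖a k‖ ^ 2 ≤
      ∫ t in (0 : ℝ)..T,
        ‖∑ k ∈ s, a k * Complex.exp (Complex.I * (t : ℂ) * (lam k : ℂ))‖ ^ 2 := by
  have hb := abs_le.mp
    (abs_integral_sin_mul_normSq_sum_sub_le (div_pos pi_pos hT) hγT s a h)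
  rw [div_div_cancel₀ pi_ne_zero] at hb
  have hle : (∫ t in (0 : ℝ)..T, Real.sin (π / T * t) *
        ‖∑ k ∈ s, a k * Complex.exp (Complex.I * (t : ℂ) * (lam k : ℂ))‖ ^ 2) ≤
      ∫ t in (0 : ℝ)..T,
        ‖∑ k ∈ s, a k * Complex.exp (Complex.I * (t : ℂ) * (lam k : ℂ))‖ ^ 2 := by
    refine intervalIntegral.integral_mono_on hT.le
      (Continuous.intervalIntegrable (by fun_prop) _ _)
      (Continuous.intervalIntegrable (by fun_prop) _ _) fun t _ => ?_
    exact mul_le_of_le_one_left (sq_nonneg _) (Real.sin_le_one _)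
  linarith [hb.1]

theorem half_le_sin_of_mem_Icc {x : ℝ} (h1 : π / 3 ≤ x) (h2 : x ≤ 2 * π / 3) :
    1 / 2 ≤ Real.sin x := by
  have h := Real.cos_le_cos_of_nonneg_of_le_pi (abs_nonneg (x - π / 2))
    (by linarith [pi_pos] : π / 3 ≤ π) (abs_le.mpr ⟨by linarith [pi_pos], by linarith [pi_pos]⟩)
  rwa [Real.cos_pi_div_three, Real.cos_abs, Real.cos_sub_pi_div_two] at h

theorem ingham_upper_bound {γ T : ℝ} (hT : 0 < T) (hγT : π / (3 * T) ≤ γ / 2)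
    (s : Finset ℤ) (a : ℤ → ℂ) {lam : ℤ → ℝ} (h : ∀ k : ℤ, γ ≤ lam (k + 1) - lam k) :
    (∫ t in (0 : ℝ)..T,
        ‖∑ k ∈ s, a k * Complex.exp (Complex.I * (t : ℂ) * (lam k : ℂ))‖ ^ 2) ≤
      2 * (2 / (π / (3 * T)) + 8 * (π / (3 * T)) / γ ^ 2) * ∑ k ∈ s, ‖a k‖ ^ 2 := by
  set b : ℤ → ℂ := fun k => a k * Complex.exp (((-T * lam k : ℝ) : ℂ) * Complex.I) with hbdef
  have hnorm : ∀ k, ‖b k‖ = ‖a k‖ := fun k => by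
    simp only [hbdef, norm_mul, Complex.norm_exp_ofReal_mul_I, mul_one]
  have hb := abs_le.mp
    (abs_integral_sin_mul_normSq_sum_sub_le (div_pos pi_pos (by linarith)) hγT s b h)
  rw [div_div_cancel₀ pi_ne_zero] at hb
  simp only [hnorm] at hb
  set f : ℝ → ℝ := fun t =>
    ‖∑ k ∈ s, a k * Complex.exp (Complex.I * (t : ℂ) * (lam k : ℂ))‖ ^ 2 with hf
  set g : ℝ → ℝ := fun t => Real.sin (π / (3 * T) * t) *
    ‖∑ k ∈ s, b k * Complex.exp (Complex.I * (t : ℂ) * (lam k : ℂ))‖ ^ 2 with hg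
  have hshift : ∀ t : ℝ, g t = Real.sin (π / (3 * T) * t) * f (t - T) := by
    intro t
    simp only [hg, hf, hbdef]
    congr 3
    refine Finset.sum_congr rfl fun k _ => ?_
    rw [mul_assoc, ← Complex.exp_add]
    congr 2
    push_cast
    ring
  have hfc : Continuous f := by fun_prop
  have hgc : Continuous g := by fun_prop
  have hf0 : ∀ t, 0 ≤ f t := fun t => sq_nonneg _
  have hmid : (∫ t in (0 : ℝ)..T, f t) ≤ ∫ t in T..(2 * T), 2 * g t := by
    have hsub : (∫ t in (0 : ℝ)..T, f t) = ∫ t in T..(2 * T), f (t - T) := by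
      rw [intervalIntegral.integral_comp_sub_right]
      congr 1 <;> ring
    rw [hsub]
    refine intervalIntegral.integral_mono_on (by linarith)
      (Continuous.intervalIntegrable (by fun_prop) _ _)
      (Continuous.intervalIntegrable (by fun_prop) _ _) fun t ht => ?_
    have hsin : 1 / 2 ≤ Real.sin (π / (3 * T) * t) := by
      apply half_le_sin_of_mem_Icc
      · rw [div_mul_eq_mul_div, div_le_div_iff₀ (by norm_num) (by positivity)]
        nlinarith [pi_pos, ht.1]
      · rw [div_mul_eq_mul_div, div_le_div_iff₀ (by positivity) (by norm_num)]
        nlinarith [pi_pos, ht.2]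
    rw [hshift]
    nlinarith [hf0 (t - T)]
  have hext : (∫ t in T..(2 * T), g t) ≤ ∫ t in (0 : ℝ)..(3 * T), g t := by
    refine intervalIntegral.integral_mono_interval hT.le (by linarith) (by linarith) ?_
      (hgc.intervalIntegrable _ _)
    refine (ae_restrict_iff' measurableSet_Ioc).mpr (Eventually.of_forall fun t ht => ?_)
    refine mul_nonneg (Real.sin_nonneg_of_nonneg_of_le_pi ?_ ?_) (sq_nonneg _)
    · have := ht.1.le
      positivity
    · rw [div_mul_eq_mul_div, div_le_iff₀ (by positivity)]
      exact mul_le_mul_of_nonneg_left ht.2 pi_pos.le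
  rw [intervalIntegral.integral_const_mul] at hmid
  linarith [hb.2]

/-- Proposition 2.1, Ingham inequality: if `λ_{k+1} - λ_k ≥ γ > 0` for all
`k ∈ ℤ`, then for every `T > 2π/γ` there are constants `C₁, C₂ > 0`, depending only on `γ`
and `T`, such that for every finitely supported family `(a_k)` of complex numbers,
`C₁ Σ|a_k|² ≤ ∫₀ᵀ |Σ a_k e^{itλ_k}|² dt ≤ C₂ Σ|a_k|²`. -/
theorem ingham_inequality (γ : ℝ) (hγ : 0 < γ) (T : ℝ) (hT : 2 * Real.pi / γ < T) :
    ∃ C₁ C₂ : ℝ, 0 < C₁ ∧ 0 < C₂ ∧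
      ∀ lam : ℤ → ℝ, (∀ k : ℤ, γ ≤ lam (k + 1) - lam k) →
        ∀ a : ℤ →₀ ℂ,
          C₁ * (∑ k ∈ a.support, ‖a k‖ ^ 2) ≤
              (∫ t in (0:ℝ)..T,
                ‖∑ k ∈ a.support, a k * Complex.exp (Complex.I * (t : ℂ) * (lam k : ℂ))‖ ^ 2) ∧
          (∫ t in (0:ℝ)..T,
              ‖∑ k ∈ a.support, a k * Complex.exp (Complex.I * (t : ℂ) * (lam k : ℂ))‖ ^ 2) ≤
            C₂ * (∑ k ∈ a.support, ‖a k‖ ^ 2) := by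
  have hT0 : 0 < T := lt_trans (by positivity) hT
  have hc : 0 < π / T := div_pos pi_pos hT0
  have hcγ : π / T < γ / 2 := by
    rw [div_lt_iff₀ hγ] at hT
    rw [div_lt_div_iff₀ hT0 (by norm_num)]
    linarith
  have hcγ' : π / (3 * T) ≤ γ / 2 :=
    (div_le_div_of_nonneg_left pi_pos.le hT0 (by linarith)).trans hcγ.le
  refine ⟨2 / (π / T) - 8 * (π / T) / γ ^ 2,
    2 * (2 / (π / (3 * T)) + 8 * (π / (3 * T)) / γ ^ 2), ?_, by positivity, fun lam h a =>
    ⟨ingham_lower_bound hT0 hcγ.le _ _ h, ingham_upper_bound hT0 hcγ' _ _ h⟩⟩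
  rw [sub_pos, div_lt_div_iff₀ (by positivity) hc]
  nlinarith
end

section
/- Let χ : ℝ → ℝ be a smooth function such that 1 − χ is compactly supported, χ(ξ) = 0 for |ξ| ≤ 1, and χ(ξ) = 1 for |ξ| ≥ 2. For h > 0 define the Fourier multiplier χ(hDₓ) on L²(𝕋) by (χ(hDₓ)u)^(k) = χ(hk)û(k). Then for every T > 0 there exists C > 0 such that for all h ∈ (0,1), all λ ≥ 0, and all u₀ ∈ L²₀(𝕋), ∫₀ᵀ ‖[χ(hDₓ), 𝒢](S_λ(t)u₀)‖²_{L²(𝕋)} dt ≤ C h² ‖u₀‖²_{L²(𝕋)}, where [A,B] = AB − BA denotes the commutator. -/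
open MeasureTheory Real Filter

noncomputable section

theorem norm_fourier_apply (n : ℤ) (x : Torus) : ‖fourier n x‖ = 1 := by
  rw [fourier_apply]
  exact Circle.norm_coe _

theorem fc_eq_fourierCoeff (u : Torus → ℂ) (k : ℤ) : fc u k = fourierCoeff u k := by
  rw [fourierCoeff, AddCircle.integral_haarAddCircle, fc]
  simp [Complex.real_smul]

/-- Parseval's identity for the Lebesgue measure on the torus. -/
theorem hasSum_sq_fc (u : L2T) :
    HasSum (fun k => ‖fc (u : Torus → ℂ) k‖ ^ 2) (‖u‖ ^ 2 / (2 * Real.pi)) := by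
  have h := (Lp.memLp u).haarAddCircle
  have hs := hasSum_sq_fourierCoeff h.toLp
  rw [fourierCoeff_congr_ae h.coeFn_toLp] at hs
  simp only [← fc_eq_fourierCoeff] at hs
  convert hs using 1
  have e : ∫ t, ‖h.toLp u t‖ ^ 2 ∂AddCircle.haarAddCircle
      = ∫ t, ‖(u : Torus → ℂ) t‖ ^ 2 ∂AddCircle.haarAddCircle := by
    apply integral_congr_ae
    filter_upwards [h.coeFn_toLp] with x hx
    rw [hx]
  rw [e, AddCircle.integral_haarAddCircle, smul_eq_mul, div_eq_inv_mul]
  congr 1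
  have h2 : ((‖u‖ ^ 2 : ℝ) : ℂ) = ((∫ t, ‖(u : Torus → ℂ) t‖ ^ 2 : ℝ) : ℂ) := by
    have := inner_self_eq_norm_sq_to_K (𝕜 := ℂ) u
    rw [L2.inner_def] at this
    simp only [inner_self_eq_norm_sq_to_K] at this
    push_cast
    rw [← integral_complex_ofReal]
    simpa using this.symm
  exact_mod_cast h2

/-- The weighted Cauchy–Schwarz inequality for series. -/
theorem sq_tsum_mul_le {ι : Type*} {a w : ι → ℝ} (ha : ∀ i, 0 ≤ a i) (hs : Summable a)
    (h1 : Summable fun i => a i * w i) (h2 : Summable fun i => a i * w i ^ 2) :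
    (∑' i, a i * w i) ^ 2 ≤ (∑' i, a i) * ∑' i, a i * w i ^ 2 := by
  have key : ∀ t : ℝ, 0 ≤ (∑' i, a i) * (t * t) + (-2 * ∑' i, a i * w i) * t
      + ∑' i, a i * w i ^ 2 := by
    intro t
    have := ((hs.hasSum.mul_right (t * t)).add ((h1.hasSum.mul_left (-2)).mul_right t)).add
      h2.hasSum
    refine this.nonneg fun i => ?_
    have : a i * (t * t) + -2 * (a i * w i) * t + a i * w i ^ 2 = a i * (w i - t) ^ 2 := by ring
    rw [this]
    exact mul_nonneg (ha i) (sq_nonneg _)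
  have := discrim_le_zero key
  rw [discrim] at this
  nlinarith

/-- Young's inequality `ℓ¹ * ℓ² ⊂ ℓ²`. -/
theorem sq_conv_le {a w : ℤ → ℝ} (ha : ∀ m, 0 ≤ a m) (hs : Summable a)
    (hw : Summable fun k => w k ^ 2) (hbd : ∀ k, Summable fun m => a m * w (k - m)) :
    (Summable fun k => (∑' m, a m * w (k - m)) ^ 2) ∧
      ∑' k, (∑' m, a m * w (k - m)) ^ 2 ≤ (∑' m, a m) ^ 2 * ∑' k, w k ^ 2 := by
  have hp : HasSum (fun p : ℤ × ℤ => a p.1 * w p.2 ^ 2) ((∑' m, a m) * ∑' k, w k ^ 2) :=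
    hs.hasSum.mul hw.hasSum (hs.mul_of_nonneg hw ha fun k => sq_nonneg _)
  let e : ℤ × ℤ ≃ ℤ × ℤ :=
    { toFun := fun p => (p.2, p.1 - p.2)
      invFun := fun p => (p.1 + p.2, p.1)
      left_inv := fun p => by simp
      right_inv := fun p => by simp }
  have hq : HasSum (fun p : ℤ × ℤ => a p.2 * w (p.1 - p.2) ^ 2)
      ((∑' m, a m) * ∑' k, w k ^ 2) :=
    (e.hasSum_iff (f := fun p : ℤ × ℤ => a p.1 * w p.2 ^ 2)).mpr hp
  have hfib : ∀ k, Summable fun m => a m * w (k - m) ^ 2 := fun k => hq.summable.prod_factor k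
  have hT := hq.prod_fiberwise fun k => (hfib k).hasSum
  have hle : ∀ k, (∑' m, a m * w (k - m)) ^ 2 ≤ (∑' m, a m) * ∑' m, a m * w (k - m) ^ 2 :=
    fun k => sq_tsum_mul_le ha hs (hbd k) (hfib k)
  have hT' := hT.mul_left (∑' m, a m)
  have hsum := Summable.of_nonneg_of_le (fun k => sq_nonneg _) hle hT'.summable
  refine ⟨hsum, (hasSum_le hle hsum.hasSum hT').trans_eq ?_⟩
  ring

theorem Lp_integrable (v : L2T) : Integrable (v : Torus → ℂ) :=
  (Lp.memLp v).integrable (by norm_num)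

theorem integrable_continuous_mul (f : C(Torus, ℂ)) {u : Torus → ℂ} (hu : Integrable u) :
    Integrable fun x => f x * u x :=
  hu.bdd_mul (c := ‖f‖) f.continuous.aestronglyMeasurable (ae_of_all _ f.norm_coe_le_norm)

/-- The Fourier coefficients of a product are given by convolution. -/
theorem hasSum_fc_mul (f : C(Torus, ℂ)) (hf : Summable fun m => ‖fc f m‖) (v : L2T) (k : ℤ) :
    HasSum (fun m => fc f m * fc (v : Torus → ℂ) (k - m))
      (fc (fun x => f x * (v : Torus → ℂ) x) k) := by
  have hc : Summable (fourierCoeff f) := by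
    refine Summable.of_norm (hf.congr fun m => ?_)
    rw [fc_eq_fourierCoeff]
  have key := hasSum_integral_of_summable_integral_norm (μ := (volume : Measure Torus))
    (F := fun (m : ℤ) x => fc f m * (fourier (-(k - m)) x * (v : Torus → ℂ) x))
    (fun m => (integrable_continuous_mul _ (Lp_integrable v)).const_mul _) (by
      refine (hf.mul_right (∫ x, ‖(v : Torus → ℂ) x‖)).congr fun m => ?_
      rw [← integral_const_mul]
      congr 1 with x
      rw [norm_mul, norm_mul, norm_fourier_apply, one_mul])
  have key2 := key.mul_left (1 / (2 * (Real.pi : ℂ)))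
  have hA : (fun m => fc f m * fc (v : Torus → ℂ) (k - m)) = fun m => 1 / (2 * (Real.pi : ℂ)) *
      ∫ x, fc f m * (fourier (-(k - m)) x * (v : Torus → ℂ) x) := by
    ext m
    rw [integral_const_mul]
    change fc f m * (1 / (2 * (Real.pi : ℂ)) * _) = _
    ring
  have hB : fc (fun x => f x * (v : Torus → ℂ) x) k = 1 / (2 * (Real.pi : ℂ)) *
      ∫ x, ∑' m, fc f m * (fourier (-(k - m)) x * (v : Torus → ℂ) x) := by
    change 1 / (2 * (Real.pi : ℂ)) * _ = _
    congr 2 with x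
    have := (has_pointwise_sum_fourier_series_of_summable hc x).mul_right
      (fourier (-k) x * (v : Torus → ℂ) x)
    rw [show fourier (-k) x * (f x * (v : Torus → ℂ) x)
      = f x * (fourier (-k) x * (v : Torus → ℂ) x) by ring, ← this.tsum_eq]
    congr 1 with m
    rw [show -(k - m) = m + -k by ring, fourier_add, fc_eq_fourierCoeff, smul_eq_mul]
    ring
  rw [hA, hB]
  exact key2

/-- Integration by parts for Fourier coefficients of periodic functions. -/
theorem norm_fourierCoeffOn_deriv {f f' : ℝ → ℂ} {T : ℝ} (hT : 0 < T) (n : ℤ)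
    (hf : ∀ x, HasDerivAt f (f' x) x) (hf' : Continuous f') (hper : f (0 + T) = f 0) (hn : n ≠ 0) :
    ‖fourierCoeffOn (lt_add_of_pos_right 0 hT) f' n‖ =
      2 * Real.pi / T * (|(n : ℝ)| * ‖fourierCoeffOn (lt_add_of_pos_right 0 hT) f n‖) := by
  have hn' : (0 : ℝ) < |(n : ℝ)| := by simpa using hn
  rw [fourierCoeffOn_of_hasDerivAt (lt_add_of_pos_right 0 hT) hn (fun x _ => hf x)
    (hf'.intervalIntegrable _ _), hper, sub_self, mul_zero, zero_sub, norm_mul, norm_neg, norm_mul]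
  simp [abs_of_pos hT, abs_of_pos Real.pi_pos]
  field_simp

theorem lift_eq_liftIoc {g : ℝ → ℝ} (hper : Function.Periodic g (2 * Real.pi)) :
    (fun x => (hper.lift x : ℂ)) = AddCircle.liftIoc (2 * Real.pi) 0 (fun x => (g x : ℂ)) := by
  ext x
  rw [← (AddCircle.equivIoc (2 * Real.pi) 0).symm_apply_apply x]
  generalize AddCircle.equivIoc (2 * Real.pi) 0 x = y
  change ((hper.lift ((y : ℝ) : Torus) : ℝ) : ℂ) =
    AddCircle.liftIoc (2 * Real.pi) 0 (fun x => (g x : ℂ)) ((y : ℝ) : Torus)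
  rw [AddCircle.liftIoc_coe_apply y.2, Function.Periodic.lift_coe]

theorem continuous_lift {g : ℝ → ℝ} (hg : Continuous g)
    (hper : Function.Periodic g (2 * Real.pi)) : Continuous fun x => (hper.lift x : ℂ) := by
  rw [lift_eq_liftIoc]
  refine AddCircle.liftIoc_continuous ?_ (by fun_prop)
  rw [hper]

theorem summable_abs_mul_norm_fc_lift {g : ℝ → ℝ} (hg : ContDiff ℝ 2 g)
    (hper : Function.Periodic g (2 * Real.pi)) :
    Summable fun m : ℤ => |(m : ℝ)| * ‖fc (fun x => (hper.lift x : ℂ)) m‖ := by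
  have hT : 0 < 2 * Real.pi := by positivity
  have hd : ∀ f : ℝ → ℝ, Function.Periodic f (2 * Real.pi) →
      Function.Periodic (deriv f) (2 * Real.pi) := by
    intro f hf x
    rw [← deriv_comp_add_const]
    congr 1
    ext y
    exact hf y
  have h1 : ContDiff ℝ 1 (deriv g) := hg.deriv'
  have h2 : Continuous (deriv (deriv g)) := h1.continuous_deriv le_rfl
  have e1 := fun (n : ℤ) (hn : n ≠ 0) => norm_fourierCoeffOn_deriv (f := fun x => (g x : ℂ))
    (f' := fun x => ((deriv g x : ℝ) : ℂ)) hT n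
    (fun x => ((hg.differentiable (by norm_num)) x).hasDerivAt.ofReal_comp)
    (Complex.continuous_ofReal.comp h1.continuous) (by rw [hper]) hn
  have e2 := fun (n : ℤ) (hn : n ≠ 0) => norm_fourierCoeffOn_deriv (f := fun x => ((deriv g x : ℝ) : ℂ))
    (f' := fun x => ((deriv (deriv g) x : ℝ) : ℂ)) hT n
    (fun x => ((h1.differentiable (by norm_num)) x).hasDerivAt.ofReal_comp)
    (Complex.continuous_ofReal.comp h2) (by rw [hd g hper]) hn
  obtain ⟨B, hB⟩ := isCompact_Icc.exists_bound_of_continuousOn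
    (s := Set.Icc 0 (0 + 2 * Real.pi)) (Complex.continuous_ofReal.comp h2).continuousOn
  have hL2 : MemLp (fun x => ((deriv (deriv g) x : ℝ) : ℂ)) 2
      (volume.restrict (Set.Ioc 0 (0 + 2 * Real.pi))) :=
    MemLp.of_bound (Complex.continuous_ofReal.comp h2).aestronglyMeasurable B
      ((ae_restrict_iff' measurableSet_Ioc).mpr
        (ae_of_all _ fun x hx => hB x (Set.Ioc_subset_Icc_self hx)))
  have hs := (hasSum_sq_fourierCoeffOn (lt_add_of_pos_right 0 hT) hL2).summable
  have hi : Summable fun n : ℤ => 1 / (n : ℝ) ^ 2 := summable_one_div_int_pow.mpr (by norm_num)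
  refine Summable.of_nonneg_of_le (fun m => by positivity) (fun m => ?_) (hi.add hs)
  rw [fc_eq_fourierCoeff, lift_eq_liftIoc, fourierCoeff_liftIoc_eq]
  rcases eq_or_ne m 0 with rfl | hm
  · simp
  · have f1 := e1 m hm
    have f2 := e2 m hm
    rw [div_self hT.ne', one_mul] at f1 f2
    rw [f1] at f2
    rw [f2, ← sq_abs (m : ℝ)]
    have hm' : (0 : ℝ) < |(m : ℝ)| := by simpa using hm
    generalize |(m : ℝ)| * ‖fourierCoeffOn (lt_add_of_pos_right 0 hT) (fun x => (g x : ℂ)) m‖ = y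
    have h3 := sq_nonneg (1 / |(m : ℝ)| - |(m : ℝ)| * y)
    have h4 : 1 / |(m : ℝ)| * (|(m : ℝ)| * y) = y := by field_simp
    have h5 : 1 / |(m : ℝ)| ^ 2 = (1 / |(m : ℝ)|) ^ 2 := by rw [div_pow, one_pow]
    rw [h5]
    nlinarith [sq_nonneg (1 / |(m : ℝ)|), sq_nonneg (|(m : ℝ)| * y)]

theorem summable_of_summable_abs_mul {a : ℤ → ℝ} (ha : ∀ m, 0 ≤ a m)
    (h : Summable fun m : ℤ => |(m : ℝ)| * a m) : Summable a := by
  refine Summable.of_nonneg_of_le ha (fun m => ?_)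
    (h.add (hasSum_ite_eq (0 : ℤ) (a 0)).summable)
  rcases eq_or_ne m 0 with rfl | hm
  · simp
  · have : (1 : ℝ) ≤ |(m : ℝ)| := by exact_mod_cast Int.one_le_abs hm
    simp only [hm, if_false, add_zero]
    nlinarith [ha m]

theorem fc_sub {u v : Torus → ℂ} (hu : Integrable u) (hv : Integrable v) (k : ℤ) :
    fc (fun x => u x - v x) k = fc u k - fc v k := by
  simp only [fc, mul_sub]
  rw [integral_sub (integrable_continuous_mul _ hu) (integrable_continuous_mul _ hv), mul_sub]

theorem fc_congr_ae {u v : Torus → ℂ} (h : u =ᵐ[volume] v) (k : ℤ) : fc u k = fc v k := by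
  simp only [fc]
  congr 1
  apply integral_congr_ae
  filter_upwards [h] with x hx
  rw [hx]

theorem fc_const_mul (c : ℂ) (u : Torus → ℂ) (k : ℤ) : fc (fun x => c * u x) k = c * fc u k := by
  simp only [fc, mul_left_comm _ c, integral_const_mul]

theorem integral_eq_fc_zero (u : Torus → ℂ) : ∫ x, u x = 2 * Real.pi * fc u 0 := by
  have : (Real.pi : ℂ) ≠ 0 := by exact_mod_cast Real.pi_ne_zero
  simp only [fc, neg_zero, fourier_zero, one_mul]
  field_simp

theorem fc_of_isG {g : Torus → ℝ} (f : C(Torus, ℂ)) (hf : ∀ x, f x = g x) {G : L2T →L[ℂ] L2T}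
    (hG : IsG g G) (v : L2T) (k : ℤ) :
    fc (G v : Torus → ℂ) k = fc (fun x => f x * (v : Torus → ℂ) x) k -
      2 * Real.pi * fc (fun x => f x * (v : Torus → ℂ) x) 0 * fc f k := by
  rw [← integral_eq_fc_zero]
  set c := ∫ x, f x * (v : Torus → ℂ) x with hc
  have hv := integrable_continuous_mul f (Lp_integrable v)
  have hcf : Integrable fun x => c * f x :=
    (f.continuous.integrable_of_hasCompactSupport (HasCompactSupport.of_compactSpace _)).const_mul c
  rw [← fc_const_mul, ← fc_sub hv hcf]
  apply fc_congr_ae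
  filter_upwards [hG v] with x hx
  rw [hx, hc]
  simp only [hf]
  ring

theorem sq_sum_three_le (x y z : ℝ) : (x + y + z) ^ 2 ≤ 3 * (x ^ 2 + y ^ 2 + z ^ 2) := by
  nlinarith [sq_nonneg (x - y), sq_nonneg (y - z), sq_nonneg (x - z)]

theorem sum_sq_le_sq_sum {a : ℤ → ℝ} (ha : ∀ m, 0 ≤ a m) (hs : Summable a) :
    (Summable fun m => a m ^ 2) ∧ ∑' m, a m ^ 2 ≤ (∑' m, a m) ^ 2 := by
  have hle : ∀ m, a m ^ 2 ≤ (∑' n, a n) * a m := fun m => by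
    rw [sq]
    exact mul_le_mul_of_nonneg_right (hs.le_tsum m fun j _ => ha j) (ha m)
  have hS := Summable.of_nonneg_of_le (fun m => sq_nonneg _) hle (hs.mul_left _)
  refine ⟨hS, (hS.tsum_le_tsum hle (hs.mul_left _)).trans_eq ?_⟩
  rw [tsum_mul_left, sq]

/-- The commutator of a Fourier multiplier with Lipschitz symbol vanishing at `0` and the
operator `𝒢` is `O(h)` on `L²`. -/
theorem norm_sq_commutator_le {g : Torus → ℝ} (f : C(Torus, ℂ)) (hf : ∀ x, f x = g x)
    (hγ : Summable fun m => ‖fc f m‖) (ha : Summable fun m : ℤ => |(m : ℝ)| * ‖fc f m‖)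
    {χ : ℝ → ℝ} {L : ℝ} (hL : 0 ≤ L) (hχ : ∀ x y, |χ x - χ y| ≤ L * |x - y|) (hχ₀ : χ 0 = 0)
    {h : ℝ} (hh : 0 ≤ h) {M G : L2T →L[ℂ] L2T} (hM : IsMult χ h M) (hG : IsG g G) (v : L2T) :
    ‖M (G v) - G (M v)‖ ^ 2 ≤
      3 * L ^ 2 * (∑' m : ℤ, |(m : ℝ)| * ‖fc f m‖) ^ 2 *
        (1 + 8 * Real.pi ^ 2 * (∑' m, ‖fc f m‖) ^ 2) * h ^ 2 * ‖v‖ ^ 2 := by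
  set γ : ℤ → ℂ := fun m => fc f m with hγdef
  set a : ℤ → ℝ := fun m => |(m : ℝ)| * ‖γ m‖ with hadef
  set w : ℤ → ℝ := fun k => ‖fc (v : Torus → ℂ) k‖ with hwdef
  set A := ∑' m, a m with hA
  set B := ∑' m, ‖γ m‖ with hB
  have ha0 : ∀ m, 0 ≤ a m := fun m => by positivity
  have hA0 : 0 ≤ A := tsum_nonneg ha0
  have hB0 : 0 ≤ B := tsum_nonneg fun m => norm_nonneg _
  have hw := hasSum_sq_fc v
  set N := √(‖v‖ ^ 2 / (2 * Real.pi)) with hN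
  have hN0 : 0 ≤ N := Real.sqrt_nonneg _
  have hN2 : N ^ 2 = ‖v‖ ^ 2 / (2 * Real.pi) := Real.sq_sqrt (by positivity)
  have hwN : ∀ k, w k ≤ N := fun k =>
    Real.le_sqrt_of_sq_le (le_hasSum hw k fun j _ => sq_nonneg _)
  have hχ' : ∀ x, |χ x| ≤ L * |x| := fun x => by simpa [hχ₀] using hχ x 0
  set P : ℤ → ℂ := fc fun x => f x * (v : Torus → ℂ) x with hP
  set Q : ℤ → ℂ := fc fun x => f x * (M v : Torus → ℂ) x with hQ
  have sP : ∀ k, HasSum (fun m => γ m * fc (v : Torus → ℂ) (k - m)) (P k) :=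
    hasSum_fc_mul f hγ v
  have sQ : ∀ k, HasSum (fun m => γ m * (χ (h * (k - m : ℤ)) * fc (v : Torus → ℂ) (k - m)))
      (Q k) := fun k => by
    simpa only [hM v] using hasSum_fc_mul f hγ (M v) k
  have hbd : ∀ k, Summable fun m => a m * w (k - m) := fun k =>
    Summable.of_nonneg_of_le (fun m => mul_nonneg (ha0 m) (norm_nonneg _))
      (fun m => mul_le_mul_of_nonneg_left (hwN _) (ha0 m)) (ha.mul_right N)
  have hcoef : ∀ k, fc ((M (G v) - G (M v) : L2T) : Torus → ℂ) k =
      (χ (h * k) * P k - Q k) - χ (h * k) * (2 * Real.pi * P 0) * γ k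
        + 2 * Real.pi * Q 0 * γ k := fun k => by
    rw [fc_congr_ae (Lp.coeFn_sub _ _),
      show (((M (G v) : L2T) : Torus → ℂ) - (G (M v) : L2T)) =
        fun x => (M (G v) : Torus → ℂ) x - (G (M v) : Torus → ℂ) x from rfl,
      fc_sub (Lp_integrable _) (Lp_integrable _), hM, fc_of_isG f hf hG, fc_of_isG f hf hG]
    ring
  have hPQ : ∀ k : ℤ, ‖χ (h * k) * P k - Q k‖ ≤ L * h * ∑' m, a m * w (k - m) := fun k => by
    have s := ((sP k).mul_left (χ (h * k) : ℂ)).sub (sQ k)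
    rw [← s.tsum_eq]
    refine tsum_of_norm_bounded ((hbd k).hasSum.mul_left (L * h)) fun m => ?_
    have e : (χ (h * k) : ℂ) * (γ m * fc (v : Torus → ℂ) (k - m)) -
        γ m * (χ (h * (k - m : ℤ)) * fc (v : Torus → ℂ) (k - m)) =
        ((χ (h * k) - χ (h * (k - m : ℤ)) : ℝ) : ℂ) * (γ m * fc (v : Torus → ℂ) (k - m)) := by
      push_cast
      ring
    rw [e, norm_mul, norm_mul, Complex.norm_real, Real.norm_eq_abs]
    have h1 := hχ (h * k) (h * (k - m : ℤ))
    rw [show h * (k : ℝ) - h * (k - m : ℤ) = h * m by push_cast; ring, abs_mul,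
      abs_of_nonneg hh] at h1
    refine (mul_le_mul_of_nonneg_right h1 (by positivity)).trans_eq ?_
    simp only [hadef, hwdef]
    ring
  have hP0 : ‖P 0‖ ≤ B * N := by
    rw [← (sP 0).tsum_eq]
    refine tsum_of_norm_bounded (hγ.hasSum.mul_right N) fun m => ?_
    rw [norm_mul]
    exact mul_le_mul_of_nonneg_left (hwN _) (norm_nonneg _)
  have hQ0 : ‖Q 0‖ ≤ L * h * A * N := by
    rw [← (sQ 0).tsum_eq]
    refine tsum_of_norm_bounded ((ha.hasSum.mul_left (L * h)).mul_right N) fun m => ?_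
    rw [norm_mul, norm_mul, Complex.norm_real, Real.norm_eq_abs]
    have h1 := hχ' (h * (0 - m : ℤ))
    rw [show h * ((0 - m : ℤ) : ℝ) = -(h * m) by push_cast; ring, abs_neg, abs_mul,
      abs_of_nonneg hh, ← show h * ((0 - m : ℤ) : ℝ) = -(h * m) by push_cast; ring] at h1
    calc ‖γ m‖ * (|χ (h * (0 - m : ℤ))| * w (0 - m)) ≤ ‖γ m‖ * ((L * (h * |(m : ℝ)|)) * N) := by
          gcongr
          exact hwN _
      _ = L * h * (|(m : ℝ)| * ‖γ m‖) * N := by ring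
  have hck : ∀ k, ‖fc ((M (G v) - G (M v) : L2T) : Torus → ℂ) k‖ ^ 2 ≤
      3 * (L * h) ^ 2 * ((∑' m, a m * w (k - m)) ^ 2 + (2 * Real.pi * B * N) ^ 2 * a k ^ 2 +
        (2 * Real.pi * A * N) ^ 2 * ‖γ k‖ ^ 2) := fun k => by
    have h2 : ‖χ (h * k) * (2 * Real.pi * P 0) * γ k‖ ≤ L * h * (2 * Real.pi * B * N * a k) := by
      have h1 := hχ' (h * k)
      rw [abs_mul, abs_of_nonneg hh] at h1
      simp only [norm_mul, Complex.norm_real, Complex.norm_ofNat, Real.norm_eq_abs,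
        abs_of_pos Real.pi_pos]
      calc |χ (h * k)| * (2 * Real.pi * ‖P 0‖) * ‖γ k‖
          ≤ (L * (h * |(k : ℝ)|)) * (2 * Real.pi * (B * N)) * ‖γ k‖ := by gcongr
        _ = L * h * (2 * Real.pi * B * N * a k) := by simp only [hadef]; ring
    have h3 : ‖2 * Real.pi * Q 0 * γ k‖ ≤ L * h * (2 * Real.pi * A * N * ‖γ k‖) := by
      simp only [norm_mul, Complex.norm_real, Complex.norm_ofNat, Real.norm_eq_abs,
        abs_of_pos Real.pi_pos]
      calc 2 * Real.pi * ‖Q 0‖ * ‖γ k‖ ≤ 2 * Real.pi * (L * h * A * N) * ‖γ k‖ := by gcongr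
        _ = L * h * (2 * Real.pi * A * N * ‖γ k‖) := by ring
    have h4 : ‖fc ((M (G v) - G (M v) : L2T) : Torus → ℂ) k‖ ≤
        L * h * (∑' m, a m * w (k - m) + 2 * Real.pi * B * N * a k +
          2 * Real.pi * A * N * ‖γ k‖) := by
      rw [hcoef k]
      refine (norm_add_le _ _).trans ?_
      refine (add_le_add ((norm_sub_le _ _).trans (add_le_add (hPQ k) h2)) h3).trans_eq ?_
      ring
    calc _ ≤ (L * h * (∑' m, a m * w (k - m) + 2 * Real.pi * B * N * a k +
          2 * Real.pi * A * N * ‖γ k‖)) ^ 2 := by gcongr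
      _ ≤ (L * h) ^ 2 * (3 * ((∑' m, a m * w (k - m)) ^ 2 + (2 * Real.pi * B * N * a k) ^ 2 +
          (2 * Real.pi * A * N * ‖γ k‖) ^ 2)) := by
        rw [mul_pow]
        exact mul_le_mul_of_nonneg_left (sq_sum_three_le _ _ _) (sq_nonneg _)
      _ = _ := by ring
  obtain ⟨yS, yB⟩ := sq_conv_le ha0 ha hw.summable hbd
  obtain ⟨aS, aB⟩ := sum_sq_le_sq_sum ha0 ha
  obtain ⟨gS, gB⟩ := sum_sq_le_sq_sum (fun m => norm_nonneg (γ m)) hγ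
  have total := hasSum_le hck (hasSum_sq_fc _) (((yS.hasSum.add (aS.hasSum.mul_left
    ((2 * Real.pi * B * N) ^ 2))).add (gS.hasSum.mul_left
      ((2 * Real.pi * A * N) ^ 2))).mul_left (3 * (L * h) ^ 2))
  rw [hw.tsum_eq, ← hN2, ← hA] at yB
  rw [div_le_iff₀ (by positivity)] at total
  calc _ ≤ _ := total
    _ ≤ 3 * (L * h) ^ 2 * (A ^ 2 * N ^ 2 + (2 * Real.pi * B * N) ^ 2 * A ^ 2 +
        (2 * Real.pi * A * N) ^ 2 * B ^ 2) * (2 * Real.pi) := by gcongr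
    _ = 3 * L ^ 2 * A ^ 2 * (1 + 8 * Real.pi ^ 2 * B ^ 2) * h ^ 2 * (N ^ 2 * (2 * Real.pi)) := by
        ring
    _ = _ := by rw [hN2, div_mul_cancel₀ _ (by positivity)]

theorem IsLamGroup.norm_sq_eq {lam : ℝ} {S : ℝ → L2T →L[ℂ] L2T} (hS : IsLamGroup lam S) (t : ℝ)
    {u : L2T} (hu : MeanZero u) : ‖S t u‖ ^ 2 = ‖u‖ ^ 2 := by
  have h1 := hasSum_sq_fc (S t u)
  have e : (fun k => ‖fc (S t u : Torus → ℂ) k‖ ^ 2) = fun k => ‖fc (u : Torus → ℂ) k‖ ^ 2 := by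
    ext k
    rcases eq_or_ne k 0 with rfl | hk
    · rw [show fc (S t u : Torus → ℂ) 0 = 0 from (hS t u hu).1,
        show fc (u : Torus → ℂ) 0 = 0 from hu]
    · rw [(hS t u hu).2 k hk, norm_mul, show Complex.I * (t : ℂ) *
        ((k : ℂ) ^ 3 - (lam : ℂ) ^ 2 / (k : ℂ)) =
          ((t * ((k : ℝ) ^ 3 - lam ^ 2 / k) : ℝ) : ℂ) * Complex.I by push_cast; ring,
        Complex.norm_exp_ofReal_mul_I, one_mul]
  rw [e] at h1
  exact (div_left_inj' (by positivity)).mp (h1.unique (hasSum_sq_fc u))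

/-- Lemma 3.5, commutator estimate: if `χ` is smooth, `1 - χ` compactly
supported, `χ = 0` on `{|ξ| ≤ 1}` and `χ = 1` on `{|ξ| ≥ 2}`, then for every `T > 0` there is
`C > 0` such that, uniformly in `h ∈ (0,1)` and `λ ≥ 0`,
`∫₀ᵀ ‖[χ(hDₓ), 𝒢](S_λ(t)u₀)‖² dt ≤ C h² ‖u₀‖²` for all `u₀ ∈ L²₀(𝕋)`. -/
theorem commutator_estimate
    -- `g` is a fixed real-valued C² function on `𝕋` (2π-periodic on `ℝ`), nonnegative,
    -- with integral 1, vanishing outside `(a,b) ⊂ (-π,π)`: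
    (g : ℝ → ℝ) (hg_reg : ContDiff ℝ 2 g) (hg_per : Function.Periodic g (2 * Real.pi))
    (hg_nonneg : ∀ x, 0 ≤ g x)
    (a b : ℝ) (ha : -Real.pi < a) (hab : a < b) (hb : b < Real.pi)
    (hg_supp : ∀ x ∈ Set.Ioc (-Real.pi) Real.pi, g x ≠ 0 → x ∈ Set.Ioo a b)
    (hg_int : ∫ x in (-Real.pi)..Real.pi, g x = 1)
    (χ : ℝ → ℝ) (hχ_reg : ContDiff ℝ (⊤ : ℕ∞) χ)
    (hχ_supp : HasCompactSupport (fun ξ => 1 - χ ξ))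
    (hχ₀ : ∀ ξ : ℝ, |ξ| ≤ 1 → χ ξ = 0) (hχ₁ : ∀ ξ : ℝ, 2 ≤ |ξ| → χ ξ = 1)
    (T : ℝ) (hT : 0 < T) :
    ∃ C : ℝ, 0 < C ∧
      ∀ h : ℝ, h ∈ Set.Ioo (0:ℝ) 1 →
        ∀ M : L2T →L[ℂ] L2T, IsMult χ h M →
          ∀ lam : ℝ, 0 ≤ lam →
            ∀ S : ℝ → L2T →L[ℂ] L2T, IsLamGroup lam S →
              ∀ G : L2T →L[ℂ] L2T, IsG hg_per.lift G →
                ∀ u₀ : L2T, MeanZero u₀ →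
                  (∫ t in (0:ℝ)..T, ‖M (G (S t u₀)) - G (M (S t u₀))‖ ^ 2) ≤
                    C * h ^ 2 * ‖u₀‖ ^ 2 := by

  obtain ⟨L, hL⟩ := ((contDiff_const (c := (1 : ℝ))).sub hχ_reg).lipschitzWith_of_hasCompactSupport
    hχ_supp (by simp)
  have hχL : ∀ x y, |χ x - χ y| ≤ L * |x - y| := fun x y => by
    have := hL.dist_le_mul x y
    rwa [Real.dist_eq, Real.dist_eq, sub_sub_sub_cancel_left, abs_sub_comm] at this
  let f : C(Torus, ℂ) := ⟨fun x => (hg_per.lift x : ℂ), continuous_lift hg_reg.continuous hg_per⟩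
  have ha := summable_abs_mul_norm_fc_lift hg_reg hg_per
  have hγ := summable_of_summable_abs_mul (fun m => norm_nonneg _) ha
  set K := 3 * (L : ℝ) ^ 2 * (∑' m : ℤ, |(m : ℝ)| * ‖fc f m‖) ^ 2 *
    (1 + 8 * Real.pi ^ 2 * (∑' m, ‖fc f m‖) ^ 2)
  have hK : 0 ≤ K := by positivity
  refine ⟨K * T + 1, by positivity, fun h hh M hM lam _ S hS G hG u₀ hu => ?_⟩
  have hbound := intervalIntegral.norm_integral_le_of_norm_le_const (a := 0) (b := T)
    (f := fun t => ‖M (G (S t u₀)) - G (M (S t u₀))‖ ^ 2) (C := K * h ^ 2 * ‖u₀‖ ^ 2)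
    fun t _ => by
      rw [norm_pow, norm_norm, ← hS.norm_sq_eq t hu]
      exact norm_sq_commutator_le f (fun _ => rfl) hγ ha L.2 hχL (hχ₀ 0 (by simp)) hh.1.le hM hG _
  rw [sub_zero, abs_of_pos hT] at hbound
  refine (le_abs_self _).trans (hbound.trans ?_)
  have : 0 ≤ h ^ 2 * ‖u₀‖ ^ 2 := by positivity
  nlinarith
end
end
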